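/- arXiv:1404.1298 — 2 statements merged into one kernel-verified Lean document; each statement's English description precedes it below -/
import Mathlib

section
/- Let S ⊆ ℝ² be a convex compact set, X ⊆ ℝ² a finite point set, and k ≥ 1 an integer. Then the number of non-empty subsets Y ⊆ X with |Y| ≤ k for which there exists an S-range S' with X ∩ S' = Y is at most k²·|X|. -/
open Set

noncomputable section

/-- The Euclidean plane. -/
abbrev Pt : Type := EuclideanSpace ℝ (Fin 2)

/-- `T` is an `S`-range: a homothetic copy of `S` with positive ratio. -/
def IsRange (S T : Set Pt) : Prop :=
  ∃ (c : ℝ) (v : Pt), 0 < c ∧ T = (fun x => c • x + v) '' S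

/-- A straight line in the plane. -/
def IsLine (l : Set Pt) : Prop :=
  ∃ (f : Pt →ₗ[ℝ] ℝ) (a : ℝ), f ≠ 0 ∧ l = {x | f x = a}

/-- A closed halfplane. -/
def IsClosedHalfplane (H : Set Pt) : Prop :=
  ∃ (f : Pt →ₗ[ℝ] ℝ) (a : ℝ), f ≠ 0 ∧ H = {x | f x ≤ a}

/-- An open halfplane bounded by the line through `p` and `q`. -/
def IsOpenHalfplaneOf (p q : Pt) (L : Set Pt) : Prop :=
  ∃ (f : Pt →ₗ[ℝ] ℝ) (a : ℝ), f ≠ 0 ∧ f p = a ∧ f q = a ∧ L = {x | a < f x}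

/-- `S` is a nice shape: a non-empty convex compact set such that every boundary
point has exactly one touching line and the boundary contains no non-trivial
straight line segment. -/
def NiceShape (S : Set Pt) : Prop :=
  S.Nonempty ∧ Convex ℝ S ∧ IsCompact S ∧
  (∀ p ∈ frontier S, ∃! l : Set Pt, IsLine l ∧ l ∩ S = {p}) ∧
  (∀ x ∈ frontier S, ∀ y ∈ frontier S, segment ℝ x y ⊆ frontier S → x = y)

/-- No four points of `A` lie on the boundary of a common `S`-range. -/
def NoFourOnBoundary (S A : Set Pt) : Prop :=
  ∀ T : Set Pt, IsRange S T →
    ∀ p₁ p₂ p₃ p₄ : Pt, p₁ ∈ A ∩ frontier T → p₂ ∈ A ∩ frontier T →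
      p₃ ∈ A ∩ frontier T → p₄ ∈ A ∩ frontier T →
      p₁ ≠ p₂ → p₁ ≠ p₃ → p₁ ≠ p₄ → p₂ ≠ p₃ → p₂ ≠ p₄ → p₃ ≠ p₄ → False

/-- `X` is in general position with respect to `S`: no two points on a vertical
line, no three points collinear, and no four points on the boundary of a common
`S`-range. -/
def GenPos (S : Set Pt) (X : Finset Pt) : Prop :=
  (∀ p ∈ X, ∀ q ∈ X, p ≠ q → p 0 ≠ q 0) ∧
  (∀ p ∈ X, ∀ q ∈ X, ∀ r ∈ X, p ≠ q → p ≠ r → q ≠ r →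
    ¬ Collinear ℝ ({p, q, r} : Set Pt)) ∧
  NoFourOnBoundary S ↑X

/-- The hyperedges of the `k`-uniform `S`-capturing hypergraph on `X`:
`k`-element subsets of `X` captured by some `S`-range. -/
def capturedSets (S : Set Pt) (X : Finset Pt) (k : ℕ) : Set (Set Pt) :=
  {Y | Y ⊆ ↑X ∧ Y.ncard = k ∧ ∃ T : Set Pt, IsRange S T ∧ ↑X ∩ T = Y}

/-- The `i`-sets of `X`: `i`-element subsets of `X` separable by a straight line,
i.e. captured by a closed halfplane.  `aᵢ` is the number of such sets. -/
def iSets (X : Finset Pt) (i : ℕ) : Set (Set Pt) :=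
  {Y | Y ⊆ ↑X ∧ Y.ncard = i ∧ ∃ H : Set Pt, IsClosedHalfplane H ∧ ↑X ∩ H = Y}

/-- `𝒜ᵢ`: closed halfplanes containing exactly `i` points of `X`, exactly two of
which lie on the boundary line. -/
def repHalfplanes (X : Finset Pt) (i : ℕ) : Set (Set Pt) :=
  {H | IsClosedHalfplane H ∧ ((↑X : Set Pt) ∩ H).ncard = i ∧
    ((↑X : Set Pt) ∩ frontier H).ncard = 2}

/-- `𝒮_pq`: the `S`-ranges having both `p` and `q` on their boundary. -/
def rangesThrough (S : Set Pt) (p q : Pt) : Set (Set Pt) :=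
  {T | IsRange S T ∧ p ∈ frontier T ∧ q ∈ frontier T}

/-- The ranges in `𝒮_pq` that come strictly after `S₁` (w.r.t. `≺`, i.e. inclusion
of the intersections with `L`) and have a point of `X` on their boundary that is
not on the boundary of `S₁`. -/
def nextCandidates (S : Set Pt) (p q : Pt) (L : Set Pt) (X : Finset Pt) (S₁ : Set Pt) :
    Set (Set Pt) :=
  {S₂ | S₂ ∈ rangesThrough S p q ∧ S₁ ∩ L ⊂ S₂ ∩ L ∧
    ((frontier S₂ \ frontier S₁) ∩ ↑X).Nonempty}

/-- `ℛ₁ᵏ`: Type I ranges, i.e. `S`-ranges containing exactly `k` points of `X`,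
exactly three of which are on the boundary. -/
def typeIRanges (S : Set Pt) (X : Finset Pt) (k : ℕ) : Set (Set Pt) :=
  {T | IsRange S T ∧ ((↑X : Set Pt) ∩ T).ncard = k ∧
    ((↑X : Set Pt) ∩ frontier T).ncard = 3}

/-- `ℛ(Y)`: the Type I representative ranges of `Y`. -/
def repRanges (S : Set Pt) (X : Finset Pt) (Y : Set Pt) : Set (Set Pt) :=
  {T | IsRange S T ∧ ↑X ∩ T = Y ∧ ((↑X : Set Pt) ∩ frontier T).ncard = 3}

/-- `ℰ₁ᵏ`: Type I hyperedges. -/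
def typeIEdges (S : Set Pt) (X : Finset Pt) (k : ℕ) : Set (Set Pt) :=
  {Y | Y ⊆ ↑X ∧ Y.ncard = k ∧ (repRanges S X Y).Nonempty}

/-- `ℰ₂ᵏ`: Type II hyperedges, captured by some `S`-range but by no `S`-range with
three points of `X` on its boundary. -/
def typeIIEdges (S : Set Pt) (X : Finset Pt) (k : ℕ) : Set (Set Pt) :=
  {Y | Y ∈ capturedSets S X k ∧ ¬ (repRanges S X Y).Nonempty}

/-- A point lies in two convex regions `{x | l • x + w ∈ S}` and `{x | l' • x + w' ∈ S}`; walk from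
it to a point of the first region along `e` and to a point of the second one against `e'`. If the
displacement between the regions is a nonnegative combination of `e` and `e'`, one of the two
endpoints belongs to both regions. -/
theorem Convex.mem_or_mem_of_displacement {S : Set Pt} (hS : Convex ℝ S) {l l' : ℝ} (hl' : 0 < l')
    (hll : l' ≤ l) {w w' m e e' : Pt} {β α ξ ξ' : ℝ} (hβ : 0 ≤ β) (hα : 0 ≤ α) (hξ : 0 ≤ ξ)
    (hξ' : 0 ≤ ξ') (hd : l • m + w = l' • m + w' + ξ • e + ξ' • e')
    (hm : l • m + w ∈ S) (hm' : l' • m + w' ∈ S)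
    (hb : l • (m + β • e) + w ∈ S) (ha : l' • (m - α • e') + w' ∈ S) :
    l' • (m + β • e) + w' ∈ S ∨ l • (m - α • e') + w ∈ S := by
  rcases hβ.eq_or_lt with rfl | hβ
  · left; simpa using hm'
  rcases hα.eq_or_lt with rfl | hα
  · right; simpa using hm
  have hl : 0 < l := hl'.trans_le hll
  have hw : w = l' • m + w' + ξ • e + ξ' • e' - l • m := by rw [← hd]; abel
  have comb : ∀ {x y z : Pt} {a b c : ℝ}, x ∈ S → y ∈ S → z ∈ S → 0 ≤ a → 0 ≤ b → 0 ≤ c →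
      a + b + c = 1 → a • x + b • y + c • z ∈ S := by
    intro x y z a b c hx hy hz h1 h2 h3 h4
    have := hS.sum_mem (t := Finset.univ) (w := ![a, b, c]) (z := ![x, y, z])
      (by intro i _; fin_cases i <;> simpa) (by simp [Fin.sum_univ_three, h4])
      (by intro i _; fin_cases i <;> simpa)
    simpa [Fin.sum_univ_three] using this
  have h1 : 0 < ξ + l * β := by positivity
  have h2 : 0 < ξ' + l' * α := by positivity
  rcases le_or_gt (l' * β * α + β * ξ') (α * ξ + l * α * β) with h | h
  · left
    have key := comb hb ha hm' (a := l' * β / (ξ + l * β)) (b := β * ξ' / ((ξ + l * β) * α))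
      (c := 1 - l' * β / (ξ + l * β) - β * ξ' / ((ξ + l * β) * α)) (by positivity) (by positivity)
      (by
        have : l' * β / (ξ + l * β) + β * ξ' / ((ξ + l * β) * α) ≤ 1 := by
          rw [div_add_div _ _ h1.ne' (by positivity), div_le_one (by positivity)]
          nlinarith
        linarith) (by ring)
    convert key using 1
    rw [hw]
    match_scalars <;> field_simp <;> ring
  · right
    have key := comb ha hb hm (a := l * α / (ξ' + l' * α)) (b := α * ξ / ((ξ' + l' * α) * β))
      (c := 1 - l * α / (ξ' + l' * α) - α * ξ / ((ξ' + l' * α) * β)) (by positivity) (by positivity)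
      (by
        have : l * α / (ξ' + l' * α) + α * ξ / ((ξ' + l' * α) * β) ≤ 1 := by
          rw [div_add_div _ _ h2.ne' (by positivity), div_le_one (by positivity)]
          nlinarith
        linarith) (by ring)
    convert key using 1
    rw [hw]
    match_scalars <;> field_simp <;> ring

theorem Convex.crossing_of_le {S : Set Pt} (hS : Convex ℝ S) {l l' : ℝ} (hl' : 0 < l')
    (hll : l' ≤ l) {w w' m e e' : Pt} {β α β' α' ξ ξ' : ℝ} (hβ : 0 ≤ β) (hα : 0 ≤ α) (hβ' : 0 ≤ β')
    (hα' : 0 ≤ α') (hd : l • m + w = l' • m + w' + ξ • e + ξ' • e')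
    (hm : l • m + w ∈ S) (hm' : l' • m + w' ∈ S)
    (hb : l • (m + β • e) + w ∈ S) (ha : l • (m - α • e) + w ∈ S)
    (hb' : l' • (m + β' • e') + w' ∈ S) (ha' : l' • (m - α' • e') + w' ∈ S) :
    (l' • (m + β • e) + w' ∈ S ∨ l' • (m - α • e) + w' ∈ S) ∨
      (l • (m + β' • e') + w ∈ S ∨ l • (m - α' • e') + w ∈ S) := by
  rcases le_total 0 ξ with h | h <;> rcases le_total 0 ξ' with h' | h'
  · have := hS.mem_or_mem_of_displacement hl' hll hβ hα' h h' hd hm hm' hb ha'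
    tauto
  · have := hS.mem_or_mem_of_displacement (e' := -e') (ξ' := -ξ') hl' hll hβ hβ' h (by linarith)
      (by simpa using hd) hm hm' hb (by simpa using hb')
    simp only [smul_neg, sub_neg_eq_add] at this
    tauto
  · have := hS.mem_or_mem_of_displacement (e := -e) (ξ := -ξ) hl' hll hα hα' (by linarith) h'
      (by simpa using hd) hm hm' (by simpa [← sub_eq_add_neg] using ha) ha'
    simp only [smul_neg, ← sub_eq_add_neg] at this
    tauto
  · have := hS.mem_or_mem_of_displacement (e := -e) (ξ := -ξ) (e' := -e') (ξ' := -ξ') hl' hll hα hβ'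
      (by linarith) (by linarith)
      (by simpa using hd) hm hm' (by simpa [← sub_eq_add_neg] using ha) (by simpa using hb')
    simp only [smul_neg, ← sub_eq_add_neg, sub_neg_eq_add] at this
    tauto

/-- Two homothetic copies of a convex set cannot cross: if a segment of the one meets a segment of
the other transversally, one of the four endpoints lies in both copies. -/
theorem Convex.crossing {S : Set Pt} (hS : Convex ℝ S) {l l' : ℝ} (hl : 0 < l) (hl' : 0 < l')
    {w w' m e e' : Pt} {β α β' α' ξ ξ' : ℝ} (hβ : 0 ≤ β) (hα : 0 ≤ α) (hβ' : 0 ≤ β')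
    (hα' : 0 ≤ α') (hd : l • m + w = l' • m + w' + ξ • e + ξ' • e')
    (hm : l • m + w ∈ S) (hm' : l' • m + w' ∈ S)
    (hb : l • (m + β • e) + w ∈ S) (ha : l • (m - α • e) + w ∈ S)
    (hb' : l' • (m + β' • e') + w' ∈ S) (ha' : l' • (m - α' • e') + w' ∈ S) :
    (l' • (m + β • e) + w' ∈ S ∨ l' • (m - α • e) + w' ∈ S) ∨
      (l • (m + β' • e') + w ∈ S ∨ l • (m - α' • e') + w ∈ S) := by
  rcases le_total l' l with h | h
  · exact hS.crossing_of_le hl' h hβ hα hβ' hα' hd hm hm' hb ha hb' ha'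
  · refine (hS.crossing_of_le hl h (ξ := -ξ') (ξ' := -ξ) hβ' hα' hβ hα ?_ hm' hm hb' ha' hb ha).symm
    rw [hd]; module

theorem interior_setOf_smul_add_mem (S : Set Pt) {l : ℝ} (hl : l ≠ 0) (w : Pt) :
    interior {x | l • x + w ∈ S} = {x | l • x + w ∈ interior S} :=
  (((Homeomorph.smulOfNeZero l hl).trans (Homeomorph.addRight w)).preimage_interior S).symm

/-- Three distinct points of a strictly convex set that are not interior are not collinear. -/
theorem StrictConvex.det_ne_zero {S : Set Pt} (hS : StrictConvex ℝ S) {x y z : Pt}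
    (hx : x ∈ S \ interior S) (hy : y ∈ S \ interior S) (hz : z ∈ S \ interior S)
    (hxy : x ≠ y) (hxz : x ≠ z) (hyz : y ≠ z) :
    (y 0 - x 0) * (z 1 - x 1) - (y 1 - x 1) * (z 0 - x 0) ≠ 0 := by
  intro h
  have hne : y 0 - x 0 ≠ 0 ∨ y 1 - x 1 ≠ 0 := by
    by_contra! hc
    apply hxy
    ext i; fin_cases i <;> simp <;> linarith
  have hcol : ∃ t : ℝ, z = x + t • (y - x) := by
    rcases hne with h0 | h0
    · refine ⟨(z 0 - x 0) / (y 0 - x 0), ?_⟩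
      ext i; fin_cases i <;> simp <;> field_simp <;> linarith
    · refine ⟨(z 1 - x 1) / (y 1 - x 1), ?_⟩
      ext i; fin_cases i <;> simp <;> field_simp <;> linarith
  obtain ⟨t, ht⟩ := hcol
  have t0 : t ≠ 0 := by rintro rfl; apply hxz; simp [ht]
  have t1 : t ≠ 1 := by rintro rfl; apply hyz; simp [ht]
  rcases lt_or_gt_of_ne t0 with h0 | h0
  · refine hyz (hS.eq hy.1 hz.1 (a := -t / (1 - t)) (b := 1 / (1 - t))
      (div_pos (by linarith) (by linarith)) (div_pos (by linarith) (by linarith)) ?_ ?_)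
    · have : 1 - t ≠ 0 := by linarith
      field_simp; ring
    · have : 1 - t ≠ 0 := by linarith
      convert hx.2 using 3
      rw [ht]; match_scalars <;> field_simp <;> ring
  rcases lt_or_gt_of_ne t1 with h1 | h1
  · refine hxy (hS.eq hx.1 hy.1 (a := 1 - t) (b := t) (by linarith) h0 (by ring) ?_)
    convert hz.2 using 3
    rw [ht]; module
  · refine hxz (hS.eq hx.1 hz.1 (a := 1 - 1 / t) (b := 1 / t)
      (by rw [sub_pos, div_lt_one h0]; exact h1) (by positivity) (by ring) ?_)
    convert hy.2 using 3
    rw [ht]; match_scalars <;> field_simp <;> ring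

theorem StrictConvex.eq_of_smul_eq {S : Set Pt} (hS : StrictConvex ℝ S) {x p y z : Pt} {β γ : ℝ}
    (hβ : 0 ≤ β) (hγ : 0 ≤ γ) (hp : p ∈ S) (hy : y ∈ S) (hz : z ∈ S) (hx : x ∉ interior S)
    (h : (1 + β + γ) • x = p + β • y + γ • z) : p = x := by
  rcases (add_nonneg hβ hγ).eq_or_lt with h0 | h0
  · obtain rfl : β = 0 := by linarith
    obtain rfl : γ = 0 := by linarith
    simpa using h.symm
  have hq : (β / (β + γ)) • y + (γ / (β + γ)) • z ∈ S :=
    hS.convex hy hz (by positivity) (by positivity) (by field_simp)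
  have hx' : x = (1 / (1 + β + γ)) • p +
      ((β + γ) / (1 + β + γ)) • ((β / (β + γ)) • y + (γ / (β + γ)) • z) := by
    have h1 : 1 + β + γ ≠ 0 := by positivity
    have h2 : x = (1 / (1 + β + γ)) • ((1 + β + γ) • x) := by
      rw [smul_smul]; field_simp; simp
    rw [h2, h]
    match_scalars <;> field_simp
  have hpq := hS.eq hp hq (a := 1 / (1 + β + γ)) (b := (β + γ) / (1 + β + γ))
    (by positivity) (by positivity) (by field_simp; ring) (hx' ▸ hx)
  rw [← hpq, ← add_smul] at hx'
  rw [hx']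
  have : 1 / (1 + β + γ) + (β + γ) / (1 + β + γ) = 1 := by field_simp; ring
  rw [this, one_smul]

theorem StrictConvex.eq_zero_of_smul_sub {S : Set Pt} (hS : StrictConvex ℝ S) {x y z : Pt}
    (hx : x ∈ S \ interior S) (hy : y ∈ S \ interior S) (hz : z ∈ S \ interior S)
    (hxy : x ≠ y) (hxz : x ≠ z) (hyz : y ≠ z) {a b : ℝ}
    (h : a • (y - x) + b • (z - x) = 0) : a = 0 ∧ b = 0 := by
  have hdet := hS.det_ne_zero hx hy hz hxy hxz hyz
  have h0 := congrArg (fun v : Pt => v 0) h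
  have h1 := congrArg (fun v : Pt => v 1) h
  simp at h0 h1
  constructor
  · apply (mul_eq_zero.1 (_ : a * _ = 0)).resolve_right hdet
    linear_combination (z 1 - x 1) * h0 - (z 0 - x 0) * h1
  · apply (mul_eq_zero.1 (_ : b * _ = 0)).resolve_right hdet
    linear_combination (y 0 - x 0) * h1 - (y 1 - x 1) * h0

theorem StrictConvex.exists_smul_sub {S : Set Pt} (hS : StrictConvex ℝ S) {x y z : Pt}
    (hx : x ∈ S \ interior S) (hy : y ∈ S \ interior S) (hz : z ∈ S \ interior S)
    (hxy : x ≠ y) (hxz : x ≠ z) (hyz : y ≠ z) (v : Pt) :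
    ∃ a b : ℝ, v = a • (y - x) + b • (z - x) := by
  have hdet := hS.det_ne_zero hx hy hz hxy hxz hyz
  refine ⟨(v 0 * (z 1 - x 1) - v 1 * (z 0 - x 0)) /
    ((y 0 - x 0) * (z 1 - x 1) - (y 1 - x 1) * (z 0 - x 0)),
    ((y 0 - x 0) * v 1 - (y 1 - x 1) * v 0) /
    ((y 0 - x 0) * (z 1 - x 1) - (y 1 - x 1) * (z 0 - x 0)), ?_⟩
  ext i
  fin_cases i <;> simp <;>
    rw [div_mul_eq_mul_div, div_mul_eq_mul_div, ← add_div, eq_div_iff hdet] <;> ring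

section

variable {S : Set Pt} {x y z x' y' z' : Pt} {a b c : ℝ}

/-- Three boundary points are moved to boundary points by an affine map whose barycentric
displacements have two nonpositive coordinates: the map is the identity. -/
theorem StrictConvex.eq_zero_of_nonpos (hS : StrictConvex ℝ S)
    (hx : x ∈ S \ interior S) (hy : y ∈ S \ interior S) (hz : z ∈ S \ interior S)
    (hx' : x' ∈ S) (hy' : y' ∈ S)
    (hxy : x ≠ y) (hxz : x ≠ z) (hyz : y ≠ z) (habc : a + b + c ≤ 0)
    (ex : x' = x + b • (y - x) + c • (z - x)) (ey : y' = y + a • (x - y) + c • (z - y))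
    (hb : b ≤ 0) (hc : c ≤ 0) : a = 0 ∧ b = 0 ∧ c = 0 := by
  have h1 := hS.eq_of_smul_eq (β := -b) (γ := -c) (by linarith) (by linarith) hx' hy.1 hz.1 hx.2
    (by rw [ex]; module)
  obtain ⟨rfl, rfl⟩ := hS.eq_zero_of_smul_sub hx hy hz hxy hxz hyz (a := b) (b := c) (by
    rw [h1, add_assoc] at ex
    exact left_eq_add.1 ex)
  have h2 := hS.eq_of_smul_eq (β := -a) (γ := 0) (by linarith) le_rfl hy' hx.1 hz.1 hy.2
    (by rw [ey]; module)
  rw [h2] at ey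
  simp [sub_eq_zero, hxy] at ey
  exact ⟨ey, rfl, rfl⟩

theorem StrictConvex.not_pos_of_pos (hS : StrictConvex ℝ S)
    (hx : x ∈ S \ interior S) (hy : y ∈ S \ interior S) (hz : z ∈ S \ interior S)
    (hx' : x' ∈ S \ interior S) (hy' : y' ∈ S) (hz' : z' ∈ S)
    (hxy : x ≠ y) (hxz : x ≠ z) (hyz : y ≠ z) (habc : a + b + c ≤ 0)
    (ex : x' = x + b • (y - x) + c • (z - x)) (ey : y' = y + a • (x - y) + c • (z - y))
    (ez : z' = z + a • (x - z) + b • (y - z)) (hb : 0 < b) (hc : 0 < c) : False := by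
  have hk : 0 < 1 - (a + b + c) := by linarith
  have h1 := hS.eq_of_smul_eq (β := b / (1 - (a + b + c))) (γ := c / (1 - (a + b + c)))
    (by positivity) (by positivity) hx.1 hy' hz' hx'.2
    (by
      have := hk.ne'
      rw [ex, ey, ez]
      match_scalars <;> field_simp <;> ring)
  have := hS.eq_zero_of_smul_sub hx hy hz hxy hxz hyz (a := b) (b := c) (by
    rw [← h1, add_assoc] at ex
    exact left_eq_add.1 ex)
  linarith [this.1]

theorem StrictConvex.eq_zero_of_barycentric (hS : StrictConvex ℝ S)
    (hx : x ∈ S \ interior S) (hy : y ∈ S \ interior S) (hz : z ∈ S \ interior S)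
    (hx' : x' ∈ S \ interior S) (hy' : y' ∈ S \ interior S) (hz' : z' ∈ S \ interior S)
    (hxy : x ≠ y) (hxz : x ≠ z) (hyz : y ≠ z) (habc : a + b + c ≤ 0)
    (ex : x' = x + b • (y - x) + c • (z - x)) (ey : y' = y + a • (x - y) + c • (z - y))
    (ez : z' = z + a • (x - z) + b • (y - z)) : a = 0 ∧ b = 0 ∧ c = 0 := by
  rcases le_or_gt a 0 with ha | ha <;> rcases le_or_gt b 0 with hb | hb <;>
    rcases le_or_gt c 0 with hc | hc
  · exact hS.eq_zero_of_nonpos hx hy hz hx'.1 hy'.1 hxy hxz hyz habc ex ey hb hc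
  · have := hS.eq_zero_of_nonpos hz hx hy hz'.1 hx'.1 hxz.symm hyz.symm hxy (a := c) (b := a)
      (c := b) (by linarith) ez (by rw [ex]; abel) ha hb
    tauto
  · have := hS.eq_zero_of_nonpos hy hx hz hy'.1 hx'.1 hxy.symm hyz hxz (a := b) (b := a)
      (c := c) (by linarith) ey ex ha hc
    tauto
  · exact (hS.not_pos_of_pos hx hy hz hx' hy'.1 hz'.1 hxy hxz hyz habc ex ey ez hb hc).elim
  · exact hS.eq_zero_of_nonpos hx hy hz hx'.1 hy'.1 hxy hxz hyz habc ex ey hb hc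
  · exact (hS.not_pos_of_pos hy hx hz hy' hx'.1 hz'.1 hxy.symm hyz hxz (a := b) (b := a)
      (c := c) (by linarith) ey ex (by rw [ez]; abel) ha hc).elim
  · exact (hS.not_pos_of_pos hz hx hy hz' hx'.1 hy'.1 hxz.symm hyz.symm hxy (a := c) (b := a)
      (c := b) (by linarith) ez (by rw [ex]; abel) (by rw [ey]; abel) ha hb).elim
  · linarith

end

theorem StrictConvex.range_unique_of_le {S : Set Pt} (hS : StrictConvex ℝ S) {l l' : ℝ} {w w' : Pt}
    (hl : 0 < l) (hll : l ≤ l') {x y z : Pt} (hxy : x ≠ y) (hxz : x ≠ z) (hyz : y ≠ z)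
    (hx : l • x + w ∈ S \ interior S) (hy : l • y + w ∈ S \ interior S)
    (hz : l • z + w ∈ S \ interior S) (hx' : l' • x + w' ∈ S \ interior S)
    (hy' : l' • y + w' ∈ S \ interior S) (hz' : l' • z + w' ∈ S \ interior S) :
    l = l' ∧ w = w' := by
  have inj : ∀ {u v : Pt}, u ≠ v → l • u + w ≠ l • v + w := by
    intro u v huv h
    exact huv (smul_right_injective _ hl.ne' (add_right_cancel h))
  obtain ⟨b, c, hbc⟩ := hS.exists_smul_sub hx hy hz (inj hxy) (inj hxz) (inj hyz)
    (l' • x + w' - (l • x + w))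
  have hw : w' = b • (l • y - l • x) + c • (l • z - l • x) + l • x + w - l' • x := by
    have : w' = (l' • x + w' - (l • x + w)) + (l • x + w) - l' • x := by abel
    rw [this, hbc]; module
  have h := hS.eq_zero_of_barycentric (a := -(l' / l - 1) - b - c) (b := b) (c := c)
    hx hy hz hx' hy' hz' (inj hxy) (inj hxz) (inj hyz)
    (by
      have : 1 ≤ l' / l := (one_le_div hl).2 hll
      linarith)
    (by rw [hw]; match_scalars <;> field_simp <;> ring)
    (by rw [hw]; match_scalars <;> field_simp <;> ring)
    (by rw [hw]; match_scalars <;> field_simp <;> ring)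
  obtain ⟨ha, rfl, rfl⟩ := h
  have e : l = l' := by
    have : l' / l = 1 := by linarith
    rw [div_eq_one_iff_eq hl.ne'] at this
    exact this.symm
  subst e
  exact ⟨rfl, by rw [hw]; module⟩

/-- At most one homothetic copy of a strictly convex set has three given points on its boundary. -/
theorem StrictConvex.range_unique {S : Set Pt} (hS : StrictConvex ℝ S) {l l' : ℝ} {w w' : Pt}
    (hl : 0 < l) (hl' : 0 < l') {x y z : Pt} (hxy : x ≠ y) (hxz : x ≠ z) (hyz : y ≠ z)
    (hx : l • x + w ∈ S \ interior S) (hy : l • y + w ∈ S \ interior S)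
    (hz : l • z + w ∈ S \ interior S) (hx' : l' • x + w' ∈ S \ interior S)
    (hy' : l' • y + w' ∈ S \ interior S) (hz' : l' • z + w' ∈ S \ interior S) :
    l = l' ∧ w = w' := by
  rcases le_total l l' with h | h
  · exact hS.range_unique_of_le hl h hxy hxz hyz hx hy hz hx' hy' hz'
  · have := hS.range_unique_of_le hl' h hxy hxz hyz hx' hy' hz' hx hy hz
    exact ⟨this.1.symm, this.2.symm⟩

open Filter Topology in
theorem Convex.not_straddle {S : Set Pt} (hS : Convex ℝ S) (hc : IsClosed S) {l₁ l₂ : ℝ}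
    (hl₁ : 0 < l₁) (hl₂ : 0 < l₂) {w₁ w₂ d x x' p : Pt} {t : ℝ} (hd0 : d 0 = 0) (hd1 : d 1 ≠ 0)
    (hx : l₁ • x + w₁ ∈ S) (hx₂ : l₂ • x + w₂ ∉ S) (hx' : l₁ • x' + w₁ ∈ S)
    (hx'₂ : l₂ • x' + w₂ ∉ S) (hxp : x 0 < p 0) (hpx' : p 0 < x' 0)
    (hlow : ∀ s : ℝ, 0 < s → l₁ • (p - s • d) + w₁ ∉ S) (hp : l₂ • p + w₂ ∈ S)
    (ht : l₂ • (p + t • d) + w₂ ∈ S) (htop : ∀ s ≥ t, l₁ • (p + s • d) + w₁ ∉ S) : False := by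
  have he : 0 < x' 0 - x 0 := by linarith
  obtain ⟨α, hα⟩ : ∃ α : ℝ, α = (p 0 - x 0) / (x' 0 - x 0) := ⟨_, rfl⟩
  have hα0 : 0 ≤ α := by rw [hα]; exact div_nonneg (by linarith) he.le
  have hα1 : 0 ≤ 1 - α := by rw [hα, sub_nonneg, div_le_one he]; linarith
  obtain ⟨μ, hμ⟩ : ∃ μ : ℝ, x + α • (x' - x) = p + μ • d := by
    refine ⟨(x 1 + α * (x' 1 - x 1) - p 1) / d 1, ?_⟩
    ext i
    fin_cases i
    · simp [hd0, hα]; field_simp; ring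
    · simp; field_simp; ring
  have hm : l₁ • (p + μ • d) + w₁ ∈ S := by
    rw [← hμ]
    have := hS hx hx' hα1 hα0 (by ring)
    convert this using 1; module
  have hμ0 : 0 ≤ μ := by
    by_contra! h
    apply hlow (-μ) (by linarith)
    simpa using hm
  have hμt : μ < t := by
    by_contra! h
    exact htop μ h hm
  have ev : ∀ (l : ℝ) (w u v : Pt), l • u + w ∉ S →
      ∀ᶠ δ : ℝ in 𝓝[>] 0, l • (u + δ • v) + w ∉ S := by
    intro l w u v h
    apply nhdsWithin_le_nhds
    have hcont : Continuous fun δ : ℝ => l • (u + δ • v) + w := by fun_prop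
    exact hcont.continuousAt.eventually (hc.isOpen_compl.mem_nhds (by simpa using h))
  have e1 := ev l₂ w₂ x d hx₂
  have e2 := ev l₂ w₂ x' d hx'₂
  have e3 := ev l₁ w₁ (p + t • d) (-d) (htop t le_rfl)
  have e4 : ∀ᶠ δ : ℝ in 𝓝[>] 0, δ < t - μ :=
    nhdsWithin_le_nhds (gt_mem_nhds (by linarith))
  obtain ⟨δ, ⟨⟨⟨h1, h2⟩, h3⟩, h4⟩, hδ : 0 < δ⟩ :=
    ((((e1.and e2).and e3).and e4).and self_mem_nhdsWithin).exists
  have hmS : l₂ • (p + (μ + δ) • d) + w₂ ∈ S := by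
    have := hS hp ht (a := 1 - (μ + δ) / t) (b := (μ + δ) / t)
      (by rw [sub_nonneg, div_le_one (by linarith)]; linarith)
      (div_nonneg (by linarith) (by linarith)) (by ring)
    convert this using 1
    have : t ≠ 0 := by linarith
    match_scalars <;> field_simp <;> ring
  obtain ⟨m, hmdef⟩ : ∃ m : Pt, m = p + (μ + δ) • d := ⟨_, rfl⟩
  obtain ⟨Δ, hΔ⟩ : ∃ Δ : Pt, Δ = l₁ • m + (w₁ - (l₁ * δ) • d) - (l₂ • m + w₂) := ⟨_, rfl⟩
  have hme : ∀ c : ℝ, m + c • (x' - x) = x + δ • d + (α + c) • (x' - x) := by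
    intro c
    have : m = x + α • (x' - x) + δ • d := by rw [hmdef, hμ]; module
    rw [this]; module
  have key := hS.crossing hl₁ hl₂ (w := w₁ - (l₁ * δ) • d) (w' := w₂) (m := m) (e := x' - x)
    (e' := d) (β := 1 - α) (α := α) (β' := t - μ - δ) (α' := μ + δ)
    (ξ := Δ 0 / (x' 0 - x 0)) (ξ' := (Δ 1 - Δ 0 / (x' 0 - x 0) * (x' 1 - x 1)) / d 1)
    hα1 hα0 (by linarith) (by linarith)
    (by
      have hd' : l₁ • m + (w₁ - (l₁ * δ) • d) = l₂ • m + w₂ + Δ := by rw [hΔ]; abel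
      rw [hd', add_assoc (l₂ • m + w₂), add_right_inj]
      ext i
      fin_cases i
      · simp [hd0]; field_simp
      · simp; field_simp; ring)
    (by convert hm using 1; rw [hmdef]; module)
    (by rw [hmdef]; exact hmS)
    (by rw [hme]; convert hx' using 1; module)
    (by rw [sub_eq_add_neg, ← neg_smul, hme]; convert hx using 1; module)
    (by rw [hmdef]; convert ht using 1; module)
    (by rw [hmdef]; convert hp using 1; module)
  rcases key with (h | h) | (h | h)
  · apply h2; rw [hme] at h; convert h using 1; module
  · apply h1; rw [sub_eq_add_neg, ← neg_smul, hme] at h; convert h using 1; module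
  · apply h3; rw [hmdef] at h; convert h using 1; module
  · apply hlow δ hδ; rw [hmdef] at h; convert h using 1; module

open Filter Topology in
/-- Of two homothetic copies sharing a point `p`, the one with the shorter vertical chord above `p`
is contained in the other one on one side of `p`. -/
theorem Convex.subset_left_or_right {S : Set Pt} (hS : Convex ℝ S) (hc : IsClosed S) {l₁ l₂ : ℝ}
    (hl₁ : 0 < l₁) (hl₂ : 0 < l₂) {w₁ w₂ d p : Pt} {t : ℝ} (hd0 : d 0 = 0) (hd1 : d 1 ≠ 0)
    (hlow : ∀ s : ℝ, 0 < s → l₁ • (p - s • d) + w₁ ∉ S) (hp : l₂ • p + w₂ ∈ S) (ht0 : 0 < t)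
    (ht : l₂ • (p + t • d) + w₂ ∈ S) (htop : ∀ s > t, l₁ • (p + s • d) + w₁ ∉ S) :
    (∀ x : Pt, x 0 < p 0 → l₁ • x + w₁ ∈ S → l₂ • x + w₂ ∈ S) ∨
      (∀ x : Pt, p 0 < x 0 → l₁ • x + w₁ ∈ S → l₂ • x + w₂ ∈ S) := by
  by_contra! ⟨⟨x, hxp, hx, hx₂⟩, ⟨x', hpx', hx', hx'₂⟩⟩
  have ev : ∀ u : Pt, l₂ • u + w₂ ∉ S →
      ∀ᶠ ρ : ℝ in 𝓝[<] 1, (ρ * l₂) • u + (l₂ • p + w₂ - (ρ * l₂) • p) ∉ S := by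
    intro u h
    apply nhdsWithin_le_nhds
    have hcont : Continuous fun ρ : ℝ => (ρ * l₂) • u + (l₂ • p + w₂ - (ρ * l₂) • p) := by fun_prop
    refine hcont.continuousAt.eventually (hc.isOpen_compl.mem_nhds fun h' => h ?_)
    convert h' using 1; module
  have e4 : ∀ᶠ ρ : ℝ in 𝓝[<] 1, 0 < ρ := nhdsWithin_le_nhds (lt_mem_nhds one_pos)
  obtain ⟨ρ, ⟨⟨h1, h2⟩, h0⟩, hρ : ρ < 1⟩ :=
    ((((ev x hx₂).and (ev x' hx'₂)).and e4).and self_mem_nhdsWithin).exists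
  refine hS.not_straddle hc hl₁ (mul_pos h0 hl₂) hd0 hd1 hx h1 hx' h2 hxp hpx' hlow
    (t := t / ρ) (by convert hp using 1; module)
    (by convert ht using 1; match_scalars <;> field_simp <;> ring) ?_
  intro s hs
  exact htop s (lt_of_lt_of_le (by rw [lt_div_iff₀ h0]; nlinarith) hs)

open Filter Topology in
theorem StrictConvex.not_straddle {S : Set Pt} (hS : StrictConvex ℝ S) (hc : IsClosed S)
    {l₁ l₂ : ℝ} (hl₁ : 0 < l₁) (hl₂ : 0 < l₂) {w₁ w₂ d x x' p : Pt} {t t' : ℝ} (hd0 : d 0 = 0)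
    (hd1 : d 1 ≠ 0) (hx : l₁ • x + w₁ ∈ S) (hx₂ : l₂ • x + w₂ ∉ interior S)
    (hx' : l₁ • x' + w₁ ∈ S) (hx'₂ : l₂ • x' + w₂ ∉ interior S) (hxp : x 0 < p 0)
    (hpx' : p 0 < x' 0) (hlow : ∀ s : ℝ, 0 < s → l₁ • (p - s • d) + w₁ ∉ S) (hp : l₂ • p + w₂ ∈ S)
    (htt' : t < t') (ht0 : 0 < t')
    (ht : l₂ • (p + t' • d) + w₂ ∈ S) (htop : ∀ s > t, l₁ • (p + s • d) + w₁ ∉ S) : False := by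
  have out : ∀ ρ : ℝ, 1 < ρ → ∀ u : Pt, u ≠ p → l₂ • u + w₂ ∉ interior S →
      (ρ * l₂) • u + (l₂ • p + w₂ - (ρ * l₂) • p) ∉ S := by
    intro ρ hρ u hu h hmem
    have h0 : 0 < ρ := by linarith
    have heq := hS.eq hp hmem (a := 1 - 1 / ρ) (b := 1 / ρ)
      (by rw [sub_pos, div_lt_one h0]; exact hρ) (by positivity) (by ring)
      (fun h' => h (by convert h' using 1; match_scalars <;> field_simp <;> ring))
    have h3 : (ρ * l₂) • (u - p) = 0 := by
      have : (ρ * l₂) • (u - p) =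
        (ρ * l₂) • u + (l₂ • p + w₂ - (ρ * l₂) • p) - (l₂ • p + w₂) := by module
      rw [this, sub_eq_zero, ← heq]
    rw [smul_eq_zero, sub_eq_zero] at h3
    exact h3.elim (mul_pos h0 hl₂).ne' hu
  have e4 : ∀ᶠ ρ : ℝ in 𝓝[>] 1, ρ * t < t' := by
    apply nhdsWithin_le_nhds
    have hcont : Continuous fun ρ : ℝ => ρ * t := by fun_prop
    exact hcont.continuousAt.eventually (gt_mem_nhds (by simpa using htt'))
  obtain ⟨ρ, h4, hρ : 1 < ρ⟩ := (e4.and self_mem_nhdsWithin).exists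
  have h0 : 0 < ρ := by linarith
  refine hS.convex.not_straddle hc hl₁ (mul_pos h0 hl₂) hd0 hd1 hx
    (out ρ hρ x (by rintro rfl; exact hxp.false) hx₂) hx'
    (out ρ hρ x' (by rintro rfl; exact hpx'.false) hx'₂) hxp hpx' hlow
    (t := t' / ρ) (by convert hp using 1; module)
    (by convert ht using 1; match_scalars <;> field_simp <;> ring) ?_
  intro s hs
  exact htop s (lt_of_lt_of_le (by rw [lt_div_iff₀ h0]; linarith) hs)

theorem StrictConvex.low_or_low {S : Set Pt} (hS : StrictConvex ℝ S) {l : ℝ} (hl : 0 < l)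
    {w p d : Pt} (hd : d ≠ 0) (hp : l • p + w ∉ interior S) :
    (∀ s : ℝ, 0 < s → l • (p - s • d) + w ∉ S) ∨
      (∀ s : ℝ, 0 < s → l • (p - s • (-d)) + w ∉ S) := by
  by_contra! ⟨⟨s, hs, h⟩, ⟨s', hs', h'⟩⟩
  have heq := hS.eq h h' (a := s' / (s + s')) (b := s / (s + s')) (by positivity) (by positivity)
    (by field_simp; ring) (fun h' => hp (by
      convert h' using 1; match_scalars <;> field_simp <;> ring))
  have h3 : (l * (s + s')) • d = 0 := by
    have : (l * (s + s')) • d = (l • (p - s' • (-d)) + w) - (l • (p - s • d) + w) := by module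
    rw [this, heq, sub_self]
  rw [smul_eq_zero] at h3
  exact h3.elim (mul_pos hl (by linarith)).ne' hd

theorem StrictConvex.exists_top {S : Set Pt} (hS : StrictConvex ℝ S) (hc : IsCompact S) {l : ℝ}
    (hl : 0 < l) {w p q r d : Pt} (hd0 : d 0 = 0) (hd1 : d 1 ≠ 0)
    (hp : l • p + w ∉ interior S) (hq : l • q + w ∈ S) (hr : l • r + w ∈ S)
    (hqp : q 0 < p 0) (hpr : p 0 < r 0) (hlow : ∀ s : ℝ, 0 < s → l • (p - s • d) + w ∉ S) :
    ∃ t : ℝ, 0 < t ∧ l • (p + t • d) + w ∈ S ∧ ∀ s > t, l • (p + s • d) + w ∉ S := by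
  have he : 0 < r 0 - q 0 := by linarith
  obtain ⟨α, hα⟩ : ∃ α : ℝ, α = (p 0 - q 0) / (r 0 - q 0) := ⟨_, rfl⟩
  have hα0 : 0 < α := by rw [hα]; exact div_pos (by linarith) he
  have hα1 : 0 < 1 - α := by rw [hα, sub_pos, div_lt_one he]; linarith
  obtain ⟨μ, hμ⟩ : ∃ μ : ℝ, q + α • (r - q) = p + μ • d := by
    refine ⟨(q 1 + α * (r 1 - q 1) - p 1) / d 1, ?_⟩
    ext i
    fin_cases i
    · simp [hd0, hα]; field_simp; ring
    · simp; field_simp; ring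
  have hcomb : l • (p + μ • d) + w = (1 - α) • (l • q + w) + α • (l • r + w) := by
    rw [← hμ]; module
  have hm : l • (p + μ • d) + w ∈ S := by
    rw [hcomb]; exact hS.convex hq hr hα1.le hα0.le (by ring)
  have hμ0 : 0 < μ := by
    rcases lt_trichotomy μ 0 with h | rfl | h
    · exact (hlow (-μ) (by linarith) (by simpa using hm)).elim
    · have := hS.eq hq hr hα1 hα0 (by ring) (by rw [← hcomb]; simpa using hp)
      have h2 : q = r := smul_right_injective _ hl.ne' (add_right_cancel this)
      rw [h2] at he; simp at he
    · exact h
  have hcont : Continuous fun s : ℝ => l • (p + s • d) + w := by fun_prop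
  have hK : IsCompact {s : ℝ | l • (p + s • d) + w ∈ S} := by
    refine Metric.isCompact_of_isClosed_isBounded (hc.isClosed.preimage hcont) ?_
    obtain ⟨R, hR⟩ := isBounded_iff_forall_norm_le.1 hc.isBounded
    have hd : 0 < ‖d‖ := norm_pos_iff.2 (by rintro rfl; simp at hd1)
    refine isBounded_iff_forall_norm_le.2 ⟨(R + ‖l • p + w‖) / (l * ‖d‖), fun s hs => ?_⟩
    rw [le_div_iff₀ (by positivity)]
    have e : (l * s) • d = (l • (p + s • d) + w) - (l • p + w) := by module
    calc ‖s‖ * (l * ‖d‖) = ‖(l * s) • d‖ := by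
          rw [norm_smul, norm_mul, Real.norm_of_nonneg hl.le]; ring
      _ ≤ _ := by rw [e]; exact (norm_sub_le _ _).trans (add_le_add (hR _ hs) le_rfl)
  obtain ⟨t, htK, ht⟩ := hK.exists_isMaxOn ⟨μ, hm⟩ continuousOn_id
  refine ⟨t, hμ0.trans_le (ht hm), htK, fun s hs h => ?_⟩
  exact (ht h).not_gt hs

open Filter Topology in
theorem notMem_interior_of_forall_gt {S : Set Pt} {l t : ℝ} {w p d : Pt}
    (h : ∀ s > t, l • (p + s • d) + w ∉ S) : l • (p + t • d) + w ∉ interior S := by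
  intro hi
  have hcont : Continuous fun s : ℝ => l • (p + s • d) + w := by fun_prop
  have ev : ∀ᶠ s : ℝ in 𝓝[>] t, l • (p + s • d) + w ∈ interior S :=
    nhdsWithin_le_nhds (hcont.continuousAt.eventually (isOpen_interior.mem_nhds hi))
  obtain ⟨s, h1, h2⟩ := (ev.and self_mem_nhdsWithin).exists
  exact h s h2 (interior_subset h1)

section

variable {S : Set Pt} {l₁ l₂ : ℝ} {w₁ w₂ p q₁ q₂ r₁ d : Pt} {X : Finset Pt} {t₁ t₂ ε : ℝ}

open Classical in
theorem StrictConvex.range_eq_of_nested (hS : StrictConvex ℝ S) (hc : IsClosed S)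
    (hl₁ : 0 < l₁) (hl₂ : 0 < l₂) (hd0 : d 0 = 0) (hd1 : d 1 ≠ 0) (hε : ε ≠ 0)
    (hp₁ : l₁ • p + w₁ ∈ S \ interior S) (hp₂ : l₂ • p + w₂ ∈ S \ interior S)
    (hq₁ : l₁ • q₁ + w₁ ∈ S \ interior S) (hr₁ : l₁ • r₁ + w₁ ∈ S \ interior S)
    (hq₁X : q₁ ∈ X) (hr₁X : r₁ ∈ X)
    (hq₁p : ε * (q₁ 0 - p 0) < 0) (hr₁p : 0 < ε * (r₁ 0 - p 0))
    (hlow₁ : ∀ s : ℝ, 0 < s → l₁ • (p - s • d) + w₁ ∉ S)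
    (htt : t₁ ≤ t₂) (ht₁0 : 0 < t₁) (ht₁ : l₁ • (p + t₁ • d) + w₁ ∈ S)
    (ht₂ : l₂ • (p + t₂ • d) + w₂ ∈ S)
    (htop₁ : ∀ s > t₁, l₁ • (p + s • d) + w₁ ∉ S) (htop₂ : ∀ s > t₂, l₂ • (p + s • d) + w₂ ∉ S)
    (hleft : {x ∈ X | l₁ • x + w₁ ∈ interior S ∧ ε * (x 0 - p 0) < 0}.card =
      {x ∈ X | l₂ • x + w₂ ∈ interior S ∧ ε * (x 0 - p 0) < 0}.card)
    (hright : {x ∈ X | l₁ • x + w₁ ∈ interior S ∧ 0 < ε * (x 0 - p 0)}.card =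
      {x ∈ X | l₂ • x + w₂ ∈ interior S ∧ 0 < ε * (x 0 - p 0)}.card)
    (hnest : ∀ x : Pt, ε * (x 0 - p 0) < 0 → l₁ • x + w₁ ∈ S → l₂ • x + w₂ ∈ S) :
    l₁ = l₂ ∧ w₁ = w₂ := by
  have hintr : ∀ x : Pt, ε * (x 0 - p 0) < 0 → l₁ • x + w₁ ∈ interior S →
      l₂ • x + w₂ ∈ interior S := by
    intro x hx hxi
    have hopen : IsOpen {y : Pt | l₁ • y + w₁ ∈ interior S ∧ ε * (y 0 - p 0) < 0} :=
      (isOpen_interior.preimage (f := fun y : Pt => l₁ • y + w₁) (by fun_prop)).inter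
        (isOpen_lt (f := fun y : Pt => ε * (y 0 - p 0)) (by fun_prop) continuous_const)
    have hsub : {y : Pt | l₁ • y + w₁ ∈ interior S ∧ ε * (y 0 - p 0) < 0} ⊆
        interior {y : Pt | l₂ • y + w₂ ∈ S} :=
      interior_maximal (fun y hy => hnest y hy.2 (interior_subset hy.1)) hopen
    have := hsub ⟨hxi, hx⟩
    rwa [interior_setOf_smul_add_mem S hl₂.ne'] at this
  have hsets := Finset.eq_of_subset_of_card_le
    (s := {x ∈ X | l₁ • x + w₁ ∈ interior S ∧ ε * (x 0 - p 0) < 0})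
    (t := {x ∈ X | l₂ • x + w₂ ∈ interior S ∧ ε * (x 0 - p 0) < 0})
    (fun x hx => by
      simp only [Finset.mem_filter] at hx ⊢
      exact ⟨hx.1, hintr x hx.2.2 hx.2.1, hx.2.2⟩) hleft.ge
  have hq₂ : l₂ • q₁ + w₂ ∈ S \ interior S := by
    refine ⟨hnest q₁ hq₁p hq₁.1, fun h => hq₁.2 ?_⟩
    have : q₁ ∈ {x ∈ X | l₂ • x + w₂ ∈ interior S ∧ ε * (x 0 - p 0) < 0} := by
      simp [hq₁X, h, hq₁p]
    rw [← hsets] at this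
    exact (Finset.mem_filter.1 this).2.1
  have hd : d ≠ 0 := by rintro rfl; simp at hd1
  rcases htt.eq_or_lt with rfl | htt
  · have h0 : q₁ ≠ p := by rintro rfl; simp at hq₁p
    refine hS.range_unique hl₁ hl₂ (x := q₁) (y := p) (z := p + t₁ • d) h0 ?_ ?_ hq₁ hp₁
      ⟨ht₁, notMem_interior_of_forall_gt htop₁⟩ hq₂ hp₂ ⟨ht₂, notMem_interior_of_forall_gt htop₂⟩
    · rintro rfl; simp [hd0] at hq₁p
    · intro h
      have : t₁ • d = 0 := by simpa using h
      exact (smul_ne_zero ht₁0.ne' hd) this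
  · exfalso
    have hR : ∀ x : Pt, 0 < ε * (x 0 - p 0) → l₁ • x + w₁ ∈ S → l₂ • x + w₂ ∈ interior S := by
      intro x hx hxS
      by_contra hxi
      rcases lt_or_gt_of_ne hε with h | h
      · exact hS.not_straddle hc hl₁ hl₂ hd0 hd1 hxS hxi hq₁.1 hq₂.2 (by nlinarith) (by nlinarith)
          hlow₁ hp₂.1 htt (by linarith) ht₂ htop₁
      · exact hS.not_straddle hc hl₁ hl₂ hd0 hd1 hq₁.1 hq₂.2 hxS hxi (by nlinarith) (by nlinarith)
          hlow₁ hp₂.1 htt (by linarith) ht₂ htop₁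
    refine (Finset.card_lt_card (s := {x ∈ X | l₁ • x + w₁ ∈ interior S ∧ 0 < ε * (x 0 - p 0)})
      (t := {x ∈ X | l₂ • x + w₂ ∈ interior S ∧ 0 < ε * (x 0 - p 0)}) ?_).ne hright
    rw [Finset.ssubset_iff_of_subset]
    · refine ⟨r₁, ?_, ?_⟩
      · simp [hr₁X, hr₁p, hR r₁ hr₁p hr₁.1]
      · simp [hr₁.2]
    · intro x hx
      simp only [Finset.mem_filter] at hx ⊢
      exact ⟨hx.1, hR x hx.2.2 (interior_subset hx.2.1), hx.2.2⟩

open Classical in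
theorem StrictConvex.range_eq_of_card_eq_of_le (hS : StrictConvex ℝ S) (hc : IsCompact S)
    (hl₁ : 0 < l₁) (hl₂ : 0 < l₂) (hd0 : d 0 = 0) (hd1 : d 1 ≠ 0)
    (hp₁ : l₁ • p + w₁ ∈ S \ interior S) (hp₂ : l₂ • p + w₂ ∈ S \ interior S)
    (hq₁ : l₁ • q₁ + w₁ ∈ S \ interior S) (hr₁ : l₁ • r₁ + w₁ ∈ S \ interior S)
    (hq₁X : q₁ ∈ X) (hr₁X : r₁ ∈ X) (hq₁p : q₁ 0 < p 0) (hr₁p : p 0 < r₁ 0)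
    (hlow₁ : ∀ s : ℝ, 0 < s → l₁ • (p - s • d) + w₁ ∉ S)
    (htt : t₁ ≤ t₂) (ht₁0 : 0 < t₁) (ht₁ : l₁ • (p + t₁ • d) + w₁ ∈ S)
    (ht₂ : l₂ • (p + t₂ • d) + w₂ ∈ S)
    (htop₁ : ∀ s > t₁, l₁ • (p + s • d) + w₁ ∉ S) (htop₂ : ∀ s > t₂, l₂ • (p + s • d) + w₂ ∉ S)
    (hleft : {x ∈ X | l₁ • x + w₁ ∈ interior S ∧ x 0 < p 0}.card =
      {x ∈ X | l₂ • x + w₂ ∈ interior S ∧ x 0 < p 0}.card)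
    (hright : {x ∈ X | l₁ • x + w₁ ∈ interior S ∧ p 0 < x 0}.card =
      {x ∈ X | l₂ • x + w₂ ∈ interior S ∧ p 0 < x 0}.card) :
    l₁ = l₂ ∧ w₁ = w₂ := by
  rcases hS.convex.subset_left_or_right hc.isClosed hl₁ hl₂ hd0 hd1 hlow₁ hp₂.1
    (ht₁0.trans_le htt) ht₂ (fun s hs => htop₁ s (htt.trans_lt hs)) with h | h
  · exact hS.range_eq_of_nested hc.isClosed hl₁ hl₂ hd0 hd1 (ε := 1) one_ne_zero hp₁ hp₂ hq₁ hr₁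
      hq₁X hr₁X (by linarith) (by linarith) hlow₁ htt ht₁0 ht₁ ht₂ htop₁ htop₂
      (by simpa using hleft) (by simpa using hright) (by simpa using h)
  · exact hS.range_eq_of_nested hc.isClosed hl₁ hl₂ hd0 hd1 (ε := -1) (by norm_num) hp₁ hp₂ hr₁ hq₁
      hr₁X hq₁X (by linarith) (by linarith) hlow₁ htt ht₁0 ht₁ ht₂ htop₁ htop₂
      (by simpa using hright) (by simpa using hleft) (by simpa using h)

open Classical in
/-- A range with three points of `X` on its boundary is determined by the middle point, the side on
which the range lies above it, and the numbers of interior points of `X` to its left and right. -/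
theorem StrictConvex.range_eq_of_card_eq {r₂ : Pt} (hS : StrictConvex ℝ S) (hc : IsCompact S)
    (hl₁ : 0 < l₁) (hl₂ : 0 < l₂) (hd0 : d 0 = 0) (hd1 : d 1 ≠ 0)
    (hp₁ : l₁ • p + w₁ ∈ S \ interior S) (hp₂ : l₂ • p + w₂ ∈ S \ interior S)
    (hq₁ : l₁ • q₁ + w₁ ∈ S \ interior S) (hr₁ : l₁ • r₁ + w₁ ∈ S \ interior S)
    (hq₂ : l₂ • q₂ + w₂ ∈ S \ interior S) (hr₂ : l₂ • r₂ + w₂ ∈ S \ interior S)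
    (hq₁X : q₁ ∈ X) (hr₁X : r₁ ∈ X) (hq₂X : q₂ ∈ X) (hr₂X : r₂ ∈ X)
    (hq₁p : q₁ 0 < p 0) (hr₁p : p 0 < r₁ 0) (hq₂p : q₂ 0 < p 0) (hr₂p : p 0 < r₂ 0)
    (hlow₁ : ∀ s : ℝ, 0 < s → l₁ • (p - s • d) + w₁ ∉ S)
    (hlow₂ : ∀ s : ℝ, 0 < s → l₂ • (p - s • d) + w₂ ∉ S)
    (hleft : {x ∈ X | l₁ • x + w₁ ∈ interior S ∧ x 0 < p 0}.card =
      {x ∈ X | l₂ • x + w₂ ∈ interior S ∧ x 0 < p 0}.card)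
    (hright : {x ∈ X | l₁ • x + w₁ ∈ interior S ∧ p 0 < x 0}.card =
      {x ∈ X | l₂ • x + w₂ ∈ interior S ∧ p 0 < x 0}.card) :
    l₁ = l₂ ∧ w₁ = w₂ := by
  obtain ⟨t₁, ht₁0, ht₁, htop₁⟩ :=
    hS.exists_top hc hl₁ hd0 hd1 hp₁.2 hq₁.1 hr₁.1 hq₁p hr₁p hlow₁
  obtain ⟨t₂, ht₂0, ht₂, htop₂⟩ :=
    hS.exists_top hc hl₂ hd0 hd1 hp₂.2 hq₂.1 hr₂.1 hq₂p hr₂p hlow₂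
  rcases le_total t₁ t₂ with h | h
  · exact hS.range_eq_of_card_eq_of_le hc hl₁ hl₂ hd0 hd1 hp₁ hp₂ hq₁ hr₁ hq₁X hr₁X hq₁p hr₁p hlow₁
      h ht₁0 ht₁ ht₂ htop₁ htop₂ hleft hright
  · have := hS.range_eq_of_card_eq_of_le hc hl₂ hl₁ hd0 hd1 hp₂ hp₁ hq₂ hr₂ hq₂X hr₂X hq₂p hr₂p
      hlow₂ h ht₂0 ht₂ ht₁ htop₂ htop₁ hleft.symm hright.symm
    exact ⟨this.1.symm, this.2.symm⟩

end

/-- A strictly convex compact set whose rightmost point `z` is unique and has a vertical line as its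
only touching line. -/
structure IsSmoothBody (S : Set Pt) (z : Pt) : Prop where
  compact : IsCompact S
  strictConvex : StrictConvex ℝ S
  mem : z ∈ S
  lt_of_ne : ∀ s ∈ S, s ≠ z → s 0 < z 0
  exists_mem_interior : ∀ g : Pt, g 0 < 0 → ∃ τ : ℝ, 0 < τ ∧ z + τ • g ∈ interior S

/-- No two points of `X` on a vertical line and no four on the boundary of a range. -/
def RangeGeneric (S : Set Pt) (X : Finset Pt) : Prop :=
  (∀ p ∈ X, ∀ q ∈ X, p 0 = q 0 → p = q) ∧
    ∀ (l : ℝ) (w : Pt), 0 < l → ∀ F ⊆ X, (∀ x ∈ F, l • x + w ∈ S \ interior S) → F.card ≤ 3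

/-- The range `{x | l • x + w ∈ S}` contains `Y`, and its interior contains no other point of
`X`. -/
def Separates (S : Set Pt) (X Y : Finset Pt) (l : ℝ) (w : Pt) : Prop :=
  0 < l ∧ (∀ y ∈ Y, l • y + w ∈ S) ∧ ∀ x ∈ X, l • x + w ∈ interior S → x ∈ Y

/-- A separating range whose rightmost point is as far to the left as possible. -/
def IsLeftmost (S : Set Pt) (z : Pt) (X Y : Finset Pt) (l : ℝ) (w : Pt) : Prop :=
  Separates S X Y l w ∧
    ∀ (l' : ℝ) (w' : Pt), Separates S X Y l' w' → (z 0 - w 0) / l ≤ (z 0 - w' 0) / l'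

theorem IsSmoothBody.notMem_interior_of_le {S : Set Pt} {z : Pt} (hS : IsSmoothBody S z) {s : Pt}
    (hs : z 0 ≤ s 0) : s ∉ interior S := by
  intro hi
  have hne : s = z := by
    by_contra h
    exact absurd (hS.lt_of_ne s (interior_subset hi) h) (not_lt.2 hs)
  subst hne
  have h1 := notMem_interior_of_forall_gt (S := S) (l := 1) (t := 0) (w := 0) (p := s)
    (d := EuclideanSpace.single 0 1) (by
      intro t ht h
      have h3 := hS.lt_of_ne _ h (by
        intro h'
        have := congrArg (fun v : Pt => v 0) h'
        simp at this
        linarith)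
      simp at h3
      linarith)
  exact h1 (by simpa using hi)

theorem Convex.notMem_interior_add {S : Set Pt} (hS : Convex ℝ S) {u x : Pt} {ε : ℝ} (hu : u ∈ S)
    (hx : x ∉ interior S) (hε : 0 ≤ ε) : x + ε • (x - u) ∉ interior S := by
  intro h
  apply hx
  have := hS.combo_interior_self_mem_interior h hu (a := 1 / (1 + ε)) (b := ε / (1 + ε))
    (by positivity) (by positivity) (by field_simp)
  convert this using 1
  match_scalars <;> field_simp <;> ring

open Filter Topology in
theorem Convex.eventually_add_smul_mem {S : Set Pt} (hS : Convex ℝ S) {x v : Pt} {τ : ℝ}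
    (hτ : 0 < τ) (hx : x ∈ S) (hv : x + τ • v ∈ S) : ∀ᶠ ε : ℝ in 𝓝[>] 0, x + ε • v ∈ S := by
  have h1 : ∀ᶠ ε : ℝ in 𝓝[>] 0, ε < τ := nhdsWithin_le_nhds (gt_mem_nhds hτ)
  filter_upwards [h1, self_mem_nhdsWithin] with ε h2 (h3 : 0 < ε)
  have := hS hx hv (a := 1 - ε / τ) (b := ε / τ) (by rw [sub_nonneg, div_le_one hτ]; exact h2.le)
    (by positivity) (by ring)
  convert this using 1
  match_scalars <;> field_simp <;> ring

section

variable {S : Set Pt} {z : Pt} {X Y : Finset Pt} {l : ℝ} {w : Pt}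

open Filter Topology in
/-- Infinitesimal motions of a leftmost range cannot move its rightmost point to the left. -/
theorem IsLeftmost.not_move (hmin : IsLeftmost S z X Y l w) (hS : IsSmoothBody S z) {κ : ℝ} {b : Pt}
    (hU : ∀ y ∈ Y, l • y + w ∉ interior S →
      ∀ᶠ ε : ℝ in 𝓝[>] 0, l • y + w + ε • (κ • (l • y + w) + b) ∈ S)
    (hV : ∀ x ∈ X, x ∉ Y → l • x + w ∈ S →
      ∀ᶠ ε : ℝ in 𝓝[>] 0, l • x + w + ε • (κ • (l • x + w) + b) ∉ interior S)
    (hz : 0 < (κ • z + b) 0) : False := by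
  obtain ⟨⟨hl, hY, hX⟩, hmin⟩ := hmin
  have e1 : ∀ᶠ ε : ℝ in 𝓝[>] 0, ∀ y ∈ Y, l • y + w + ε • (κ • (l • y + w) + b) ∈ S := by
    rw [Filter.eventually_all_finset]
    intro y hy
    by_cases hi : l • y + w ∈ interior S
    · apply nhdsWithin_le_nhds
      have hcont : Continuous fun ε : ℝ => l • y + w + ε • (κ • (l • y + w) + b) := by fun_prop
      have := (hcont.continuousAt (x := 0)).eventually
        (isOpen_interior.mem_nhds (by simpa using hi))
      exact this.mono fun ε h => interior_subset h
    · exact hU y hy hi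
  have e2 : ∀ᶠ ε : ℝ in 𝓝[>] 0, ∀ x ∈ X, x ∉ Y →
      l • x + w + ε • (κ • (l • x + w) + b) ∉ interior S := by
    rw [Filter.eventually_all_finset]
    intro x hx
    by_cases hxY : x ∈ Y
    · simp [hxY]
    by_cases hi : l • x + w ∈ S
    · exact (hV x hx hxY hi).mono fun _ h _ => h
    · apply nhdsWithin_le_nhds
      have hcont : Continuous fun ε : ℝ => l • x + w + ε • (κ • (l • x + w) + b) := by fun_prop
      have := (hcont.continuousAt (x := 0)).eventually
        (hS.compact.isClosed.isOpen_compl.mem_nhds (by simpa using hi))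
      exact this.mono fun ε h _ h' => h (interior_subset h')
  have e3 : ∀ᶠ ε : ℝ in 𝓝[>] 0, 0 < 1 + ε * κ := by
    apply nhdsWithin_le_nhds
    have hcont : Continuous fun ε : ℝ => 1 + ε * κ := by fun_prop
    exact hcont.continuousAt.eventually (lt_mem_nhds (by simp))
  obtain ⟨ε, ⟨⟨h1, h2⟩, h3⟩, hε : 0 < ε⟩ := (((e1.and e2).and e3).and self_mem_nhdsWithin).exists
  have hA : ∀ x : Pt, ((1 + ε * κ) * l) • x + ((1 + ε * κ) • w + ε • b) =
      l • x + w + ε • (κ • (l • x + w) + b) := fun x => by module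
  have := hmin ((1 + ε * κ) * l) ((1 + ε * κ) • w + ε • b) ⟨by positivity,
    fun y hy => by rw [hA]; exact h1 y hy,
    fun x hx hxi => by
      by_contra hxY
      rw [hA] at hxi
      exact h2 x hx hxY hxi⟩
  rw [div_le_div_iff₀ hl (by positivity)] at this
  simp at this hz
  nlinarith [mul_pos hε hz, mul_pos hl (mul_pos hε hz)]

theorem IsLeftmost.not_subset_singleton (hmin : IsLeftmost S z X Y l w) (hS : IsSmoothBody S z)
    {u : Pt} (hu : u ∈ S) (huz : u ≠ z)
    (hY : ∀ y ∈ Y, l • y + w ∉ interior S → l • y + w = u) : False := by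
  refine hmin.not_move hS (κ := 1) (b := -u) ?_ ?_ ?_
  · intro y hy hi
    refine Filter.Eventually.of_forall fun ε => ?_
    rw [hY y hy hi]
    simpa using hu
  · intro x hx hxY _
    filter_upwards [self_mem_nhdsWithin] with ε (hε : 0 < ε)
    have := hS.strictConvex.convex.notMem_interior_add hu
      (fun h => hxY (hmin.1.2.2 x hx h)) hε.le
    simpa [sub_eq_add_neg] using this
  · simpa using hS.lt_of_ne u hu huz

open Filter Topology in
theorem IsLeftmost.exists_ne (hmin : IsLeftmost S z X Y l w) (hS : IsSmoothBody S z)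
    (hYz : ∀ y ∈ Y, l • y + w ≠ z) : ∃ x ∈ X, x ∉ Y ∧ l • x + w ∈ S ∧ l • x + w ≠ z := by
  by_contra! hX
  have e1 : ∀ᶠ σ : ℝ in 𝓝[>] 0, ∀ y ∈ Y, (l • y + w) 0 < z 0 - σ := by
    rw [Filter.eventually_all_finset]
    intro y hy
    apply nhdsWithin_le_nhds
    have hcont : Continuous fun σ : ℝ => z 0 - σ := by fun_prop
    exact hcont.continuousAt.eventually
      (lt_mem_nhds (by simpa using hS.lt_of_ne _ (hmin.1.2.1 y hy) (hYz y hy)))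
  obtain ⟨σ, h1, hσ : 0 < σ⟩ := (e1.and self_mem_nhdsWithin).exists
  obtain ⟨z₁, hz₁⟩ : ∃ z₁ : Pt, z₁ = z - σ • EuclideanSpace.single 0 1 := ⟨_, rfl⟩
  have hz₁0 : z₁ 0 = z 0 - σ := by simp [hz₁]
  have e2 : ∀ᶠ τ : ℝ in 𝓝[>] 0, ∀ y ∈ Y, z + τ • (l • y + w - z₁) ∈ S := by
    rw [Filter.eventually_all_finset]
    intro y hy
    obtain ⟨τ, hτ, hmem⟩ := hS.exists_mem_interior (l • y + w - z₁) (by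
      have := h1 y hy
      rw [PiLp.sub_apply, hz₁0]; linarith)
    exact hS.strictConvex.convex.eventually_add_smul_mem hτ hS.mem (interior_subset hmem)
  obtain ⟨τ, h2, hτ : 0 < τ⟩ := (e2.and self_mem_nhdsWithin).exists
  have hDz : (τ - 1) • z + (z - τ • z₁) = τ • (z - z₁) := by module
  have hpos : 0 < (τ • (z - z₁)) 0 := by
    simp [hz₁0]; positivity
  refine hmin.not_move hS (κ := τ - 1) (b := z - τ • z₁) ?_ ?_ ?_
  · intro y hy _
    refine hS.strictConvex.convex.eventually_add_smul_mem one_pos (hmin.1.2.1 y hy) ?_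
    convert h2 y hy using 1; module
  · intro x hx hxY hxS
    filter_upwards [self_mem_nhdsWithin] with ε (hε : 0 < ε)
    rw [hX x hx hxY hxS, hDz]
    apply hS.notMem_interior_of_le
    have : (z + ε • τ • (z - z₁)) 0 = z 0 + ε * (τ • (z - z₁)) 0 := by simp
    rw [this]
    nlinarith
  · rw [hDz]; exact hpos

open Filter Topology in
theorem IsLeftmost.not_cross (hmin : IsLeftmost S z X Y l w) (hS : IsSmoothBody S z)
    {a c v : Pt} {r s : ℝ} (ha : a ∈ S) (hc : c ∈ S) (hv : v ∈ S \ interior S) (hcz : c ≠ z)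
    (hvz : v ≠ z) (hva : v ≠ a) (hr0 : 0 ≤ r) (hr1 : r ≤ 1) (hs0 : 0 ≤ s) (hs1 : s ≤ 1)
    (h : r • v + (1 - r) • c = s • z + (1 - s) • a)
    (hY : ∀ y ∈ Y, l • y + w ∉ interior S → l • y + w = a ∨ l • y + w = c)
    (hX : ∀ x ∈ X, x ∉ Y → l • x + w ∈ S → l • x + w = v) : False := by
  have hr : r < 1 := by
    refine lt_of_le_of_ne hr1 ?_
    rintro rfl
    simp only [one_smul, sub_self, zero_smul, add_zero] at h
    rcases hs0.eq_or_lt with rfl | hs0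
    · simp at h; exact hva h
    rcases hs1.eq_or_lt with rfl | hs1
    · simp at h; exact hvz h
    have := hS.strictConvex.eq hS.mem ha hs0 (sub_pos.2 hs1) (by ring) (h ▸ hv.2)
    apply hva
    rw [h, this]; module
  have hc' : r • v = s • z + (1 - s) • a - (1 - r) • c := by rw [← h]; abel
  have Da : (1 - r - s) • a + (r • (v - a) - (1 - r - s) • a) = r • (v - a) := by abel
  have Dc : (1 - r - s) • c + (r • (v - a) - (1 - r - s) • a) = s • (z - c) := by
    rw [smul_sub, hc']; module
  have Dz : (1 - r - s) • z + (r • (v - a) - (1 - r - s) • a) = (1 - r) • (z - c) := by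
    rw [smul_sub r, hc']; module
  have Dv : (1 - r - s) • v + (r • (v - a) - (1 - r - s) • a) = (1 - s) • (v - a) := by module
  have hconv := hS.strictConvex.convex
  refine hmin.not_move hS (κ := 1 - r - s) (b := r • (v - a) - (1 - r - s) • a) ?_ ?_ ?_
  · intro y hy hi
    refine hconv.eventually_add_smul_mem one_pos (hmin.1.2.1 y hy) ?_
    rcases hY y hy hi with h | h
    · rw [h, Da]
      convert hconv ha hv.1 (sub_nonneg.2 hr1) hr0 (by ring) using 1; module
    · rw [h, Dc]
      convert hconv hc hS.mem (sub_nonneg.2 hs1) hs0 (by ring) using 1; module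
  · intro x hx hxY hxS
    filter_upwards [self_mem_nhdsWithin] with ε (hε : 0 < ε)
    rw [hX x hx hxY hxS, Dv, smul_smul]
    exact hconv.notMem_interior_add ha hv.2 (mul_nonneg hε.le (sub_nonneg.2 hs1))
  · rw [Dz]
    have := hS.lt_of_ne c hc hcz
    simp
    exact mul_pos (by linarith) (by linarith)

end

theorem RangeGeneric.eq_or_eq_or_eq {S : Set Pt} {X : Finset Pt} (hX : RangeGeneric S X) {l : ℝ}
    {w x a b c : Pt} (hl : 0 < l) (hxX : x ∈ X) (haX : a ∈ X) (hbX : b ∈ X) (hcX : c ∈ X)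
    (hx : l • x + w ∈ S \ interior S) (ha : l • a + w ∈ S \ interior S)
    (hb : l • b + w ∈ S \ interior S) (hc : l • c + w ∈ S \ interior S)
    (hab : a ≠ b) (hac : a ≠ c) (hbc : b ≠ c) : x = a ∨ x = b ∨ x = c := by
  classical
  by_contra! ⟨h1, h2, h3⟩
  have := hX.2 l w hl {x, a, b, c} (by
      intro y hy
      simp only [Finset.mem_insert, Finset.mem_singleton] at hy
      rcases hy with rfl | rfl | rfl | rfl <;> assumption) (by
      intro y hy
      simp only [Finset.mem_insert, Finset.mem_singleton] at hy
      rcases hy with rfl | rfl | rfl | rfl <;> assumption)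
  have hcard : ({x, a, b, c} : Finset Pt).card = 4 := by
    rw [Finset.card_insert_of_notMem, Finset.card_insert_of_notMem, Finset.card_insert_of_notMem,
      Finset.card_singleton] <;> simp [*]
  omega

/-- Of four boundary points of a strictly convex set, some two pairs span crossing chords. -/
theorem StrictConvex.exists_chord_crossing {S : Set Pt} (hS : StrictConvex ℝ S) {z x y c : Pt}
    (hz : z ∈ S \ interior S) (hx : x ∈ S \ interior S) (hy : y ∈ S \ interior S)
    (hc : c ∈ S \ interior S) (hzx : z ≠ x) (hzy : z ≠ y) (hzc : z ≠ c) (hxy : x ≠ y) (hxc : x ≠ c)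
    (hyc : y ≠ c) :
    ∃ r s : ℝ, 0 ≤ r ∧ r ≤ 1 ∧ 0 ≤ s ∧ s ≤ 1 ∧
      (r • x + (1 - r) • c = s • z + (1 - s) • y ∨ r • y + (1 - r) • c = s • z + (1 - s) • x ∨
        r • x + (1 - r) • y = s • z + (1 - s) • c) := by
  obtain ⟨a, b, hab⟩ := hS.exists_smul_sub hz hx hy hzx hzy hxy (c - z)
  have hcc : c = (1 - a - b) • z + a • x + b • y := by
    have : c = c - z + z := by abel
    rw [this, hab]; module
  have pos : ∀ {n : ℝ}, n < 0 → 0 < 1 - n := fun h => by linarith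
  rcases lt_or_ge a 0 with ha | ha <;> rcases lt_or_ge b 0 with hb | hb <;>
    rcases lt_or_ge (1 - a - b) 0 with hg | hg
  · linarith
  · exact (hzc (hS.eq_of_smul_eq (β := -a) (γ := -b) (by linarith) (by linarith) hc.1 hx.1 hy.1 hz.2
      (by rw [hcc]; module)).symm).elim
  · exact (hyc (hS.eq_of_smul_eq (β := -(1 - a - b)) (γ := -a) (by linarith) (by linarith) hc.1 hz.1
      hx.1 hy.2 (by rw [hcc]; module)).symm).elim
  · have := (pos ha).ne'
    refine ⟨-a / (1 - a), (1 - a - b) / (1 - a), div_nonneg (by linarith) (by linarith), ?_,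
      div_nonneg (by linarith) (by linarith), ?_, Or.inl ?_⟩
    · rw [div_le_one (by linarith)]; linarith
    · rw [div_le_one (by linarith)]; linarith
    · rw [hcc]; match_scalars <;> field_simp <;> ring
  · exact (hxc (hS.eq_of_smul_eq (β := -(1 - a - b)) (γ := -b) (by linarith) (by linarith) hc.1 hz.1
      hy.1 hx.2 (by rw [hcc]; module)).symm).elim
  · have := (pos hb).ne'
    refine ⟨-b / (1 - b), (1 - a - b) / (1 - b), div_nonneg (by linarith) (by linarith), ?_,
      div_nonneg (by linarith) (by linarith), ?_, Or.inr (Or.inl ?_)⟩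
    · rw [div_le_one (by linarith)]; linarith
    · rw [div_le_one (by linarith)]; linarith
    · rw [hcc]; match_scalars <;> field_simp <;> ring
  · have hab0 : 0 < a + b := by linarith
    refine ⟨a / (a + b), (a + b - 1) / (a + b), by positivity, ?_,
      div_nonneg (by linarith) (by linarith), ?_, Or.inr (Or.inr ?_)⟩
    · rw [div_le_one (by linarith)]; linarith
    · rw [div_le_one (by linarith)]; linarith
    · rw [hcc]; match_scalars <;> field_simp <;> ring
  · exfalso
    rcases ha.eq_or_lt with rfl | ha
    · rcases hb.eq_or_lt with rfl | hb
      · exact hzc (by rw [hcc]; module)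
      · exact hyc (hS.eq_of_smul_eq (β := (1 - b) / b) (γ := 0) (div_nonneg (by linarith) hb.le)
          le_rfl hy.1 hz.1 hx.1 hc.2 (by rw [hcc]; match_scalars <;> field_simp <;> ring))
    · exact hxc (hS.eq_of_smul_eq (β := (1 - a - b) / a) (γ := b / a)
          (div_nonneg (by linarith) ha.le) (by positivity) hx.1 hz.1 hy.1 hc.2
          (by rw [hcc]; match_scalars <;> field_simp <;> ring))

/-- `Y` arises from the range `{x | l • x + w ∈ S}`, which has three points of `X` on its boundary,
by dropping one of these. The side conditions ensure that each range yields at most one `Y`. -/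
def IsTripleRange (S : Set Pt) (z : Pt) (X Y : Finset Pt) (l : ℝ) (w : Pt) : Prop :=
  0 < l ∧ ∃ v ∈ X, ∃ a ∈ X, ∃ c ∈ X, v ≠ a ∧ v ≠ c ∧ a ≠ c ∧
    l • v + w ∈ S \ interior S ∧ l • a + w ∈ S \ interior S ∧ l • c + w ∈ S \ interior S ∧
    (∀ x, x ∈ Y ↔ x ∈ X ∧ l • x + w ∈ S ∧ x ≠ v) ∧
    ((IsLeftmost S z X Y l w ∧ ∀ x ∈ X, l • x + w ≠ z) ∨ (l • a + w = z ∧ v 0 < c 0))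

section

variable {S : Set Pt} {z : Pt} {X Y Y₁ Y₂ : Finset Pt} {l : ℝ} {w : Pt}

theorem IsSmoothBody.mem_diff (hS : IsSmoothBody S z) : z ∈ S \ interior S :=
  ⟨hS.mem, hS.notMem_interior_of_le le_rfl⟩

theorem IsLeftmost.not_two (hS : IsSmoothBody S z) (hX : RangeGeneric S X)
    (h₁ : IsLeftmost S z X Y₁ l w) (h₂ : IsLeftmost S z X Y₂ l w)
    (hXz : ∀ x ∈ X, l • x + w ≠ z) {v₁ v₂ c : Pt} (hv₁X : v₁ ∈ X) (hv₂X : v₂ ∈ X) (hcX : c ∈ X)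
    (hv₁ : l • v₁ + w ∈ S \ interior S) (hv₂ : l • v₂ + w ∈ S \ interior S)
    (hc : l • c + w ∈ S \ interior S) (hv₁v₂ : v₁ ≠ v₂) (hv₁c : v₁ ≠ c) (hv₂c : v₂ ≠ c)
    (hY₁ : ∀ x, x ∈ Y₁ ↔ x ∈ X ∧ l • x + w ∈ S ∧ x ≠ v₁)
    (hY₂ : ∀ x, x ∈ Y₂ ↔ x ∈ X ∧ l • x + w ∈ S ∧ x ≠ v₂) : False := by
  have hl := h₁.1.1
  have inj : ∀ {u v : Pt}, u ≠ v → l • u + w ≠ l • v + w := by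
    intro u v huv h
    exact huv (smul_right_injective _ hl.ne' (add_right_cancel h))
  have hU : ∀ {Y : Finset Pt} {v a b : Pt}, a ∈ X → b ∈ X → v ∈ X →
      l • v + w ∈ S \ interior S → l • a + w ∈ S \ interior S → l • b + w ∈ S \ interior S →
      v ≠ a → v ≠ b → a ≠ b → (∀ x, x ∈ Y ↔ x ∈ X ∧ l • x + w ∈ S ∧ x ≠ v) →
      ∀ y ∈ Y, l • y + w ∉ interior S → l • y + w = l • a + w ∨ l • y + w = l • b + w := by
    intro Y v a b ha hb hv hv' ha' hb' h1 h2 h3 hY y hy hi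
    rw [hY] at hy
    rcases hX.eq_or_eq_or_eq hl hy.1 hv ha hb ⟨hy.2.1, hi⟩ hv' ha' hb' h1 h2 h3 with rfl | rfl | rfl
    · exact (hy.2.2 rfl).elim
    · exact Or.inl rfl
    · exact Or.inr rfl
  have hV : ∀ {Y : Finset Pt} {v : Pt}, (∀ x, x ∈ Y ↔ x ∈ X ∧ l • x + w ∈ S ∧ x ≠ v) →
      ∀ x ∈ X, x ∉ Y → l • x + w ∈ S → l • x + w = l • v + w := by
    intro Y v hY x hx hxY hxS
    rw [hY] at hxY
    have : x = v := by by_contra h; exact hxY ⟨hx, hxS, h⟩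
    rw [this]
  obtain ⟨r, s, hr0, hr1, hs0, hs1, h⟩ := hS.strictConvex.exists_chord_crossing hS.mem_diff hv₁ hv₂
    hc (hXz _ hv₁X).symm (hXz _ hv₂X).symm (hXz _ hcX).symm (inj hv₁v₂) (inj hv₁c) (inj hv₂c)
  rcases h with h | h | h
  · exact h₁.not_cross hS hv₂.1 hc.1 hv₁ (hXz _ hcX) (hXz _ hv₁X) (inj hv₁v₂) hr0 hr1 hs0 hs1 h
      (hU hv₂X hcX hv₁X hv₁ hv₂ hc hv₁v₂ hv₁c hv₂c hY₁) (hV hY₁)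
  · exact h₂.not_cross hS hv₁.1 hc.1 hv₂ (hXz _ hcX) (hXz _ hv₂X) (inj hv₁v₂.symm) hr0 hr1 hs0 hs1 h
      (hU hv₁X hcX hv₂X hv₂ hv₁ hc hv₁v₂.symm hv₂c hv₁c hY₂) (hV hY₂)
  · exact h₁.not_cross hS hc.1 hv₂.1 hv₁ (hXz _ hv₂X) (hXz _ hv₁X) (inj hv₁c) hr0 hr1 hs0 hs1 h
      (hU hcX hv₂X hv₁X hv₁ hc hv₂ hv₁c hv₁v₂ hv₂c.symm hY₁) (hV hY₁)

theorem IsTripleRange.unique (hS : IsSmoothBody S z) (hX : RangeGeneric S X)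
    (h₁ : IsTripleRange S z X Y₁ l w) (h₂ : IsTripleRange S z X Y₂ l w) : Y₁ = Y₂ := by
  obtain ⟨hl, v₁, hv₁X, a₁, ha₁X, c₁, hc₁X, hva₁, hvc₁, hac₁, hv₁, ha₁, hc₁, hY₁, h₁⟩ := h₁
  obtain ⟨-, v₂, hv₂X, a₂, ha₂X, c₂, hc₂X, hva₂, hvc₂, hac₂, hv₂, ha₂, hc₂, hY₂, h₂⟩ := h₂
  by_cases hvv : v₁ = v₂
  · ext x; rw [hY₁, hY₂, hvv]
  exfalso
  have hv₂' := (hX.eq_or_eq_or_eq hl hv₂X hv₁X ha₁X hc₁X hv₂ hv₁ ha₁ hc₁ hva₁ hvc₁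
    hac₁).resolve_left (Ne.symm hvv)
  have hv₁' := (hX.eq_or_eq_or_eq hl hv₁X hv₂X ha₂X hc₂X hv₁ hv₂ ha₂ hc₂ hva₂ hvc₂
    hac₂).resolve_left hvv
  rcases h₁ with ⟨h₁, hz⟩ | ⟨hz₁, h₁⟩ <;> rcases h₂ with ⟨h₂, hz'⟩ | ⟨hz₂, h₂⟩
  · rcases hv₂' with rfl | rfl
    · exact IsLeftmost.not_two hS hX h₁ h₂ hz hv₁X ha₁X hc₁X hv₁ ha₁ hc₁ hva₁ hvc₁ hac₁ hY₁ hY₂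
    · exact IsLeftmost.not_two hS hX h₁ h₂ hz hv₁X hc₁X ha₁X hv₁ hc₁ ha₁ hvc₁ hva₁ hac₁.symm hY₁ hY₂
  · exact hz _ ha₂X hz₂
  · exact hz' _ ha₁X hz₁
  · have haa : a₁ = a₂ := smul_right_injective _ hl.ne' (add_right_cancel (hz₁.trans hz₂.symm))
    subst haa
    have e1 := hv₂'.resolve_left hva₂
    have e2 := hv₁'.resolve_left hva₁
    subst e1 e2
    exact lt_asymm h₁ h₂

/-- `Y` is separated by a range with rightmost point `p ∈ Y`. -/
def IsTipRange (S : Set Pt) (z : Pt) (X Y : Finset Pt) (p : Pt) (l : ℝ) (w : Pt) : Prop :=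
  Separates S X Y l w ∧ p ∈ Y ∧ l • p + w = z

theorem IsTipRange.eq_of_card_eq_of_le (hS : IsSmoothBody S z) (hX : RangeGeneric S X) {p : Pt}
    {l₁ l₂ : ℝ} {w₁ w₂ : Pt} (hY₁X : Y₁ ⊆ X) (hY₂X : Y₂ ⊆ X)
    (h₁ : IsTipRange S z X Y₁ p l₁ w₁) (h₂ : IsTipRange S z X Y₂ p l₂ w₂)
    (hn₁ : ∀ l w, ¬ IsTripleRange S z X Y₁ l w) (hn₂ : ∀ l w, ¬ IsTripleRange S z X Y₂ l w)
    (hcard : Y₁.card = Y₂.card) (hle : l₂ ≤ l₁) : Y₁ = Y₂ := by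
  obtain ⟨⟨hl₁, hY₁, hI₁⟩, hpY₁, hp₁⟩ := h₁
  obtain ⟨⟨hl₂, hY₂, hI₂⟩, hpY₂, hp₂⟩ := h₂
  have hw₁ : w₁ = z - l₁ • p := by rw [← hp₁]; abel
  have hw₂ : w₂ = z - l₂ • p := by rw [← hp₂]; abel
  rcases hle.eq_or_lt with rfl | hlt
  · obtain rfl : w₁ = w₂ := by rw [hw₁, hw₂]
    by_contra hne
    have hs₁ : ¬ Y₁ ⊆ Y₂ := fun h => hne (Finset.eq_of_subset_of_card_le h hcard.ge)
    have hs₂ : ¬ Y₂ ⊆ Y₁ := fun h => hne (Finset.eq_of_subset_of_card_le h hcard.le).symm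
    obtain ⟨x₁, hx₁, hx₁'⟩ := Finset.not_subset.1 hs₁
    obtain ⟨x₂, hx₂, hx₂'⟩ := Finset.not_subset.1 hs₂
    have key : ∀ {Y Y' : Finset Pt} {x x' : Pt}, Y ⊆ X → (∀ y ∈ Y, l₂ • y + w₁ ∈ S) →
        (∀ x ∈ X, l₂ • x + w₁ ∈ interior S → x ∈ Y) → p ∈ Y → Y' ⊆ X →
        (∀ y ∈ Y', l₂ • y + w₁ ∈ S) →
        (∀ x ∈ X, l₂ • x + w₁ ∈ interior S → x ∈ Y') → x ∈ Y → x ∉ Y' → x' ∈ Y' → x' ∉ Y → p ∈ Y' →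
        x' 0 < x 0 → (∀ l w, ¬ IsTripleRange S z X Y l w) → False := by
      intro Y Y' x x' hYX hYS hI hpY hYX' hYS' hI' hx hx' hxx hxx' hpY' hlt hn
      have hxp : x ≠ p := by rintro rfl; exact hx' hpY'
      have hxp' : x' ≠ p := by rintro rfl; exact hxx' hpY
      have hxx'' : x' ≠ x := by rintro rfl; exact hx' hxx
      have hp' : l₂ • p + w₁ ∈ S \ interior S := by rw [hp₁]; exact hS.mem_diff
      have f1 : l₂ • x' + w₁ ∈ S \ interior S :=
        ⟨hYS' _ hxx, fun h => hxx' (hI _ (hYX' hxx) h)⟩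
      have f2 : l₂ • x + w₁ ∈ S \ interior S :=
        ⟨hYS _ hx, fun h => hx' (hI' _ (hYX hx) h)⟩
      refine hn l₂ w₁ ⟨hl₁, x', hYX' hxx, p, hYX hpY, x, hYX hx, hxp', hxx'', hxp.symm, f1, hp', f2,
        fun y => ⟨fun hy => ⟨hYX hy, hYS _ hy, ?_⟩, fun ⟨hyX, hyS, hy⟩ => ?_⟩, Or.inr ⟨hp₁, hlt⟩⟩
      · rintro rfl; exact hxx' hy
      · by_cases hi : l₂ • y + w₁ ∈ interior S
        · exact hI _ hyX hi
        · rcases hX.eq_or_eq_or_eq hl₁ hyX (hYX' hxx) (hYX hpY) (hYX hx) ⟨hyS, hi⟩ f1 hp' f2 hxp'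
            hxx'' hxp.symm with rfl | rfl | rfl
          · exact (hy rfl).elim
          · exact hpY
          · exact hx
    have hne' : x₁ 0 ≠ x₂ 0 := by
      intro h
      rw [hX.1 _ (hY₁X hx₁) _ (hY₂X hx₂) h] at hx₁
      exact hx₂' hx₁
    rcases lt_or_gt_of_ne hne' with h | h
    · exact key hY₂X hY₂ hI₂ hpY₂ hY₁X hY₁ hI₁ hx₂ hx₂' hx₁ hx₁' hpY₁ h hn₂
    · exact key hY₁X hY₁ hI₁ hpY₁ hY₂X hY₂ hI₂ hx₁ hx₁' hx₂ hx₂' hpY₂ h hn₁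
  · refine Finset.eq_of_subset_of_card_le (fun y hy => ?_) hcard.ge
    by_cases hyp : y = p
    · rw [hyp]; exact hpY₂
    apply hI₂ y (hY₁X hy)
    by_contra hi
    have := hS.strictConvex.eq hS.mem (hY₁ y hy) (a := 1 - l₂ / l₁) (b := l₂ / l₁)
      (by rw [sub_pos, div_lt_one hl₁]; exact hlt) (by positivity) (by ring) (fun h => hi (by
        convert h using 1
        rw [hw₁, hw₂]; match_scalars <;> field_simp <;> ring))
    rw [← hp₁] at this
    exact hyp (smul_right_injective _ hl₁.ne' (add_right_cancel this)).symm

theorem IsTipRange.eq_of_card_eq (hS : IsSmoothBody S z) (hX : RangeGeneric S X) {p : Pt}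
    {l₁ l₂ : ℝ} {w₁ w₂ : Pt} (hY₁X : Y₁ ⊆ X) (hY₂X : Y₂ ⊆ X)
    (h₁ : IsTipRange S z X Y₁ p l₁ w₁) (h₂ : IsTipRange S z X Y₂ p l₂ w₂)
    (hn₁ : ∀ l w, ¬ IsTripleRange S z X Y₁ l w) (hn₂ : ∀ l w, ¬ IsTripleRange S z X Y₂ l w)
    (hcard : Y₁.card = Y₂.card) : Y₁ = Y₂ := by
  rcases le_total l₂ l₁ with h | h
  · exact h₁.eq_of_card_eq_of_le hS hX hY₁X hY₂X h₂ hn₁ hn₂ hcard h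
  · exact (h₂.eq_of_card_eq_of_le hS hX hY₂X hY₁X h₁ hn₂ hn₁ hcard.symm h).symm

end

section

variable {S : Set Pt} {z : Pt} {X Y : Finset Pt} {l : ℝ} {w p : Pt}

open Filter Topology in
/-- Separating ranges that avoid a point `x` to the left of `p ∈ Y` and whose rightmost point is not
too far to the right are bounded in size. -/
theorem IsSmoothBody.exists_ratio_lower_bound (hS : IsSmoothBody S z) {g : Pt} (hg : g 0 < 0)
    (ρ : ℝ) : ∃ m : ℝ, 0 < m ∧ ∀ (l : ℝ) (s : Pt), 0 < l → s ∈ S → z 0 - s 0 ≤ l * ρ →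
      s + l • g ∉ interior S → m ≤ l := by
  obtain ⟨τ, hτ, hmem⟩ := hS.exists_mem_interior g hg
  have hopen : IsOpen {s : Pt | s + τ • g ∈ interior S} :=
    isOpen_interior.preimage (f := fun s : Pt => s + τ • g) (by fun_prop)
  have hK : IsCompact (S \ {s : Pt | s + τ • g ∈ interior S}) := hS.compact.diff hopen
  obtain ⟨τ₁, hτ₁, h₁⟩ : ∃ τ₁ : ℝ, 0 < τ₁ ∧ ∀ s ∈ S \ {s : Pt | s + τ • g ∈ interior S},
      τ₁ ≤ z 0 - s 0 := by
    rcases (S \ {s : Pt | s + τ • g ∈ interior S}).eq_empty_or_nonempty with h | h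
    · exact ⟨1, one_pos, by simp [h]⟩
    · obtain ⟨s, hs, hmin⟩ := hK.exists_isMinOn h
        (f := fun s : Pt => z 0 - s 0) (by fun_prop)
      refine ⟨z 0 - s 0, sub_pos.2 (hS.lt_of_ne s hs.1 ?_), fun s' hs' => hmin hs'⟩
      rintro rfl
      exact hs.2 hmem
  refine ⟨min τ (τ₁ / (|ρ| + 1)), by positivity, fun l s hl hs hle hi => ?_⟩
  by_cases hsN : s + τ • g ∈ interior S
  · refine (min_le_left _ _).trans ?_
    by_contra! hlt
    apply hi
    have := hS.strictConvex.convex.combo_self_interior_mem_interior hs hsN (a := 1 - l / τ)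
      (b := l / τ) (by rw [sub_nonneg, div_le_one hτ]; exact hlt.le) (by positivity) (by ring)
    convert this using 1
    match_scalars <;> field_simp <;> ring
  · refine (min_le_right _ _).trans ?_
    rw [div_le_iff₀ (by positivity)]
    have := h₁ s ⟨hs, hsN⟩
    nlinarith [le_abs_self ρ]

theorem IsSmoothBody.exists_isLeftmost (hS : IsSmoothBody S z) (hsep : Separates S X Y l w)
    {p' x : Pt} (hp : p ∈ Y) (hp' : p' ∈ Y) (hne : p' ≠ p) (hx : x ∈ X) (hxY : x ∉ Y)
    (hxp : x 0 < p 0) : ∃ l' w', IsLeftmost S z X Y l' w' := by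
  obtain ⟨R, hR⟩ := isBounded_iff_forall_norm_le.1 hS.compact.isBounded
  have hpp : 0 < ‖p' - p‖ := norm_pos_iff.2 (sub_ne_zero.2 hne)
  obtain ⟨m, hm, hml⟩ := hS.exists_ratio_lower_bound (g := x - p)
    (by rw [PiLp.sub_apply]; linarith) ((z 0 - w 0) / l - p 0)
  have hcorner : ∀ (l' : ℝ) (s x : Pt), l' • x + (s - l' • p) = s + l' • (x - p) :=
    fun l' s x => by module
  let C : Set (ℝ × Pt) := {θ | θ ∈ Icc m (2 * R / ‖p' - p‖) ×ˢ S ∧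
    (∀ y ∈ Y, θ.2 + θ.1 • (y - p) ∈ S) ∧
      ∀ x ∈ X, x ∉ Y → θ.2 + θ.1 • (x - p) ∉ interior S}
  have hCc : IsCompact C := by
    have h1 : IsClosed {θ : ℝ × Pt | (∀ y ∈ Y, θ.2 + θ.1 • (y - p) ∈ S) ∧
        ∀ x ∈ X, x ∉ Y → θ.2 + θ.1 • (x - p) ∉ interior S} := by
      have h2 : {θ : ℝ × Pt | (∀ y ∈ Y, θ.2 + θ.1 • (y - p) ∈ S) ∧
          ∀ x ∈ X, x ∉ Y → θ.2 + θ.1 • (x - p) ∉ interior S} =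
          (⋂ y ∈ Y, (fun θ : ℝ × Pt => θ.2 + θ.1 • (y - p)) ⁻¹' S) ∩
            ⋂ x ∈ X, ⋂ (_ : x ∉ Y), (fun θ : ℝ × Pt => θ.2 + θ.1 • (x - p)) ⁻¹' (interior S)ᶜ := by
        ext; simp
      rw [h2]
      exact (isClosed_biInter fun y _ => hS.compact.isClosed.preimage (by fun_prop)).inter
        (isClosed_biInter fun x _ => isClosed_iInter fun _ =>
          isOpen_interior.isClosed_compl.preimage (by fun_prop))
    exact (isCompact_Icc.prod hS.compact).inter_right h1
  have hCmem : ∀ (l' : ℝ) (w' : Pt), Separates S X Y l' w' →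
      (z 0 - w' 0) / l' ≤ (z 0 - w 0) / l → (l', l' • p + w') ∈ C := by
    intro l' w' ⟨hl', hY', hX'⟩ hle
    have e : ∀ x : Pt, l' • p + w' + l' • (x - p) = l' • x + w' := fun x => by module
    refine ⟨⟨⟨?_, ?_⟩, hY' p hp⟩, fun y hy => ?_, fun x hx hxY hi => hxY ?_⟩
    · refine hml l' (l' • p + w') hl' (hY' p hp) ?_ ?_
      · rw [div_le_iff₀ hl'] at hle
        simp only [PiLp.add_apply, PiLp.smul_apply, smul_eq_mul]
        linarith
      · rw [e]; exact fun hi => hxY (hX' x hx hi)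
    · rw [le_div_iff₀ hpp]
      have h1 := norm_sub_le (l' • p' + w') (l' • p + w')
      have e1 : l' • p' + w' - (l' • p + w') = l' • (p' - p) := by module
      rw [e1, norm_smul, Real.norm_of_nonneg hl'.le] at h1
      linarith [hR _ (hY' p' hp'), hR _ (hY' p hp)]
    · simp only [e]; exact hY' y hy
    · simp only [e] at hi; exact hX' x hx hi
  obtain ⟨⟨l', s⟩, hθ, hmin⟩ := hCc.exists_isMinOn ⟨_, hCmem l w hsep le_rfl⟩
    (f := fun θ : ℝ × Pt => (z 0 - (θ.2 - θ.1 • p) 0) / θ.1) (by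
      refine ContinuousOn.div (by fun_prop) (by fun_prop) fun θ hθ => ?_
      exact (hm.trans_le hθ.1.1.1).ne')
  refine ⟨l', s - l' • p, ⟨hm.trans_le hθ.1.1.1, fun y hy => ?_, fun x hx hi => ?_⟩, ?_⟩
  · rw [hcorner]; exact hθ.2.1 y hy
  · rw [hcorner] at hi
    by_contra hxY
    exact hθ.2.2 x hx hxY hi
  · have main : ∀ (l'' : ℝ) (w'' : Pt), Separates S X Y l'' w'' →
        (z 0 - w'' 0) / l'' ≤ (z 0 - w 0) / l →
        (z 0 - (s - l' • p) 0) / l' ≤ (z 0 - w'' 0) / l'' := by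
      intro l'' w'' h h'
      have := hmin (hCmem l'' w'' h h')
      simpa using this
    intro l'' w'' h
    rcases le_total ((z 0 - w'' 0) / l'') ((z 0 - w 0) / l) with h' | h'
    · exact main l'' w'' h h'
    · exact (main l w hsep le_rfl).trans h'

open Filter Topology in
theorem IsSmoothBody.exists_isTipRange_singleton (hS : IsSmoothBody S z) :
    ∃ l w, IsTipRange S z X {p} p l w := by
  obtain ⟨R, hR⟩ := isBounded_iff_forall_norm_le.1 hS.compact.isBounded
  have ev : ∀ᶠ l : ℝ in atTop, ∀ x ∈ X, x ≠ p → z + l • (x - p) ∉ S := by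
    rw [Filter.eventually_all_finset]
    intro x _
    by_cases hxp : x = p
    · simp [hxp]
    have hpos : 0 < ‖x - p‖ := norm_pos_iff.2 (sub_ne_zero.2 hxp)
    filter_upwards [eventually_gt_atTop (2 * R / ‖x - p‖), eventually_gt_atTop 0] with l h1 h2 _ h
    rw [div_lt_iff₀ hpos] at h1
    have h3 := norm_sub_le (z + l • (x - p)) z
    rw [add_sub_cancel_left, norm_smul, Real.norm_of_nonneg h2.le] at h3
    linarith [hR _ h, hR _ hS.mem]
  obtain ⟨l, h, hl⟩ := (ev.and (eventually_gt_atTop 0)).exists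
  refine ⟨l, z - l • p, ⟨hl, ?_, fun x hx hi => ?_⟩, by simp, by abel⟩
  · intro y hy
    rw [Finset.mem_singleton.1 hy, add_sub_cancel]
    exact hS.mem
  · rw [Finset.mem_singleton]
    by_contra hxp
    apply h x hx hxp
    convert interior_subset hi using 1; module

open Filter Topology in
theorem IsSmoothBody.exists_isTipRange (hS : IsSmoothBody S z) (hp : p ∈ Y)
    (hmax : ∀ y ∈ Y, y ≠ p → y 0 < p 0) (hright : ∀ x ∈ X, x ∉ Y → p 0 ≤ x 0) :
    ∃ l w, IsTipRange S z X Y p l w := by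
  have ev : ∀ᶠ l : ℝ in 𝓝[>] 0, ∀ y ∈ Y, z + l • (y - p) ∈ S := by
    rw [Filter.eventually_all_finset]
    intro y hy
    by_cases hyp : y = p
    · simp [hyp, hS.mem]
    obtain ⟨τ, hτ, hmem⟩ := hS.exists_mem_interior (y - p)
      (by have := hmax y hy hyp; rw [PiLp.sub_apply]; linarith)
    exact hS.strictConvex.convex.eventually_add_smul_mem hτ hS.mem (interior_subset hmem)
  obtain ⟨l, h, hl : 0 < l⟩ := (ev.and self_mem_nhdsWithin).exists
  have e : ∀ x : Pt, l • x + (z - l • p) = z + l • (x - p) := fun x => by module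
  refine ⟨l, z - l • p, ⟨hl, fun y hy => ?_, fun x hx hi => ?_⟩, hp, by abel⟩
  · rw [e]; exact h y hy
  · by_contra hxY
    rw [e] at hi
    refine hS.notMem_interior_of_le ?_ hi
    have := hright x hx hxY
    simp only [PiLp.add_apply, PiLp.smul_apply, PiLp.sub_apply, smul_eq_mul]
    nlinarith

open Classical in
/-- Every separable set is separated by a range with its rightmost point in `Y`, or by one that has
three points of `X` on its boundary. -/
theorem Separates.exists_isTipRange_or_isTripleRange (hsep : Separates S X Y l w)
    (hS : IsSmoothBody S z) (hX : RangeGeneric S X) (hYX : Y ⊆ X) (hY : Y.Nonempty) :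
    (∃ p l w, IsTipRange S z X Y p l w) ∨ ∃ l w, IsTripleRange S z X Y l w := by
  by_contra! ⟨hnot, hnot'⟩
  obtain ⟨p, hp, hpmax⟩ := Y.exists_max_image (fun y => y 0) hY
  have hmax : ∀ y ∈ Y, y ≠ p → y 0 < p 0 := fun y hy hyp =>
    lt_of_le_of_ne (hpmax y hy) fun h => hyp (hX.1 y (hYX hy) p (hYX hp) h)
  obtain ⟨p', hp', hne⟩ : ∃ p' ∈ Y, p' ≠ p := by
    by_contra! h
    obtain rfl : Y = {p} := by
      ext y; rw [Finset.mem_singleton]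
      exact ⟨h y, fun h => h ▸ hp⟩
    obtain ⟨l, w, h⟩ := hS.exists_isTipRange_singleton (X := X) (p := p)
    exact hnot p l w h
  obtain ⟨x, hx, hxY, hxp⟩ : ∃ x ∈ X, x ∉ Y ∧ x 0 < p 0 := by
    by_contra! h
    obtain ⟨l, w, h⟩ := hS.exists_isTipRange hp hmax h
    exact hnot p l w h
  obtain ⟨l, w, hmin⟩ := hS.exists_isLeftmost hsep hp hp' hne hx hxY hxp
  obtain ⟨hl, hYS, hXi⟩ := hmin.1
  have hYz : ∀ y ∈ Y, l • y + w ≠ z := fun y hy h => hnot y l w ⟨hmin.1, hy, h⟩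
  obtain ⟨v, hvX, hvY, hvS, hvz⟩ := hmin.exists_ne hS hYz
  obtain ⟨a, haY, hai⟩ : ∃ a ∈ Y, l • a + w ∉ interior S := by
    by_contra! h
    exact hmin.not_subset_singleton hS (hYS p hp) (hYz p hp) fun y hy hi => (hi (h y hy)).elim
  obtain ⟨c, hcY, hci, hca⟩ : ∃ c ∈ Y, l • c + w ∉ interior S ∧ l • c + w ≠ l • a + w := by
    by_contra! h
    exact hmin.not_subset_singleton hS (hYS a haY) (hYz a haY) h
  have hac : a ≠ c := by rintro rfl; exact hca rfl
  have hva : v ≠ a := by rintro rfl; exact hvY haY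
  have hvc : v ≠ c := by rintro rfl; exact hvY hcY
  have fv : l • v + w ∈ S \ interior S := ⟨hvS, fun h => hvY (hXi v hvX h)⟩
  have fa : l • a + w ∈ S \ interior S := ⟨hYS a haY, hai⟩
  have fc : l • c + w ∈ S \ interior S := ⟨hYS c hcY, hci⟩
  have hYv : ∀ x ∈ X, x ∉ Y → l • x + w ∈ S → x = v := by
    intro x hx hxY hxS
    rcases hX.eq_or_eq_or_eq hl hx hvX (hYX haY) (hYX hcY) ⟨hxS, fun h => hxY (hXi x hx h)⟩ fv fa fc
      hva hvc hac with rfl | rfl | rfl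
    · rfl
    · exact (hxY haY).elim
    · exact (hxY hcY).elim
  refine hnot' l w ⟨hl, v, hvX, a, hYX haY, c, hYX hcY, hva, hvc, hac, fv, fa, fc, fun x =>
    ⟨fun h => ⟨hYX h, hYS x h, ?_⟩, fun ⟨h1, h2, h3⟩ => ?_⟩, Or.inl ⟨hmin, fun x hx h => ?_⟩⟩
  · rintro rfl; exact hvY h
  · by_contra h
    exact h3 (hYv x h1 h h2)
  · by_cases hxY : x ∈ Y
    · exact hYz x hxY h
    · apply hvz
      rw [← hYv x hx hxY (h ▸ hS.mem), h]

end

section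

variable {S : Set Pt} {z : Pt} {X Y : Finset Pt} {l : ℝ} {w p : Pt}

open Classical in
/-- The range `{x | l • x + w ∈ S}` has `p ∈ X` on the side of its boundary opposite to the vertical
direction `d`, further boundary points in `X` on either side of `p`, and `i` resp. `j` interior
points in `X` to the left resp. right of `p`. -/
def IsMiddle (S : Set Pt) (X : Finset Pt) (l : ℝ) (w p d : Pt) (i j : ℕ) : Prop :=
  0 < l ∧ p ∈ X ∧ l • p + w ∈ S \ interior S ∧
    (∃ q ∈ X, l • q + w ∈ S \ interior S ∧ q 0 < p 0) ∧
    (∃ r ∈ X, l • r + w ∈ S \ interior S ∧ p 0 < r 0) ∧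
    (∀ s : ℝ, 0 < s → l • (p - s • d) + w ∉ S) ∧
    {x ∈ X | l • x + w ∈ interior S ∧ x 0 < p 0}.card = i ∧
    {x ∈ X | l • x + w ∈ interior S ∧ p 0 < x 0}.card = j

theorem exists_lt_lt_of_ne {P : Pt → Prop} {u v t : Pt} (hu : P u) (hv : P v) (ht : P t)
    (huv : u 0 ≠ v 0) (hut : u 0 ≠ t 0) (hvt : v 0 ≠ t 0) :
    ∃ q p r, P q ∧ P p ∧ P r ∧ q 0 < p 0 ∧ p 0 < r 0 := by
  rcases lt_or_gt_of_ne huv with h1 | h1 <;> rcases lt_or_gt_of_ne hut with h2 | h2 <;>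
    rcases lt_or_gt_of_ne hvt with h3 | h3
  · exact ⟨u, v, t, hu, hv, ht, h1, h3⟩
  · exact ⟨u, t, v, hu, ht, hv, h2, h3⟩
  · linarith
  · exact ⟨t, u, v, ht, hu, hv, h2, h1⟩
  · exact ⟨v, u, t, hv, hu, ht, h1, h2⟩
  · linarith
  · exact ⟨v, t, u, hv, ht, hu, h3, h2⟩
  · exact ⟨t, v, u, ht, hv, hu, h3, h1⟩

open Classical in
theorem IsTripleRange.exists_isMiddle (h : IsTripleRange S z X Y l w) (hS : IsSmoothBody S z)
    (hX : RangeGeneric S X) : ∃ p i j, i + j + 2 = Y.card ∧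
      (IsMiddle S X l w p (EuclideanSpace.single 1 1) i j ∨
        IsMiddle S X l w p (-EuclideanSpace.single 1 1) i j) := by
  obtain ⟨hl, v, hv, a, ha, c, hc, hva, hvc, hac, fv, fa, fc, hY, -⟩ := h
  obtain ⟨q, p, r, ⟨hq, fq⟩, ⟨hp, fp⟩, ⟨hr, fr⟩, hqp, hpr⟩ :=
    exists_lt_lt_of_ne (P := fun x => x ∈ X ∧ l • x + w ∈ S \ interior S) ⟨hv, fv⟩ ⟨ha, fa⟩ ⟨hc, fc⟩
      (fun h => hva (hX.1 _ hv _ ha h)) (fun h => hvc (hX.1 _ hv _ hc h))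
      (fun h => hac (hX.1 _ ha _ hc h))
  refine ⟨p, {x ∈ X | l • x + w ∈ interior S ∧ x 0 < p 0}.card,
    {x ∈ X | l • x + w ∈ interior S ∧ p 0 < x 0}.card, ?_, ?_⟩
  rotate_left
  · rcases hS.strictConvex.low_or_low hl (d := EuclideanSpace.single 1 1) (by simp) fp.2 with h | h
    · exact Or.inl ⟨hl, hp, fp, ⟨q, hq, fq, hqp⟩, ⟨r, hr, fr, hpr⟩, h, rfl, rfl⟩
    · exact Or.inr ⟨hl, hp, fp, ⟨q, hq, fq, hqp⟩, ⟨r, hr, fr, hpr⟩, h, rfl, rfl⟩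
  · have hYI : Y = insert a (insert c {x ∈ X | l • x + w ∈ interior S}) := by
      ext x
      rw [hY]
      simp only [Finset.mem_insert, Finset.mem_filter]
      constructor
      · rintro ⟨h1, h2, h3⟩
        by_cases hx : l • x + w ∈ interior S
        · exact Or.inr (Or.inr ⟨h1, hx⟩)
        · rcases hX.eq_or_eq_or_eq hl h1 hv ha hc ⟨h2, hx⟩ fv fa fc hva hvc hac with h | h | h
          · exact (h3 h).elim
          · exact Or.inl h
          · exact Or.inr (Or.inl h)
      · rintro (rfl | rfl | ⟨h1, h2⟩)
        · exact ⟨ha, fa.1, hva.symm⟩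
        · exact ⟨hc, fc.1, hvc.symm⟩
        · exact ⟨h1, interior_subset h2, by rintro rfl; exact fv.2 h2⟩
    rw [hYI, Finset.card_insert_of_notMem, Finset.card_insert_of_notMem,
      ← Finset.card_union_of_disjoint]
    · refine congrArg (fun F : Finset Pt => F.card + 2) ?_
      ext x
      simp only [Finset.mem_union, Finset.mem_filter]
      constructor
      · rintro (h | h) <;> exact ⟨h.1, h.2.1⟩
      · rintro ⟨h1, h2⟩
        rcases lt_trichotomy (x 0) (p 0) with h | h | h
        · exact Or.inl ⟨h1, h2, h⟩
        · obtain rfl := hX.1 x h1 p hp h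
          exact (fp.2 h2).elim
        · exact Or.inr ⟨h1, h2, h⟩
    · rw [Finset.disjoint_left]
      simp only [Finset.mem_filter]
      rintro x ⟨-, -, h⟩ ⟨-, -, h'⟩
      exact lt_asymm h h'
    · simp [fc.2]
    · simp [hac, fa.2]

theorem IsMiddle.eq {l₁ l₂ : ℝ} {w₁ w₂ d : Pt} {i j : ℕ} (hS : IsSmoothBody S z) (hd0 : d 0 = 0)
    (hd1 : d 1 ≠ 0) (h₁ : IsMiddle S X l₁ w₁ p d i j) (h₂ : IsMiddle S X l₂ w₂ p d i j) :
    l₁ = l₂ ∧ w₁ = w₂ := by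
  obtain ⟨hl₁, hp, hp₁, ⟨q₁, hq₁X, hq₁, hqp₁⟩, ⟨r₁, hr₁X, hr₁, hrp₁⟩, hlow₁, hi₁, hj₁⟩ := h₁
  obtain ⟨hl₂, -, hp₂, ⟨q₂, hq₂X, hq₂, hqp₂⟩, ⟨r₂, hr₂X, hr₂, hrp₂⟩, hlow₂, hi₂, hj₂⟩ := h₂
  exact hS.strictConvex.range_eq_of_card_eq hS.compact hl₁ hl₂ hd0 hd1 hp₁ hp₂ hq₁ hr₁ hq₂ hr₂ hq₁X
    hr₁X hq₂X hr₂X hqp₁ hrp₁ hqp₂ hrp₂ hlow₁ hlow₂ (hi₁.trans hi₂.symm) (hj₁.trans hj₂.symm)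

open Classical in
/-- A smooth body separates at most `(2 * k - 1) * X.card` sets of size `k` from a generic set. -/
theorem IsSmoothBody.card_separates_le (hS : IsSmoothBody S z) (hX : RangeGeneric S X) {k : ℕ}
    (hk : 1 ≤ k) : {Y ∈ X.powerset | Y.card = k ∧ ∃ l w, Separates S X Y l w}.card ≤
      (2 * k - 1) * X.card := by
  let d : Bool → Pt := fun σ => if σ then EuclideanSpace.single 1 1 else -EuclideanSpace.single 1 1
  have hd0 : ∀ σ, d σ 0 = 0 := by intro σ; cases σ <;> simp [d]
  have hd1 : ∀ σ, d σ 1 ≠ 0 := by intro σ; cases σ <;> simp [d]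
  let L : Finset Pt → Pt × Option (Bool × Fin (k - 1)) → Prop := fun Y u => match u with
    | (p, none) => (∀ l w, ¬ IsTripleRange S z X Y l w) ∧ ∃ l w, IsTipRange S z X Y p l w
    | (p, some (σ, i)) => ∃ l w, IsTripleRange S z X Y l w ∧ IsMiddle S X l w p (d σ) i (k - 2 - i)
  have hex : ∀ Y : Finset Pt, Y ⊆ X ∧ Y.card = k ∧ (∃ l w, Separates S X Y l w) →
      ∃ u, u.1 ∈ X ∧ L Y u := by
    rintro Y ⟨hYX, hYk, l, w, hsep⟩
    by_cases ht : ∃ l w, IsTripleRange S z X Y l w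
    · obtain ⟨l, w, ht⟩ := ht
      obtain ⟨p, i, j, hij, hm⟩ := ht.exists_isMiddle hS hX
      obtain rfl : j = k - 2 - i := by omega
      rcases hm with hm | hm
      · exact ⟨(p, some (true, ⟨i, by omega⟩)), hm.2.1, l, w, ht, by simpa [d] using hm⟩
      · exact ⟨(p, some (false, ⟨i, by omega⟩)), hm.2.1, l, w, ht, by simpa [d] using hm⟩
    · rcases hsep.exists_isTipRange_or_isTripleRange hS hX hYX
        (Finset.card_pos.1 (by omega)) with ⟨p, l, w, h⟩ | h
      · exact ⟨(p, none), hYX h.2.1, by push Not at ht; exact ht, l, w, h⟩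
      · exact (ht h).elim
  have hinj : ∀ (Y₁ Y₂ : Finset Pt) (u), Y₁ ⊆ X → Y₂ ⊆ X → Y₁.card = Y₂.card → L Y₁ u → L Y₂ u →
      Y₁ = Y₂ := by
    rintro Y₁ Y₂ ⟨p, - | ⟨σ, i⟩⟩ hY₁ hY₂ hcard h₁ h₂
    · obtain ⟨hn₁, l₁, w₁, h₁⟩ := h₁
      obtain ⟨hn₂, l₂, w₂, h₂⟩ := h₂
      exact h₁.eq_of_card_eq hS hX hY₁ hY₂ h₂ hn₁ hn₂ hcard
    · obtain ⟨l₁, w₁, ht₁, hm₁⟩ := h₁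
      obtain ⟨l₂, w₂, ht₂, hm₂⟩ := h₂
      obtain ⟨rfl, rfl⟩ := hm₁.eq hS (hd0 σ) (hd1 σ) hm₂
      exact ht₁.unique hS hX ht₂
  have hcard : (X ×ˢ (Finset.univ : Finset (Option (Bool × Fin (k - 1))))).card =
      (2 * k - 1) * X.card := by
    rw [Finset.card_product, Finset.card_univ, Fintype.card_option, Fintype.card_prod,
      Fintype.card_bool, Fintype.card_fin, mul_comm]
    congr 1
    omega
  choose! f hf using hex
  rw [← hcard]
  refine Finset.card_le_card_of_injOn f (fun Y hY => ?_) fun Y₁ h₁ Y₂ h₂ h => ?_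
  · simp only [Finset.coe_filter, mem_ofPred_eq, Finset.mem_powerset] at hY
    simpa using (hf Y hY).1
  · simp only [Finset.coe_filter, mem_ofPred_eq, Finset.mem_powerset] at h₁ h₂
    refine hinj Y₁ Y₂ (f Y₁) h₁.1 h₂.1 (h₁.2.1.trans h₂.2.1.symm) (hf Y₁ h₁).2 ?_
    rw [h]
    exact (hf Y₂ h₂).2

end

section

open Filter Topology in
/-- Every compact convex set is contained in the interior of an arbitrarily close smooth body. -/
theorem Convex.exists_isSmoothBody {S : Set Pt} (hconv : Convex ℝ S) (hcomp : IsCompact S)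
    (hne : S.Nonempty) {ε : ℝ} (hε : 0 < ε) :
    ∃ S' z, IsSmoothBody S' z ∧ S ⊆ interior S' ∧
      ∀ x ∈ S', ∃ s ∈ S, (x 0 - s 0) ^ 2 + (x 1 - s 1) ^ 2 ≤ ε := by
  obtain ⟨m, hm, hmax⟩ := hcomp.exists_isMaxOn hne
    (f := fun s : Pt => s 0 ^ 2 + s 1 ^ 2) (by fun_prop)
  set M : ℝ := m 0 ^ 2 + m 1 ^ 2 + 1 with hM
  have hM0 : 0 < M := by positivity
  obtain ⟨η, hη, hηM⟩ : ∃ η : ℝ, 0 < η ∧ η * M = ε := ⟨ε / M, by positivity, by field_simp⟩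
  let q : Pt → Pt → ℝ := fun x s =>
    (x 0 - s 0) ^ 2 + (x 1 - s 1) ^ 2 + η * (x 0 ^ 2 + x 1 ^ 2)
  have hqS : ∀ s ∈ S, q s s < ε := by
    intro s hs
    have h1 : s 0 ^ 2 + s 1 ^ 2 < M := by
      have : s 0 ^ 2 + s 1 ^ 2 ≤ m 0 ^ 2 + m 1 ^ 2 := hmax hs
      linarith
    have h2 := mul_lt_mul_of_pos_left h1 hη
    simp only [q]
    linarith
  let S' : Set Pt := {x | ∃ s ∈ S, q x s ≤ ε}
  have hintr : ∀ x : Pt, ∀ s ∈ S, q x s < ε → x ∈ interior S' := by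
    intro x s hs hx
    refine mem_interior.2 ⟨{x | q x s < ε}, fun y hy => ⟨s, hs, le_of_lt hy⟩, ?_, hx⟩
    exact isOpen_lt (f := fun x => q x s) (by fun_prop) continuous_const
  have hSS : S ⊆ interior S' := fun s hs => hintr s s hs (hqS s hs)
  have hSc : IsCompact S' := by
    have h1 : IsCompact ((Metric.closedBall (0 : Pt) (M + 1) ×ˢ S) ∩
        {θ : Pt × Pt | q θ.1 θ.2 ≤ ε}) :=
      ((isCompact_closedBall _ _).prod hcomp).inter_right
        (isClosed_le (f := fun θ : Pt × Pt => q θ.1 θ.2) (by fun_prop) continuous_const)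
    have h2 : S' = Prod.fst '' ((Metric.closedBall (0 : Pt) (M + 1) ×ˢ S) ∩
        {θ : Pt × Pt | q θ.1 θ.2 ≤ ε}) := by
      ext x
      constructor
      · rintro ⟨s, hs, hx⟩
        refine ⟨(x, s), ⟨⟨?_, hs⟩, hx⟩, rfl⟩
        rw [mem_closedBall_zero_iff]
        have h3 := EuclideanSpace.real_norm_sq_eq x
        rw [Fin.sum_univ_two] at h3
        have h4 : η * ‖x‖ ^ 2 ≤ η * M := by
          rw [h3, hηM]
          refine le_trans ?_ hx
          simp only [q]
          linarith [sq_nonneg (x 0 - s 0), sq_nonneg (x 1 - s 1)]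
        have h5 := le_of_mul_le_mul_left h4 hη
        nlinarith
      · rintro ⟨⟨x, s⟩, ⟨⟨-, hs⟩, hx⟩, rfl⟩
        exact ⟨s, hs, hx⟩
    rw [h2]
    exact h1.image continuous_fst
  have hScv : StrictConvex ℝ S' := by
    rintro x ⟨s, hs, hx⟩ y ⟨t, ht, hy⟩ hxy a b ha hb hab
    refine hintr _ (a • s + b • t) (hconv hs ht ha.le hb.le hab) ?_
    obtain rfl : b = 1 - a := by linarith
    have hpos : 0 < (x 0 - y 0) ^ 2 + (x 1 - y 1) ^ 2 := by
      have h3 := EuclideanSpace.real_norm_sq_eq (x - y)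
      rw [Fin.sum_univ_two] at h3
      simp only [PiLp.sub_apply] at h3
      rw [← h3]
      have := norm_pos_iff.2 (sub_ne_zero.2 hxy)
      positivity
    have hmul : 0 < η * (a * (1 - a) * ((x 0 - y 0) ^ 2 + (x 1 - y 1) ^ 2)) := by positivity
    have hmul' : 0 ≤ a * (1 - a) *
        ((x 0 - s 0 - (y 0 - t 0)) ^ 2 + (x 1 - s 1 - (y 1 - t 1)) ^ 2) := by
      positivity
    have h1 := mul_le_mul_of_nonneg_left hx ha.le
    have h2 := mul_le_mul_of_nonneg_left hy hb.le
    simp only [q, PiLp.add_apply, PiLp.smul_apply, smul_eq_mul] at h1 h2 ⊢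
    linarith
  obtain ⟨z, hz, hzmax⟩ := hSc.exists_isMaxOn ⟨m, interior_subset (hSS hm)⟩
    (f := fun x : Pt => x 0) (by fun_prop)
  have hle : ∀ x ∈ S', x 0 ≤ z 0 := fun x hx => hzmax hx
  have hzi : z ∉ interior S' := by
    intro hi
    have := notMem_interior_of_forall_gt (S := S') (l := 1) (t := 0) (w := 0) (p := z)
      (d := EuclideanSpace.single 0 1) (by
        intro t ht h
        have := hle _ h
        simp at this
        linarith)
    exact this (by simpa using hi)
  refine ⟨S', z, ⟨hSc, hScv, hz, fun s hs hsz => lt_of_le_of_ne (hle s hs) fun h => ?_, ?_⟩,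
    hSS, ?_⟩
  · refine notMem_interior_of_forall_gt (S := S') (l := 1) (t := 0) (w := 0)
      (p := (2⁻¹ : ℝ) • s + (2⁻¹ : ℝ) • z) (d := EuclideanSpace.single 0 1) (fun t ht h' => ?_) ?_
    · have := hle _ h'
      simp at this
      linarith
    · have := hScv hs hz hsz (a := 2⁻¹) (b := 2⁻¹) (by norm_num) (by norm_num) (by norm_num)
      simpa using this
  · obtain ⟨s, hs, hqs⟩ := hz
    set n₀ : ℝ := z 0 - s 0 + η * z 0 with hn₀
    set n₁ : ℝ := z 1 - s 1 + η * z 1 with hn₁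
    have hdir : ∀ g : Pt, g 0 * n₀ + g 1 * n₁ < 0 → ∃ τ : ℝ, 0 < τ ∧ z + τ • g ∈ interior S' := by
      intro g hg
      have hev : ∀ᶠ τ : ℝ in 𝓝[>] 0,
          2 * (g 0 * n₀ + g 1 * n₁) + τ * ((1 + η) * (g 0 ^ 2 + g 1 ^ 2)) < 0 := by
        refine nhdsWithin_le_nhds (ContinuousAt.eventually_lt (by fun_prop) (by fun_prop) ?_)
        linarith
      obtain ⟨τ, h, hτ : 0 < τ⟩ := (hev.and self_mem_nhdsWithin).exists
      refine ⟨τ, hτ, hintr _ s hs (lt_of_lt_of_le ?_ hqs)⟩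
      have := mul_pos_of_neg_of_neg h (neg_neg_of_pos hτ)
      simp only [q, PiLp.add_apply, PiLp.smul_apply, smul_eq_mul]
      nlinarith
    have hnon : ∀ g : Pt, 0 < g 0 → 0 ≤ g 0 * n₀ + g 1 * n₁ := by
      intro g hg
      by_contra! h
      obtain ⟨τ, hτ, h⟩ := hdir g h
      have := hle _ (interior_subset h)
      simp only [PiLp.add_apply, PiLp.smul_apply, smul_eq_mul] at this
      nlinarith
    have h1 : n₁ = 0 := by
      by_contra h
      have := hnon !₂[1, -(n₀ + 1) / n₁] (by simp)
      simp [h] at this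
      linarith
    have h0 : 0 < n₀ := by
      refine lt_of_le_of_ne (by simpa using hnon !₂[1, 0] (by simp)) fun h => ?_
      refine hzi (hintr z s hs (lt_of_le_of_lt ?_ (hqS s hs)))
      have e : q s s = q z s - 2 * ((z 0 - s 0) * n₀ + (z 1 - s 1) * n₁) +
          (1 + η) * ((z 0 - s 0) ^ 2 + (z 1 - s 1) ^ 2) := by
        simp only [q, hn₀, hn₁]; ring
      rw [e, ← h, h1]
      have : 0 ≤ (1 + η) * ((z 0 - s 0) ^ 2 + (z 1 - s 1) ^ 2) := by positivity
      linarith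
    intro g hg
    refine hdir g ?_
    rw [h1]
    nlinarith
  · rintro x ⟨s, hs, hx⟩
    refine ⟨s, hs, le_trans ?_ hx⟩
    simp only [q]
    have : 0 ≤ η * (x 0 ^ 2 + x 1 ^ 2) := by positivity
    linarith

end

section

open MeasureTheory Topology

variable {S : Set Pt}

theorem Convex.volume_setOf_boundary (hS : Convex ℝ S) {l : ℝ} (hl : 0 < l) (w : Pt) :
    volume {y : Pt | l • y + w ∈ S \ interior S} = 0 := by
  have hT : Convex ℝ {y : Pt | l • y + w ∈ S} := by
    intro x hx y hy a b ha hb hab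
    have := hS hx hy ha hb hab
    have e : l • (a • x + b • y) + w = a • (l • x + w) + b • (l • y + w) := by
      obtain rfl : b = 1 - a := by linarith
      module
    change l • (a • x + b • y) + w ∈ S
    rwa [e]
  refine measure_mono_null (fun y hy => ?_) (hT.addHaar_frontier volume)
  refine ⟨subset_closure hy.1, fun h => hy.2 ?_⟩
  rwa [interior_setOf_smul_add_mem S hl.ne'] at h

theorem volume_setOf_apply_zero_eq (c : ℝ) : volume {y : Pt | y 0 = c} = 0 := by
  have hT : Convex ℝ {y : Pt | y 0 ≤ c} := by
    intro x hx y hy a b ha hb hab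
    have h1 := mul_le_mul_of_nonneg_left (show x 0 ≤ c from hx) ha
    have h2 := mul_le_mul_of_nonneg_left (show y 0 ≤ c from hy) hb
    change (a • x + b • y) 0 ≤ c
    simp only [PiLp.add_apply, PiLp.smul_apply, smul_eq_mul]
    calc _ ≤ (a + b) * c := by linarith
      _ = c := by rw [hab, one_mul]
  refine measure_mono_null (fun y hy => ?_) (hT.addHaar_frontier volume)
  refine ⟨subset_closure (le_of_eq hy), fun h => ?_⟩
  refine notMem_interior_of_forall_gt (S := {y : Pt | y 0 ≤ c}) (l := 1) (t := 0) (w := 0) (p := y)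
    (d := EuclideanSpace.single 0 1) (fun t ht h' => ?_) (by simpa using h)
  have hyc : y 0 = c := hy
  simp [hyc] at h'
  linarith

theorem StrictConvex.volume_setOf_concyclic (hS : StrictConvex ℝ S) {a b c : Pt} (hab : a ≠ b)
    (hac : a ≠ c) (hbc : b ≠ c) :
    volume {y : Pt | ∃ (l : ℝ) (w : Pt), 0 < l ∧ l • a + w ∈ S \ interior S ∧
      l • b + w ∈ S \ interior S ∧ l • c + w ∈ S \ interior S ∧
        l • y + w ∈ S \ interior S} = 0 := by
  by_cases h : ∃ (l : ℝ) (w : Pt), 0 < l ∧ l • a + w ∈ S \ interior S ∧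
      l • b + w ∈ S \ interior S ∧ l • c + w ∈ S \ interior S
  · obtain ⟨l, w, hl, ha, hb, hc⟩ := h
    refine measure_mono_null ?_ (hS.convex.volume_setOf_boundary hl w)
    rintro y ⟨l', w', hl', ha', hb', hc', hy⟩
    obtain ⟨rfl, rfl⟩ := hS.range_unique hl hl' hab hac hbc ha hb hc ha' hb' hc'
    exact hy
  · refine measure_mono_null ?_ measure_empty
    rintro y ⟨l', w', hl', ha', hb', hc', hy⟩
    exact h ⟨l', w', hl', ha', hb', hc'⟩

open Classical in
theorem RangeGeneric.exists_insert (hS : StrictConvex ℝ S) {Z : Finset Pt} (hZ : RangeGeneric S Z)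
    {x : Pt} {U : Set Pt} (hU : U ∈ 𝓝 x) : ∃ y ∈ U, y ∉ Z ∧ RangeGeneric S (insert y Z) := by
  let B : Set Pt := (⋃ p ∈ Z, {y : Pt | y 0 = p 0}) ∪
    ⋃ a ∈ Z, ⋃ b ∈ Z, ⋃ c ∈ Z, ⋃ (_ : a ≠ b ∧ a ≠ c ∧ b ≠ c),
      {y : Pt | ∃ (l : ℝ) (w : Pt), 0 < l ∧ l • a + w ∈ S \ interior S ∧
        l • b + w ∈ S \ interior S ∧ l • c + w ∈ S \ interior S ∧ l • y + w ∈ S \ interior S}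
  have hB : volume B = 0 := by
    refine measure_union_null ?_ ?_
    · exact (measure_biUnion_null_iff Z.countable_toSet).2 fun p _ => volume_setOf_apply_zero_eq _
    · refine (measure_biUnion_null_iff Z.countable_toSet).2 fun a _ => ?_
      refine (measure_biUnion_null_iff Z.countable_toSet).2 fun b _ => ?_
      refine (measure_biUnion_null_iff Z.countable_toSet).2 fun c _ => ?_
      refine measure_iUnion_null fun h => hS.volume_setOf_concyclic h.1 h.2.1 h.2.2
  obtain ⟨y, hyU, hyB⟩ : ∃ y ∈ U, y ∉ B := by
    by_contra! h
    exact (Measure.measure_pos_of_mem_nhds volume hU).ne' (measure_mono_null h hB)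
  have hy0 : ∀ p ∈ Z, y 0 ≠ p 0 := fun p hp h =>
    hyB (Or.inl (mem_iUnion₂.2 ⟨p, hp, h⟩))
  have hy3 : ∀ a ∈ Z, ∀ b ∈ Z, ∀ c ∈ Z, a ≠ b → a ≠ c → b ≠ c → ∀ (l : ℝ) (w : Pt), 0 < l →
      l • a + w ∈ S \ interior S → l • b + w ∈ S \ interior S → l • c + w ∈ S \ interior S →
        l • y + w ∉ S \ interior S := by
    intro a ha b hb c hc hab hac hbc l w hl fa fb fc fy
    exact hyB (Or.inr (mem_iUnion₂.2 ⟨a, ha, mem_iUnion₂.2 ⟨b, hb, mem_iUnion₂.2 ⟨c, hc,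
      mem_iUnion.2 ⟨⟨hab, hac, hbc⟩, l, w, hl, fa, fb, fc, fy⟩⟩⟩⟩))
  refine ⟨y, hyU, fun h => hy0 y h rfl, fun p hp q hq hpq => ?_, fun l w hl F hF hfr => ?_⟩
  · rcases Finset.mem_insert.1 hp with rfl | hp' <;> rcases Finset.mem_insert.1 hq with rfl | hq'
    · rfl
    · exact (hy0 q hq' hpq).elim
    · exact (hy0 p hp' hpq.symm).elim
    · exact hZ.1 p hp' q hq' hpq
  · by_cases hyF : y ∈ F
    · by_contra! hcard
      have h1 := Finset.card_erase_of_mem hyF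
      obtain ⟨a, b, c, ha, hb, hc, hab, hac, hbc⟩ :=
        Finset.two_lt_card_iff.1 (show 2 < (F.erase y).card by omega)
      have hmem : ∀ u ∈ F.erase y, u ∈ Z ∧ l • u + w ∈ S \ interior S := by
        intro u hu
        obtain ⟨h1, h2⟩ := Finset.mem_erase.1 hu
        exact ⟨(Finset.mem_insert.1 (hF h2)).resolve_left h1, hfr u h2⟩
      exact hy3 a (hmem a ha).1 b (hmem b hb).1 c (hmem c hc).1 hab hac hbc l w hl (hmem a ha).2
        (hmem b hb).2 (hmem c hc).2 (hfr y hyF)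
    · exact hZ.2 l w hl F (fun u hu => (Finset.mem_insert.1 (hF hu)).resolve_left
        (by rintro rfl; exact hyF hu)) hfr

open Classical in
/-- Every finite set can be made generic by an arbitrarily small perturbation. -/
theorem StrictConvex.exists_rangeGeneric_image (hS : StrictConvex ℝ S) (X : Finset Pt)
    {U : Pt → Set Pt} (hU : ∀ x ∈ X, U x ∈ 𝓝 x) :
    ∃ g : Pt → Pt, InjOn g X ∧ (∀ x ∈ X, g x ∈ U x) ∧ RangeGeneric S (X.image g) := by
  induction X using Finset.induction_on with
  | empty =>
    refine ⟨id, by simp, by simp, by simp, fun l w _ F hF _ => ?_⟩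
    rw [Finset.image_empty, Finset.subset_empty] at hF
    simp [hF]
  | insert x X hx ih =>
    obtain ⟨g, hg, hgU, hgX⟩ := ih fun x hx => hU x (Finset.mem_insert_of_mem hx)
    obtain ⟨y, hyU, hyZ, hy⟩ := hgX.exists_insert hS (hU x (Finset.mem_insert_self x X))
    have he : ∀ u ∈ X, Function.update g x y u = g u := fun u hu =>
      Function.update_of_ne (by rintro rfl; exact hx hu) _ _
    have himg : X.image (Function.update g x y) = X.image g := Finset.image_congr he
    refine ⟨Function.update g x y, ?_, ?_, ?_⟩
    · rw [Finset.coe_insert, injOn_insert (by simpa using hx)]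
      refine ⟨hg.congr fun u hu => (he u hu).symm, ?_⟩
      rw [← Finset.coe_image, himg]
      simpa using hyZ
    · intro u hu
      rcases Finset.mem_insert.1 hu with rfl | hu
      · simpa using hyU
      · rw [he u hu]; exact hgU u hu
    · rw [Finset.image_insert, himg]
      simpa using hy

end

section

open Filter Topology

variable {S : Set Pt} {X Y : Finset Pt}

/-- The points of `X` in the range `{x | l • x + w ∈ S}` are those in `Y`. -/
def Captures (S : Set Pt) (X Y : Finset Pt) (l : ℝ) (w : Pt) : Prop :=
  0 < l ∧ ∀ x ∈ X, l • x + w ∈ S ↔ x ∈ Y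

theorem IsRange.exists_captures {T : Set Pt} (hT : IsRange S T) (h : (X : Set Pt) ∩ T = Y) :
    ∃ l w, Captures S X Y l w := by
  obtain ⟨c, v, hc, rfl⟩ := hT
  refine ⟨c⁻¹, -(c⁻¹ • v), by positivity, fun x hx => ?_⟩
  have hmem : x ∈ Y ↔ x ∈ (fun x => c • x + v) '' S := by
    rw [← Finset.mem_coe, ← h]
    simp [hx]
  rw [hmem]
  constructor
  · intro h
    refine ⟨_, h, ?_⟩
    match_scalars <;> field_simp <;> ring
  · rintro ⟨s, hs, rfl⟩
    convert hs using 1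
    match_scalars <;> field_simp <;> ring

theorem IsCompact.eventually_forall_lt_sq_dist (hS : IsCompact S) {x : Pt} (hx : x ∉ S) :
    ∀ᶠ ε : ℝ in 𝓝[>] 0, ∀ s ∈ S, ε < (x 0 - s 0) ^ 2 + (x 1 - s 1) ^ 2 := by
  rcases S.eq_empty_or_nonempty with rfl | hne
  · simp
  obtain ⟨s₀, hs₀, hmin⟩ := hS.exists_isMinOn hne
    (f := fun s : Pt => (x 0 - s 0) ^ 2 + (x 1 - s 1) ^ 2) (by fun_prop)
  have hpos : 0 < (x 0 - s₀ 0) ^ 2 + (x 1 - s₀ 1) ^ 2 := by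
    have h := EuclideanSpace.real_norm_sq_eq (x - s₀)
    rw [Fin.sum_univ_two] at h
    simp only [PiLp.sub_apply] at h
    rw [← h]
    have := norm_pos_iff.2 (sub_ne_zero.2 (show x ≠ s₀ by rintro rfl; exact hx hs₀))
    positivity
  filter_upwards [nhdsWithin_le_nhds (gt_mem_nhds hpos)] with ε hε s hs
  exact lt_of_lt_of_le hε (hmin hs)

open Classical in
theorem Convex.card_captures_le (hconv : Convex ℝ S) (hcomp : IsCompact S) (X : Finset Pt) {k : ℕ}
    (hk : 1 ≤ k) :
    {Y ∈ X.powerset | Y.card = k ∧ ∃ l w, Captures S X Y l w}.card ≤ (2 * k - 1) * X.card := by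
  set G := {Y ∈ X.powerset | Y.card = k ∧ ∃ l w, Captures S X Y l w} with hG
  rcases G.eq_empty_or_nonempty with hGe | ⟨Y₀, hY₀⟩
  · simp [hGe]
  have hGX : ∀ Y ∈ G, Y ⊆ X := fun Y hY => Finset.mem_powerset.1 (Finset.mem_filter.1 hY).1
  have hGk : ∀ Y ∈ G, Y.card = k := fun Y hY => (Finset.mem_filter.1 hY).2.1
  have hcap : ∀ Y ∈ G, ∃ l w, Captures S X Y l w := fun Y hY => (Finset.mem_filter.1 hY).2.2
  choose! l w hlw using hcap
  have hne : S.Nonempty := by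
    obtain ⟨y, hy⟩ := Finset.card_pos.1 (show 0 < Y₀.card by rw [hGk Y₀ hY₀]; omega)
    exact ⟨_, ((hlw Y₀ hY₀).2 y (hGX Y₀ hY₀ hy)).2 hy⟩
  obtain ⟨ε, hε, hε0 : 0 < ε⟩ : ∃ ε : ℝ, (∀ Y ∈ G, ∀ x ∈ X, x ∉ Y → ∀ s ∈ S,
      ε < ((l Y • x + w Y) 0 - s 0) ^ 2 + ((l Y • x + w Y) 1 - s 1) ^ 2) ∧ ε ∈ Ioi (0 : ℝ) := by
    refine Eventually.exists (f := 𝓝[>] (0 : ℝ)) (Eventually.and ?_ self_mem_nhdsWithin)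
    refine (eventually_all_finset _).2 fun Y hY => (eventually_all_finset _).2 fun x hx => ?_
    by_cases hxY : x ∈ Y
    · simp [hxY]
    · filter_upwards [hcomp.eventually_forall_lt_sq_dist
        (fun h => hxY (((hlw Y hY).2 x hx).1 h))] with ε hε _
      exact hε
  obtain ⟨S', z, hS', hSS', hS'ε⟩ := hconv.exists_isSmoothBody hcomp hne hε0
  let U : Pt → Set Pt := fun x =>
    {y | ∀ Y ∈ G, (x ∈ Y → l Y • y + w Y ∈ S') ∧ (x ∉ Y → l Y • y + w Y ∉ S')}
  have hU : ∀ x ∈ X, U x ∈ 𝓝 x := by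
    intro x hx
    refine (eventually_all_finset _).2 fun Y hY => ?_
    have hcont : Continuous fun y : Pt => l Y • y + w Y := by fun_prop
    by_cases hxY : x ∈ Y
    · have h := hSS' (((hlw Y hY).2 x hx).2 hxY)
      filter_upwards [hcont.continuousAt.eventually (isOpen_interior.mem_nhds h)] with y hy
      exact ⟨fun _ => interior_subset hy, fun h => (h hxY).elim⟩
    · have h : l Y • x + w Y ∉ S' := fun h => by
        obtain ⟨s, hs, hle⟩ := hS'ε _ h
        exact absurd (hε Y hY x hx hxY s hs) (not_lt.2 hle)
      filter_upwards [hcont.continuousAt.eventually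
        (hS'.compact.isClosed.isOpen_compl.mem_nhds h)] with y hy
      exact ⟨fun h => (hxY h).elim, fun _ => hy⟩
  obtain ⟨g, hg, hgU, hgX⟩ := hS'.strictConvex.exists_rangeGeneric_image X hU
  rw [← Finset.card_image_of_injOn hg]
  refine le_trans ?_ (hS'.card_separates_le hgX hk)
  refine Finset.card_le_card_of_injOn (fun Y => Y.image g) (fun Y hY => ?_) fun Y₁ h₁ Y₂ h₂ h => ?_
  · have hY : Y ∈ G := hY
    refine Finset.mem_coe.2 (Finset.mem_filter.2 ⟨Finset.mem_powerset.2
      (Finset.image_subset_image (hGX Y hY)), ?_, l Y, w Y, (hlw Y hY).1, ?_, ?_⟩)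
    · rw [Finset.card_image_of_injOn (hg.mono (hGX Y hY)), hGk Y hY]
    · intro y hy
      obtain ⟨x, hx, rfl⟩ := Finset.mem_image.1 hy
      exact (hgU x (hGX Y hY hx) Y hY).1 hx
    · intro y hy hi
      obtain ⟨x, hx, rfl⟩ := Finset.mem_image.1 hy
      by_contra hxY
      exact (hgU x hx Y hY).2 (fun h => hxY (Finset.mem_image_of_mem g h)) (interior_subset hi)
  · have h' : g '' Y₁ = g '' Y₂ := by
      rw [← Finset.coe_image, ← Finset.coe_image]; exact congrArg _ h
    exact_mod_cast (hg.image_eq_image_iff (by exact_mod_cast hGX Y₁ h₁)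
      (by exact_mod_cast hGX Y₂ h₂)).1 h'

theorem Finset.sum_Icc_two_mul_sub_one (k : ℕ) : ∑ j ∈ Finset.Icc 1 k, (2 * j - 1) = k ^ 2 := by
  induction k with
  | zero => simp
  | succ k ih =>
    rw [Finset.sum_Icc_succ_top (by omega), ih, show 2 * (k + 1) - 1 = 2 * k + 1 by omega]
    ring

end

/-- at most `k²·|X|` non-empty subsets of `X` of size at most `k`
are captured by a homothetic copy of a convex compact set `S`. -/
theorem captured_at_most_k_bound
    (S : Set Pt) (hconv : Convex ℝ S) (hcomp : IsCompact S)
    (X : Finset Pt) (k : ℕ) (hk : 1 ≤ k) :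
    {Y : Set Pt | Y.Nonempty ∧ Y ⊆ ↑X ∧ Y.ncard ≤ k ∧
        ∃ T : Set Pt, IsRange S T ∧ ↑X ∩ T = Y}.ncard ≤ k ^ 2 * X.card := by
  classical
  let F : Finset (Finset Pt) := {Y ∈ X.powerset | Y.card ∈ Finset.Icc 1 k ∧
    ∃ l w, Captures S X Y l w}
  have hsub : {Y : Set Pt | Y.Nonempty ∧ Y ⊆ ↑X ∧ Y.ncard ≤ k ∧
      ∃ T : Set Pt, IsRange S T ∧ ↑X ∩ T = Y} ⊆ (fun Y : Finset Pt => (Y : Set Pt)) '' F := by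
    rintro Y ⟨hne, hYX, hcard, T, hT, hXT⟩
    lift Y to Finset Pt using X.finite_toSet.subset hYX
    rw [ncard_coe_finset] at hcard
    refine ⟨Y, Finset.mem_coe.2 (Finset.mem_filter.2 ⟨Finset.mem_powerset.2 (by exact_mod_cast hYX),
      Finset.mem_Icc.2 ⟨Finset.card_pos.2 (by exact_mod_cast hne), hcard⟩,
      hT.exists_captures hXT⟩), rfl⟩
  calc _ ≤ ((fun Y : Finset Pt => (Y : Set Pt)) '' F).ncard :=
        ncard_le_ncard hsub (F.finite_toSet.image _)
    _ ≤ (F : Set (Finset Pt)).ncard := ncard_image_le F.finite_toSet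
    _ = F.card := ncard_coe_finset F
    _ = ∑ j ∈ Finset.Icc 1 k, {Y ∈ F | Y.card = j}.card :=
        Finset.card_eq_sum_card_fiberwise fun Y hY => (Finset.mem_filter.1 hY).2.1
    _ ≤ ∑ j ∈ Finset.Icc 1 k, (2 * j - 1) * X.card := by
        refine Finset.sum_le_sum fun j hj => ?_
        refine le_trans (Finset.card_le_card fun Y hY => ?_)
          (hconv.card_captures_le hcomp X (Finset.mem_Icc.1 hj).1)
        obtain ⟨hYF, hYj⟩ := Finset.mem_filter.1 hY
        obtain ⟨hYX, -, hcap⟩ := Finset.mem_filter.1 hYF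
        exact Finset.mem_filter.2 ⟨hYX, hYj, hcap⟩
    _ = k ^ 2 * X.card := by rw [← Finset.sum_mul, Finset.sum_Icc_two_mul_sub_one]
end
end

section
/- Let S ⊆ ℝ² be a nice shape and let X ⊆ ℝ² be a finite point set of n points in general position with respect to S. Then the total number of non-empty subsets Y ⊆ X for which there exists an S-range S' with X ∩ S' = Y equals the cake number C(n,3) + C(n,2) + C(n,1). -/
open Set

noncomputable section

open Filter Topology

section Convexity

variable {S : Set Pt}

lemma NiceShape.interior_nonempty (hS : NiceShape S) : (interior S).Nonempty := by
  obtain ⟨⟨p, hp⟩, hconv, hcomp, huniq, hseg⟩ := hS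
  by_contra hne
  rw [Set.not_nonempty_iff_eq_empty] at hne
  have hfr : frontier S = S := by
    rw [hcomp.isClosed.frontier_eq, hne, Set.sdiff_empty]
  rw [hfr] at huniq hseg
  have hsing : ∀ y ∈ S, y = p := fun y hy =>
    hseg y hy p hp (hconv.segment_subset hy hp)
  obtain ⟨l, -, hl⟩ := huniq p hp
  have touching (i : Fin 2) : {x : Pt | x i = p i} = l := by
    apply hl
    refine ⟨⟨(EuclideanSpace.proj i : Pt →L[ℝ] ℝ).toLinearMap, p i, ?_, rfl⟩, ?_⟩
    · intro h
      have := LinearMap.congr_fun h (EuclideanSpace.single i (1 : ℝ))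
      simp at this
    · ext x
      refine ⟨fun hx => hsing x hx.2, ?_⟩
      rintro rfl
      exact ⟨rfl, hp⟩
  have hmem : p + EuclideanSpace.single (0 : Fin 2) (1 : ℝ) ∈ {x : Pt | x 1 = p 1} := by
    simp
  rw [touching 1, ← touching 0] at hmem
  simp at hmem

lemma le_of_lt_on_interior (hconv : Convex ℝ S) (hinterior : (interior S).Nonempty)
    {f : Pt →L[ℝ] ℝ} {c : ℝ} (hf : ∀ y ∈ interior S, f y < c) {y : Pt} (hy : y ∈ S) :
    f y ≤ c := by
  have hcl : y ∈ closure (interior S) := by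
    rw [hconv.closure_interior_eq_closure_of_nonempty_interior hinterior]
    exact subset_closure hy
  have hclosed : IsClosed {z : Pt | f z ≤ c} := isClosed_le f.continuous continuous_const
  exact closure_minimal (fun z hz => (hf z hz).le) hclosed hcl

lemma NiceShape.strictConvex (hS : NiceShape S) : StrictConvex ℝ S := by
  have hinterior := hS.interior_nonempty
  obtain ⟨-, hconv, hcomp, -, hseg⟩ := hS
  intro x hx y hy hxy a b ha hb hab
  by_contra hz
  obtain ⟨f, hf⟩ := geometric_hahn_banach_open_point hconv.interior isOpen_interior hz
  have hle : ∀ u ∈ S, f u ≤ f (a • x + b • y) := fun u hu =>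
    le_of_lt_on_interior hconv hinterior hf hu
  have hfz : f (a • x + b • y) = a * f x + b * f y := by simp
  have h1 := hle x hx
  have h2 := hle y hy
  have hfx : f x = f (a • x + b • y) := by
    refine le_antisymm h1 ?_
    obtain rfl : b = 1 - a := by linarith
    nlinarith
  have hfy : f y = f (a • x + b • y) := by
    refine le_antisymm h2 ?_
    obtain rfl : b = 1 - a := by linarith
    nlinarith
  have hsub : segment ℝ x y ⊆ frontier S := by
    intro u hu
    rw [hcomp.isClosed.frontier_eq]
    refine ⟨hconv.segment_subset hx hy hu, fun hui => ?_⟩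
    have hlt := hf u hui
    obtain ⟨c, d, -, -, hcd, rfl⟩ := hu
    rw [map_add, map_smul, map_smul, smul_eq_mul, smul_eq_mul, hfx, hfy, ← add_mul, hcd,
      one_mul] at hlt
    exact lt_irrefl _ hlt
  exact hxy (hseg x (hsub (left_mem_segment ℝ x y)) y (hsub (right_mem_segment ℝ x y)) hsub)

/-- A functional that is maximised over a nice shape at `x` is an outer normal there: it is
maximised only at `x`, and every direction on which it is negative points into the interior. -/
lemma NiceShape.normal_of_lt_on_interior (hS : NiceShape S) {x : Pt} (hx : x ∈ frontier S)
    {n : Pt →L[ℝ] ℝ} (hn : ∀ y ∈ interior S, n y < n x) :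
    (∀ y ∈ S, y ≠ x → n y < n x) ∧
      ∀ d, n d < 0 → ∀ᶠ ε : ℝ in 𝓝[>] 0, x + ε • d ∈ interior S := by
  have hinterior := hS.interior_nonempty
  have hstrict := hS.strictConvex
  obtain ⟨-, hconv, hcomp, huniq, -⟩ := hS
  have hxS : x ∈ S := hcomp.isClosed.frontier_subset hx
  obtain ⟨l, -, hl⟩ := huniq x hx
  have key (f : Pt →L[ℝ] ℝ) (hf : ∀ y ∈ interior S, f y < f x) :
      (∀ y ∈ S, y ≠ x → f y < f x) ∧ {y | f y = f x} = l := by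
    have hlt : ∀ y ∈ S, y ≠ x → f y < f x := by
      intro y hy hyx
      have hm := hf _ (hstrict hy hxS hyx (a := 1 / 2) (b := 1 / 2)
        (by norm_num) (by norm_num) (by norm_num))
      simp only [map_add, map_smul, smul_eq_mul] at hm
      linarith
    refine ⟨hlt, hl _ ⟨⟨f.toLinearMap, f x, ?_, rfl⟩, ?_⟩⟩
    · intro h
      obtain ⟨y, hy⟩ := hinterior
      have h1 : f y = 0 := LinearMap.congr_fun h y
      have h2 : f x = 0 := LinearMap.congr_fun h x
      have := hf y hy
      linarith
    · ext y
      refine ⟨fun hy => by_contra fun hne => (hlt y hy.2 hne).ne hy.1, ?_⟩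
      rintro rfl
      exact ⟨rfl, hxS⟩
  obtain ⟨hn1, hn2⟩ := key n hn
  refine ⟨hn1, fun d hd => ?_⟩
  have hexists : ∃ ε : ℝ, 0 < ε ∧ x + ε • d ∈ interior S := by
    by_contra! hno
    have hray : Convex ℝ ((fun ε : ℝ => x + ε • d) '' Set.Ioi 0) := by
      have hline : (fun ε : ℝ => x + ε • d) = AffineMap.lineMap x (x + d) := by
        ext1 ε
        simp [AffineMap.lineMap_apply, add_comm]
      rw [hline]
      exact (convex_Ioi (0 : ℝ)).affine_image _
    obtain ⟨m, u, hm1, hm2⟩ := geometric_hahn_banach_open hconv.interior isOpen_interior hray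
      (by
        rw [Set.disjoint_right]
        rintro _ ⟨ε, hε, rfl⟩
        exact hno ε hε)
    have hray' : ∀ ε : ℝ, 0 < ε → u ≤ m x + ε * m d := fun ε hε => by
      simpa using hm2 _ ⟨ε, hε, rfl⟩
    have hux : u ≤ m x := by
      have ht : Tendsto (fun ε : ℝ => m x + ε * m d) (𝓝[>] 0) (𝓝 (m x + 0 * m d)) :=
        Tendsto.mono_left (Continuous.tendsto (by fun_prop) 0) nhdsWithin_le_nhds
      rw [zero_mul, add_zero] at ht
      exact ge_of_tendsto ht (eventually_mem_nhdsWithin.mono hray')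
    have hmx : m x = u := le_antisymm (le_of_lt_on_interior hconv hinterior hm1 hxS) hux
    have hmd : 0 ≤ m d := by
      have := hray' 1 one_pos
      linarith
    obtain ⟨-, hm3⟩ := key m (fun y hy => hmx ▸ hm1 y hy)
    obtain ⟨y, hy⟩ := hinterior
    have h1 := hn y hy
    have h2 := hm1 y hy
    have hz : y + ((n x - n y) / n d) • d ∈ {z | n z = n x} := by
      simp only [Set.mem_ofPred_eq, map_add, map_smul, smul_eq_mul]
      rw [div_mul_cancel₀ _ hd.ne]
      ring
    rw [hn2, ← hm3] at hz
    simp only [Set.mem_ofPred_eq, map_add, map_smul, smul_eq_mul] at hz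
    have : (n x - n y) / n d * m d ≤ 0 :=
      mul_nonpos_of_nonpos_of_nonneg (div_nonpos_of_nonneg_of_nonpos (by linarith) hd.le) hmd
    linarith
  obtain ⟨ε, hε, hεi⟩ := hexists
  filter_upwards [Ioo_mem_nhdsGT hε] with δ hδ
  have hmem := hconv.combo_self_interior_mem_interior hxS hεi
    (a := 1 - δ / ε) (b := δ / ε) (by rw [sub_nonneg, div_le_one hε]; exact hδ.2.le)
    (div_pos hδ.1 hε) (by ring)
  convert hmem using 1
  have hεδ : δ / ε * ε = δ := by field_simp
  rw [smul_add, smul_smul, hεδ]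
  module

lemma NiceShape.exists_normal (hS : NiceShape S) {x : Pt} (hx : x ∈ frontier S) :
    ∃ n : Pt →L[ℝ] ℝ, (∀ y ∈ S, y ≠ x → n y < n x) ∧
      ∀ d, n d < 0 → ∀ᶠ ε : ℝ in 𝓝[>] 0, x + ε • d ∈ interior S := by
  obtain ⟨n, hn⟩ := geometric_hahn_banach_open_point hS.2.1.interior isOpen_interior hx.2
  exact ⟨n, hS.normal_of_lt_on_interior hx hn⟩

end Convexity

section Circumscribing

variable {S : Set Pt} {p q r : Pt}

/-- The cross product of two plane vectors. -/
def cross (u v : Pt) : ℝ := u 0 * v 1 - u 1 * v 0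

lemma cross_sub_sub_rotate (p q r : Pt) :
    cross (r - q) (p - q) = cross (q - p) (r - p) := by
  simp only [cross, PiLp.sub_apply]
  ring

lemma exists_functional_lt_of_cross_ne_zero (h : cross (q - p) (r - p) ≠ 0) :
    ∃ f : Pt →L[ℝ] ℝ, f p < f r ∧ f q < f r := by
  let g : Pt →L[ℝ] ℝ :=
    (q - p) 0 • EuclideanSpace.proj 1 - (q - p) 1 • EuclideanSpace.proj 0
  have hg (x : Pt) : g x = cross (q - p) x := by simp [g, cross]
  have hpq : g p = g q := by
    rw [hg, hg]
    simp only [cross, PiLp.sub_apply]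
    ring
  have hr : g r - g p ≠ 0 := by
    rwa [← map_sub, hg]
  rcases lt_or_gt_of_ne hr with hneg | hpos
  · refine ⟨-g, ?_, ?_⟩ <;> simp only [neg_apply] <;> linarith
  · exact ⟨g, by linarith, by linarith⟩

/-- The homotheties `x ↦ t • x + w`, `t ≥ 0`, that move both `p` and `q` into `S`. -/
def pairPlacements (S : Set Pt) (p q : Pt) : Set (ℝ × Pt) :=
  {z | 0 ≤ z.1 ∧ z.1 • p + z.2 ∈ S ∧ z.1 • q + z.2 ∈ S}

lemma pairPlacements_comm : pairPlacements S p q = pairPlacements S q p := by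
  ext z
  simp only [pairPlacements, Set.mem_ofPred_eq]
  tauto

lemma smul_add_combo (x y : ℝ × Pt) (a b : ℝ) (u : Pt) :
    (a • x + b • y).1 • u + (a • x + b • y).2 =
      a • (x.1 • u + x.2) + b • (y.1 • u + y.2) := by
  simp only [Prod.fst_add, Prod.smul_fst, Prod.snd_add, Prod.smul_snd, smul_eq_mul]
  module

lemma convex_pairPlacements (hS : Convex ℝ S) : Convex ℝ (pairPlacements S p q) := by
  rintro x ⟨hx0, hxp, hxq⟩ y ⟨hy0, hyp, hyq⟩ a b ha hb hab
  refine ⟨?_, ?_, ?_⟩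
  · simp only [Prod.fst_add, Prod.smul_fst, smul_eq_mul]
    positivity
  · rw [smul_add_combo]
    exact hS hxp hyp ha hb hab
  · rw [smul_add_combo]
    exact hS hxq hyq ha hb hab

lemma isCompact_pairPlacements (hS : IsCompact S) (hpq : p ≠ q) :
    IsCompact (pairPlacements S p q) := by
  let L : Pt → ℝ := fun x => inner ℝ (q - p) x / ‖q - p‖ ^ 2
  have hcont : Continuous fun x : Pt × Pt => (L (x.2 - x.1), x.1 - L (x.2 - x.1) • p) := by
    fun_prop
  refine ((hS.prod hS).image hcont).of_isClosed_subset ?_ ?_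
  · have hc := hS.isClosed
    exact (isClosed_le continuous_const continuous_fst).inter
      ((hc.preimage (f := fun z : ℝ × Pt => z.1 • p + z.2) (by fun_prop)).inter
        (hc.preimage (f := fun z : ℝ × Pt => z.1 • q + z.2) (by fun_prop)))
  · rintro ⟨t, w⟩ ⟨-, hp, hq⟩
    refine ⟨(t • p + w, t • q + w), ⟨hp, hq⟩, ?_⟩
    have hne : ‖q - p‖ ^ 2 ≠ 0 := by
      have : q - p ≠ 0 := sub_ne_zero.2 hpq.symm
      positivity
    have hL : L (t • q + w - (t • p + w)) = t := by
      have : t • q + w - (t • p + w) = t • (q - p) := by module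
      simp only [L]
      rw [this, inner_smul_right, real_inner_self_eq_norm_sq, mul_div_cancel_right₀ _ hne]
    ext1
    · exact hL
    · simp only [hL]
      module

lemma tendsto_combo (x y : Pt) :
    Tendsto (fun s : ℝ => (1 - s) • x + s • y) (𝓝[>] 0) (𝓝 x) := by
  have h : Tendsto (fun s : ℝ => (1 - s) • x + s • y) (𝓝[>] 0)
      (𝓝 ((1 - (0 : ℝ)) • x + (0 : ℝ) • y)) :=
    Tendsto.mono_left (Continuous.tendsto (by fun_prop) 0) nhdsWithin_le_nhds
  simpa using h

/-- A placement of a pair with maximal ratio among those placing `r` in an open set is maximal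
among all placements of the pair. -/
lemma le_of_forall_placement_le (hS : Convex ℝ S) {U : Set Pt} (hU : IsOpen U) {z : ℝ × Pt}
    (hz : z ∈ pairPlacements S p q) (hzU : z.1 • r + z.2 ∈ U)
    (hmax : ∀ y ∈ pairPlacements S p q, y.1 • r + y.2 ∈ U → y.1 ≤ z.1)
    {y : ℝ × Pt} (hy : y ∈ pairPlacements S p q) : y.1 ≤ z.1 := by
  by_contra! hlt
  have hev := (tendsto_combo (z.1 • r + z.2) (y.1 • r + y.2)).eventually (hU.mem_nhds hzU)
  obtain ⟨s, hs, hs0, hs1⟩ := (hev.and (Ioo_mem_nhdsGT one_pos)).exists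
  have hmem := convex_pairPlacements hS hz hy (sub_nonneg.2 hs1.le) hs0.le (sub_add_cancel 1 s)
  have := hmax _ hmem (by rw [smul_add_combo]; exact hs)
  simp only [Prod.fst_add, Prod.smul_fst, smul_eq_mul] at this
  nlinarith

lemma eq_of_placement_maximal (hS : StrictConvex ℝ S) {z y : ℝ × Pt}
    (hz : z ∈ pairPlacements S p q) (hmax : ∀ y ∈ pairPlacements S p q, y.1 ≤ z.1)
    (hy : y ∈ pairPlacements S p q) (hyz : y.1 = z.1) : y = z := by
  by_contra hne
  have hne2 : y.2 ≠ z.2 := fun h => hne (Prod.ext hyz h)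
  have hmid {u : Pt} (hzu : z.1 • u + z.2 ∈ S) (hyu : y.1 • u + y.2 ∈ S) :
      ∀ᶠ ε : ℝ in 𝓝[>] 0, (z.1 + ε) • u + (1 / 2 : ℝ) • (y.2 + z.2) ∈ S := by
    have hinterior := hS hyu hzu (fun h => hne2 (by rwa [hyz, add_right_inj] at h))
      (a := 1 / 2) (b := 1 / 2) (by norm_num) (by norm_num) (by norm_num)
    have hlim : Tendsto (fun ε : ℝ => (z.1 + ε) • u + (1 / 2 : ℝ) • (y.2 + z.2)) (𝓝[>] 0)
        (𝓝 ((z.1 + 0) • u + (1 / 2 : ℝ) • (y.2 + z.2))) :=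
      Tendsto.mono_left (Continuous.tendsto (by fun_prop) 0) nhdsWithin_le_nhds
    refine (hlim.eventually (isOpen_interior.mem_nhds ?_)).mono fun ε hε => interior_subset hε
    convert hinterior using 1
    rw [hyz]
    module
  obtain ⟨ε, ⟨hp, hq⟩, hε⟩ :=
    (((hmid hz.2.1 hy.2.1).and (hmid hz.2.2 hy.2.2)).and self_mem_nhdsWithin).exists
  have hε' : 0 < ε := hε
  have := hmax (z.1 + ε, (1 / 2 : ℝ) • (y.2 + z.2)) ⟨by have := hz.1; positivity, hp, hq⟩
  simp only at this
  linarith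

/-- Sliding the triangle along `qr` while enlarging it keeps `q` inside and `r` outside. -/
lemma notMem_interior_of_placement_maximal (hS : Convex ℝ S) {z : ℝ × Pt} (hpos : 0 < z.1)
    (hz : z ∈ pairPlacements S p q) (hrS : z.1 • r + z.2 ∈ S)
    (hzr : z.1 • r + z.2 ∉ interior S)
    (hmax : ∀ y ∈ pairPlacements S p q, y.1 • r + y.2 ∉ interior S → y.1 ≤ z.1) :
    z.1 • p + z.2 ∉ interior S := by
  intro hp
  let w : ℝ → Pt := fun ε => z.2 + (ε * z.1) • (r - q - q)
  have hlim : Tendsto (fun ε : ℝ => (z.1 * (1 + ε)) • p + w ε) (𝓝[>] 0)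
      (𝓝 ((z.1 * (1 + 0)) • p + w 0)) :=
    Tendsto.mono_left (Continuous.tendsto (by fun_prop) 0) nhdsWithin_le_nhds
  have hev := hlim.eventually (isOpen_interior.mem_nhds (s := interior S) (by simpa [w] using hp))
  obtain ⟨ε, hε, hε0, hε1⟩ := (hev.and (Ioo_mem_nhdsGT one_pos)).exists
  have hq : (z.1 * (1 + ε)) • q + w ε ∈ S := by
    have := hS hz.2.2 hrS (sub_nonneg.2 hε1.le) hε0.le (sub_add_cancel 1 ε)
    convert this using 1
    simp only [w]
    module
  have hr : (z.1 * (1 + ε)) • r + w ε ∉ interior S := by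
    intro hr
    apply hzr
    have h2 : (1 + 2 * ε) ≠ 0 := by positivity
    have := hS.combo_self_interior_mem_interior hz.2.2 hr
      (a := 2 * ε / (1 + 2 * ε)) (b := 1 / (1 + 2 * ε)) (by positivity) (by positivity)
      (by field_simp; ring)
    convert this using 1
    simp only [w]
    match_scalars <;> field_simp <;> ring
  have := hmax (z.1 * (1 + ε), w ε) ⟨by positivity, interior_subset hε, hq⟩ hr
  simp only at this
  nlinarith

lemma exists_pos_placement_notMem_interior (hS : NiceShape S) (h : cross (q - p) (r - p) ≠ 0) :
    ∃ z ∈ pairPlacements S p q, 0 < z.1 ∧ z.1 • r + z.2 ∉ interior S := by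
  obtain ⟨f, hfp, hfq⟩ := exists_functional_lt_of_cross_ne_zero h
  obtain ⟨x, hx, hmax⟩ := hS.2.2.1.exists_isMaxOn hS.1 f.continuous.continuousOn
  have hlt : ∀ y ∈ interior S, f y < f x := by
    intro y hy
    have hlim : Tendsto (fun ε : ℝ => y + ε • (r - p)) (𝓝[>] 0) (𝓝 (y + (0 : ℝ) • (r - p))) :=
      Tendsto.mono_left (Continuous.tendsto (by fun_prop) 0) nhdsWithin_le_nhds
    rw [zero_smul, add_zero] at hlim
    obtain ⟨ε, hε, hε0⟩ :=
      ((hlim.eventually (isOpen_interior.mem_nhds hy)).and self_mem_nhdsWithin).exists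
    have hle : f (y + ε • (r - p)) ≤ f x := hmax (interior_subset hε)
    simp only [map_add, map_smul, map_sub, smul_eq_mul] at hle
    have hpos : 0 < ε * (f r - f p) := mul_pos hε0 (sub_pos.2 hfp)
    linarith
  have hxi : x ∉ interior S := fun hxi => lt_irrefl _ (hlt x hxi)
  have hdir := (hS.normal_of_lt_on_interior ⟨subset_closure hx, hxi⟩ hlt).2
  obtain ⟨ε, ⟨hp, hq⟩, hε⟩ := (((hdir (p - r) (by rw [map_sub]; linarith)).and
    (hdir (q - r) (by rw [map_sub]; linarith))).and self_mem_nhdsWithin).exists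
  have hε0 : 0 < ε := hε
  refine ⟨(ε, x - ε • r), ⟨hε0.le, ?_, ?_⟩, hε0, ?_⟩
  · convert interior_subset hp using 1
    module
  · convert interior_subset hq using 1
    module
  · simpa using hxi

/-- If the largest copy of a triangle in a nice shape has a vertex in the interior, then some copy
is inscribed. -/
lemma exists_inscribed_of_mem_interior (hS : NiceShape S) (h : cross (q - p) (r - p) ≠ 0)
    {z : ℝ × Pt} (hz : z ∈ pairPlacements S p q) (hzr : z.1 • r + z.2 ∈ interior S)
    (hmax : ∀ y ∈ pairPlacements S p q, y.1 • r + y.2 ∈ S → y.1 ≤ z.1) :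
    ∃ (t : ℝ) (w : Pt), 0 < t ∧ t • p + w ∈ frontier S ∧ t • q + w ∈ frontier S ∧
      t • r + w ∈ frontier S := by
  have hpq : p ≠ q := by
    rintro rfl
    simp [cross] at h
  have hconv := hS.2.1
  have hclosed := hS.2.2.1.isClosed
  have hzmax : ∀ y ∈ pairPlacements S p q, y.1 ≤ z.1 := fun y hy =>
    le_of_forall_placement_le hconv isOpen_interior hz hzr
      (fun y hy hyr => hmax y hy (interior_subset hyr)) hy
  have hcomp : IsCompact (pairPlacements S p q ∩
      (fun y : ℝ × Pt => y.1 • r + y.2) ⁻¹' (interior S)ᶜ) :=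
    (isCompact_pairPlacements hS.2.2.1 hpq).inter_right
      (isOpen_interior.isClosed_compl.preimage (by fun_prop))
  obtain ⟨x, hx, hxpos, hxr⟩ := exists_pos_placement_notMem_interior hS h
  obtain ⟨y, ⟨hy, hyr⟩, hymax⟩ :=
    hcomp.exists_isMaxOn ⟨x, hx, hxr⟩ continuous_fst.continuousOn
  have hypos : 0 < y.1 := hxpos.trans_le (hymax (a := x) ⟨hx, hxr⟩)
  have hymax' : ∀ u ∈ pairPlacements S p q, u.1 • r + u.2 ∉ interior S → u.1 ≤ y.1 :=
    fun u hu hur => hymax (a := u) ⟨hu, hur⟩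
  have hyrS : y.1 • r + y.2 ∈ S := by
    by_contra hyrS
    have hle := le_of_forall_placement_le hconv hclosed.isOpen_compl hy hyrS
      (fun u hu hur => hymax' u hu fun hui => hur (interior_subset hui)) hz
    obtain rfl := eq_of_placement_maximal hS.strictConvex hz hzmax hy
      (le_antisymm (hzmax y hy) hle)
    exact hyr hzr
  have hp := notMem_interior_of_placement_maximal hconv hypos hy hyrS hyr hymax'
  rw [pairPlacements_comm] at hy hymax'
  have hq := notMem_interior_of_placement_maximal hconv hypos hy hyrS hyr hymax'
  exact ⟨y.1, y.2, hypos, ⟨subset_closure hy.2.2, hp⟩, ⟨subset_closure hy.2.1, hq⟩,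
    ⟨subset_closure hyrS, hyr⟩⟩

/-- Every triangle has a positively homothetic copy inscribed in a given nice shape. -/
lemma NiceShape.exists_inscribed (hS : NiceShape S) (h : cross (q - p) (r - p) ≠ 0) :
    ∃ (t : ℝ) (w : Pt), 0 < t ∧ t • p + w ∈ frontier S ∧ t • q + w ∈ frontier S ∧
      t • r + w ∈ frontier S := by
  have hpq : p ≠ q := by
    rintro rfl
    simp [cross] at h
  have hcomp : IsCompact (pairPlacements S p q ∩ (fun y : ℝ × Pt => y.1 • r + y.2) ⁻¹' S) :=
    (isCompact_pairPlacements hS.2.2.1 hpq).inter_right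
      (hS.2.2.1.isClosed.preimage (by fun_prop))
  obtain ⟨x, hx⟩ := hS.interior_nonempty
  have hsmall (u : Pt) : ∀ᶠ ε : ℝ in 𝓝[>] 0, ε • u + x ∈ S := by
    have hlim : Tendsto (fun ε : ℝ => ε • u + x) (𝓝[>] 0) (𝓝 ((0 : ℝ) • u + x)) :=
      Tendsto.mono_left (Continuous.tendsto (by fun_prop) 0) nhdsWithin_le_nhds
    rw [zero_smul, zero_add] at hlim
    exact (hlim.eventually (isOpen_interior.mem_nhds hx)).mono fun ε hε => interior_subset hε
  obtain ⟨ε, ⟨⟨hεp, hεq⟩, hεr⟩, hε⟩ :=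
    ((((hsmall p).and (hsmall q)).and (hsmall r)).and self_mem_nhdsWithin).exists
  have hε0 : 0 < ε := hε
  obtain ⟨z, ⟨hz, hzr⟩, hmax⟩ := hcomp.exists_isMaxOn (f := Prod.fst)
    ⟨(ε, x), ⟨hε0.le, hεp, hεq⟩, hεr⟩ continuous_fst.continuousOn
  have hpos : 0 < z.1 := hε0.trans_le (hmax (a := (ε, x)) ⟨⟨hε0.le, hεp, hεq⟩, hεr⟩)
  have hmax' : ∀ y : ℝ × Pt, 0 ≤ y.1 → y.1 • p + y.2 ∈ S → y.1 • q + y.2 ∈ S →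
      y.1 • r + y.2 ∈ S → y.1 ≤ z.1 := fun y h0 h1 h2 h3 => hmax (a := y) ⟨⟨h0, h1, h2⟩, h3⟩
  by_cases hri : z.1 • r + z.2 ∈ interior S
  · exact exists_inscribed_of_mem_interior hS h hz hri
      fun y hy hyr => hmax' y hy.1 hy.2.1 hy.2.2 hyr
  have h' : cross (r - q) (p - q) ≠ 0 := by rwa [cross_sub_sub_rotate]
  by_cases hpi : z.1 • p + z.2 ∈ interior S
  · obtain ⟨t, w, ht, h1, h2, h3⟩ := exists_inscribed_of_mem_interior hS h'
      (z := z) ⟨hz.1, hz.2.2, hzr⟩ hpi fun y hy hyp => hmax' y hy.1 hyp hy.2.1 hy.2.2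
    exact ⟨t, w, ht, h3, h1, h2⟩
  have h'' : cross (p - r) (q - r) ≠ 0 := by rwa [cross_sub_sub_rotate]
  by_cases hqi : z.1 • q + z.2 ∈ interior S
  · obtain ⟨t, w, ht, h1, h2, h3⟩ := exists_inscribed_of_mem_interior hS h''
      (z := z) ⟨hz.1, hzr, hz.2.1⟩ hqi fun y hy hyq => hmax' y hy.1 hy.2.2 hyq hy.2.1
    exact ⟨t, w, ht, h2, h3, h1⟩
  exact ⟨z.1, z.2, hpos, ⟨subset_closure hz.2.1, hpi⟩, ⟨subset_closure hz.2.2, hqi⟩,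
    ⟨subset_closure hzr, hri⟩⟩

end Circumscribing

section LocalPatterns

variable {S : Set Pt}

lemma exists_sum_mul_eq_of_off_diagonal_pos (M : Fin 3 → Fin 3 → ℝ) (hdiag : ∀ i, M i i = 0)
    (hpos : ∀ i j, i ≠ j → 0 < M i j) (y : Fin 3 → ℝ) :
    ∃ a : Fin 3 → ℝ, ∀ i, ∑ j, M i j * a j = y i := by
  have hdet : (Matrix.of M).det ≠ 0 := by
    have h : (Matrix.of M).det = M 0 1 * M 1 2 * M 2 0 + M 0 2 * M 1 0 * M 2 1 := by
      rw [Matrix.det_fin_three]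
      simp [hdiag]
    have h01 := hpos 0 1 (by decide)
    have h12 := hpos 1 2 (by decide)
    have h20 := hpos 2 0 (by decide)
    have h02 := hpos 0 2 (by decide)
    have h10 := hpos 1 0 (by decide)
    have h21 := hpos 2 1 (by decide)
    rw [h]
    positivity
  refine ⟨(Matrix.of M)⁻¹.mulVec y, fun i => ?_⟩
  have h : (Matrix.of M).mulVec ((Matrix.of M)⁻¹.mulVec y) = y := by
    rw [Matrix.mulVec_mulVec, Matrix.mul_nonsing_inv _ (isUnit_iff_ne_zero.2 hdet),
      Matrix.one_mulVec]
  exact congrFun h i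

/-- A homothety that puts three points on the boundary of a nice shape can be perturbed so that
exactly a prescribed subset of the three stays in the shape, while off-boundary points do not
change sides. -/
lemma NiceShape.exists_perturbation (hS : NiceShape S) {P : Fin 3 → Pt}
    (hP : Function.Injective P) {t : ℝ} (ht : 0 < t) {w : Pt}
    (hfr : ∀ i, t • P i + w ∈ frontier S) (F : Finset Pt)
    (hF : ∀ x ∈ F, t • x + w ∉ frontier S) (σ : Fin 3 → Prop) :
    ∃ (t' : ℝ) (w' : Pt), 0 < t' ∧ (∀ i, t' • P i + w' ∈ S ↔ σ i) ∧
      ∀ x ∈ F, t' • x + w' ∈ S ↔ t • x + w ∈ S := by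
  classical
  have hclosed := hS.2.2.1.isClosed
  choose n hn hdir using fun i => hS.exists_normal (hfr i)
  set Q : Fin 3 → Pt := fun i => t • P i + w with hQ
  have hQinj : ∀ i j, i ≠ j → Q j ≠ Q i := by
    intro i j hij h
    have h1 : t • P j = t • P i := add_right_cancel h
    exact hij (hP (smul_right_injective Pt ht.ne' h1)).symm
  obtain ⟨a, ha⟩ := exists_sum_mul_eq_of_off_diagonal_pos (fun i j => n i (Q i - Q j))
    (by simp)
    (fun i j hij => by
      rw [map_sub, sub_pos]
      exact hn i _ (hclosed.frontier_subset (hfr j)) (hQinj i j hij))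
    (fun i => if σ i then -1 else 1)
  let V : Pt → Pt := fun x => ∑ j, a j • (x - Q j)
  have hV : ∀ i, n i (V (Q i)) = if σ i then -1 else 1 := by
    intro i
    rw [← ha i]
    simp only [V, map_sum, map_smul, smul_eq_mul]
    exact Finset.sum_congr rfl fun j _ => mul_comm _ _
  have hlim (x : Pt) : Tendsto (fun ε : ℝ => x + ε • V x) (𝓝[>] 0) (𝓝 x) := by
    have h : Tendsto (fun ε : ℝ => x + ε • V x) (𝓝[>] 0) (𝓝 (x + (0 : ℝ) • V x)) :=
      Tendsto.mono_left (Continuous.tendsto (by fun_prop) 0) nhdsWithin_le_nhds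
    simpa using h
  have hvert (i : Fin 3) : ∀ᶠ ε : ℝ in 𝓝[>] 0, (Q i + ε • V (Q i) ∈ S ↔ σ i) := by
    by_cases hσ : σ i
    · have := hdir i (V (Q i)) (by rw [hV, if_pos hσ]; norm_num)
      filter_upwards [this] with ε hε
      exact iff_of_true (interior_subset hε) hσ
    · filter_upwards [self_mem_nhdsWithin] with ε hε
      refine iff_of_false (fun hmem => ?_) hσ
      have hε0 : 0 < ε := hε
      have hval : n i (Q i + ε • V (Q i)) = n i (Q i) + ε := by
        rw [map_add, map_smul, hV, if_neg hσ, smul_eq_mul, mul_one]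
      have hne : Q i + ε • V (Q i) ≠ Q i := fun h => by
        rw [h] at hval
        linarith
      have := hn i _ hmem hne
      rw [hval] at this
      linarith
  have hstable (x : Pt) (hx : x ∈ F) :
      ∀ᶠ ε : ℝ in 𝓝[>] 0, ((t • x + w) + ε • V (t • x + w) ∈ S ↔ t • x + w ∈ S) := by
    by_cases hmem : t • x + w ∈ S
    · have hinterior : t • x + w ∈ interior S :=
        by_contra fun h => hF x hx ⟨subset_closure hmem, h⟩
      filter_upwards [(hlim _).eventually (isOpen_interior.mem_nhds hinterior)] with ε hε
      exact iff_of_true (interior_subset hε) hmem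
    · filter_upwards [(hlim _).eventually (hclosed.isOpen_compl.mem_nhds hmem)] with ε hε
      exact iff_of_false hε hmem
  have hratio : ∀ᶠ ε : ℝ in 𝓝[>] 0, 0 < 1 + ε * ∑ j, a j := by
    have h : Tendsto (fun ε : ℝ => 1 + ε * ∑ j, a j) (𝓝[>] 0) (𝓝 (1 + 0 * ∑ j, a j)) :=
      Tendsto.mono_left (Continuous.tendsto (by fun_prop) 0) nhdsWithin_le_nhds
    exact h.eventually (lt_mem_nhds (by simp))
  obtain ⟨ε, ⟨h1, h2⟩, h3⟩ := (((eventually_all.2 hvert).and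
    ((Finset.eventually_all F).2 hstable)).and hratio).exists
  have hmap (x : Pt) : ((1 + ε * ∑ j, a j) * t) • x +
      ((1 + ε * ∑ j, a j) • w - ε • ∑ j, a j • Q j) =
        (t • x + w) + ε • V (t • x + w) := by
    simp only [V, smul_sub, Finset.sum_sub_distrib, ← Finset.sum_smul]
    module
  refine ⟨(1 + ε * ∑ j, a j) * t, (1 + ε * ∑ j, a j) • w - ε • ∑ j, a j • Q j,
    mul_pos h3 ht, fun i => ?_, fun x hx => ?_⟩
  · rw [hmap]
    exact h1 i
  · rw [hmap]
    exact h2 x hx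

end LocalPatterns

section Crossing

variable {S : Set Pt}

lemma exists_eq_smul_add_smul {u w : Pt} (h : cross u w ≠ 0) (x : Pt) :
    ∃ α β : ℝ, x = α • u + β • w := by
  refine ⟨cross x w / cross u w, cross u x / cross u w, ?_⟩
  ext i
  fin_cases i <;>
  · simp only [PiLp.add_apply, PiLp.smul_apply, smul_eq_mul, Fin.zero_eta, Fin.mk_one]
    field_simp
    simp only [cross]
    ring

lemma functional_ext {u w : Pt} (h : cross u w ≠ 0) {f g : Pt →L[ℝ] ℝ} (hu : f u = g u)
    (hw : f w = g w) : f = g := by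
  ext x
  obtain ⟨α, β, rfl⟩ := exists_eq_smul_add_smul h x
  simp [hu, hw]

/-- `D` models the difference of the support functions of two convex sets, and the remaining
hypotheses say that the four functionals cut off the four vertices `u`, `-ρ • u`, `w`, `-σ • w`
of a quadrilateral; `hside` fixes the side on which the cone of `fq` and `fs` passes. -/
lemma sublinear_nonpos_of_alternating {D : (Pt →L[ℝ] ℝ) → ℝ}
    (hD : ∀ (α β : ℝ) (f g : Pt →L[ℝ] ℝ), 0 ≤ α → 0 ≤ β →
      D (α • f + β • g) ≤ α * D f + β * D g)
    {u w : Pt} (h : cross u w ≠ 0) {ρ σ : ℝ} (hρ : 0 < ρ) (hσ : 0 < σ)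
    {fq fs fp : Pt →L[ℝ] ℝ} (hq : D fq < 0) (hs : D fs < 0)
    (hqp : fq u < fq w) (hqr : -ρ * fq u < fq w)
    (hsp : fs u < -σ * fs w) (hsr : -ρ * fs u < -σ * fs w)
    (hpq : fp w < fp u) (hps : -σ * fp w < fp u)
    (hside : 0 < fs u * fq w - fs w * fq u) : D fp ≤ 0 := by
  set a₁ := fq u with ha₁
  set b₁ := fq w with hb₁
  set a₂ := fs u with ha₂
  set b₂ := fs w with hb₂
  set a₃ := fp u with ha₃
  set b₃ := fp w with hb₃
  have hb₁pos : 0 < b₁ := by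
    by_contra! hle
    have h1 : a₁ < 0 := by linarith
    nlinarith
  have hb₂neg : b₂ < 0 := by
    by_contra! hle
    have h1 : a₂ < 0 := by nlinarith
    nlinarith
  have ha₃pos : 0 < a₃ := by
    by_contra! hle
    have h1 : b₃ < 0 := by linarith
    nlinarith
  have hα : 0 ≤ b₃ * a₂ - a₃ * b₂ := by
    rcases le_total 0 b₃ with h3 | h3 <;> rcases le_total 0 a₂ with h2 | h2
    · nlinarith [mul_nonneg h3 h2, mul_pos ha₃pos (neg_pos.2 hb₂neg)]
    · have h1 : b₂ < a₂ := by
        have : b₁ * b₂ < b₁ * a₂ := by nlinarith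
        exact lt_of_mul_lt_mul_left this hb₁pos.le
      nlinarith
    · nlinarith
    · nlinarith [mul_nonneg_of_nonpos_of_nonpos h3 h2, mul_pos ha₃pos (neg_pos.2 hb₂neg)]
  have hβ : 0 ≤ b₁ * a₃ - a₁ * b₃ := by
    rcases le_total 0 b₃ with h3 | h3 <;> rcases le_total 0 a₁ with h1 | h1
    · nlinarith
    · nlinarith [mul_pos hb₁pos ha₃pos, mul_nonneg h3 (neg_nonneg.2 h1)]
    · nlinarith [mul_pos hb₁pos ha₃pos, mul_nonneg h1 (neg_nonneg.2 h3)]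
    · have h2 : -a₁ < σ * b₁ := by
        have : (-b₂) * (-a₁) < (-b₂) * (σ * b₁) := by nlinarith
        exact lt_of_mul_lt_mul_left this (neg_nonneg.2 hb₂neg.le)
      nlinarith
  set e := a₂ * b₁ - b₂ * a₁ with he
  have hcomb : fp = ((b₃ * a₂ - a₃ * b₂) / e) • fq + ((b₁ * a₃ - a₁ * b₃) / e) • fs := by
    apply functional_ext h
    · simp only [add_apply, smul_apply, smul_eq_mul,
        ← ha₁, ← ha₂, ← ha₃]
      field_simp
      rw [he]
      ring
    · simp only [add_apply, smul_apply, smul_eq_mul,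
        ← hb₁, ← hb₂, ← hb₃]
      field_simp
      rw [he]
      ring
  have hle := hD _ _ fq fs (div_nonneg hα hside.le) (div_nonneg hβ hside.le)
  rw [← hcomb] at hle
  have h1 := mul_nonpos_of_nonneg_of_nonpos (div_nonneg hα hside.le) hq.le
  have h2 := mul_nonpos_of_nonneg_of_nonpos (div_nonneg hβ hside.le) hs.le
  linarith

lemma false_of_alternating {D : (Pt →L[ℝ] ℝ) → ℝ} (hD0 : D 0 = 0)
    (hD : ∀ (α β : ℝ) (f g : Pt →L[ℝ] ℝ), 0 ≤ α → 0 ≤ β →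
      D (α • f + β • g) ≤ α * D f + β * D g)
    {u w : Pt} (h : cross u w ≠ 0) {ρ σ : ℝ} (hρ : 0 < ρ) (hσ : 0 < σ)
    {fp fr fq fs : Pt →L[ℝ] ℝ} (hp : 0 < D fp) (hr : 0 < D fr) (hq : D fq < 0) (hs : D fs < 0)
    (hpq : fp w < fp u) (hps : -σ * fp w < fp u)
    (hrq : fr w < -ρ * fr u) (hrs : -σ * fr w < -ρ * fr u)
    (hqp : fq u < fq w) (hqr : -ρ * fq u < fq w)
    (hsp : fs u < -σ * fs w) (hsr : -ρ * fs u < -σ * fs w) : False := by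
  rcases lt_trichotomy 0 (fs u * fq w - fs w * fq u) with hpos | hzero | hneg
  · exact hp.not_ge (sublinear_nonpos_of_alternating hD h hρ hσ hq hs hqp hqr hsp hsr hpq hps
      hpos)
  · have hb₁pos : 0 < fq w := by
      by_contra! hle
      have h1 : fq u < 0 := by linarith
      nlinarith
    have hb₂neg : fs w < 0 := by
      by_contra! hle
      have h1 : fs u < 0 := by nlinarith
      nlinarith
    have hcomb : (-fs w) • fq + fq w • fs = 0 := by
      apply functional_ext h
      · simp only [add_apply, smul_apply, smul_eq_mul, zero_apply]
        linarith
      · simp only [add_apply, smul_apply, smul_eq_mul, zero_apply]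
        ring
    have hle := hD (-fs w) (fq w) fq fs (by linarith) hb₁pos.le
    rw [hcomb, hD0] at hle
    nlinarith
  · have hinv : -ρ⁻¹ * -ρ = 1 := by
      field_simp
    refine hr.not_ge (sublinear_nonpos_of_alternating (u := -ρ • u) (w := w) (ρ := ρ⁻¹) (σ := σ)
      hD ?_ (inv_pos.2 hρ) hσ hq hs ?_ ?_ ?_ ?_ ?_ ?_ ?_)
    · have : cross (-ρ • u) w = -ρ * cross u w := by
        simp only [cross, PiLp.smul_apply, smul_eq_mul]
        ring
      rw [this]
      exact mul_ne_zero (neg_ne_zero.2 hρ.ne') h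
    all_goals simp only [map_smul, smul_eq_mul, ← mul_assoc, hinv, one_mul]
    all_goals first | assumption | nlinarith

/-- Two homothets of a compact convex set do not cross: there is no quadrilateral such that one
of them contains exactly the ends of one diagonal and the other exactly the ends of the other. -/
lemma false_of_crossing (hne : S.Nonempty) (hconv : Convex ℝ S) (hcomp : IsCompact S)
    {c₁ c₂ : ℝ} (hc₂ : 0 ≤ c₂) (hc : c₂ ≤ c₁) {v₁ v₂ : Pt} {m u w : Pt} (h : cross u w ≠ 0)
    {ρ σ : ℝ} (hρ : 0 < ρ) (hσ : 0 < σ)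
    (hp₁ : m + u ∈ (fun x => c₁ • x + v₁) '' S) (hr₁ : m + -ρ • u ∈ (fun x => c₁ • x + v₁) '' S)
    (hq₁ : m + w ∉ (fun x => c₁ • x + v₁) '' S) (hs₁ : m + -σ • w ∉ (fun x => c₁ • x + v₁) '' S)
    (hp₂ : m + u ∉ (fun x => c₂ • x + v₂) '' S) (hr₂ : m + -ρ • u ∉ (fun x => c₂ • x + v₂) '' S)
    (hq₂ : m + w ∈ (fun x => c₂ • x + v₂) '' S)
    (hs₂ : m + -σ • w ∈ (fun x => c₂ • x + v₂) '' S) : False := by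
  have hmax (f : Pt →L[ℝ] ℝ) : ∃ x ∈ S, ∀ y ∈ S, f y ≤ f x :=
    hcomp.exists_isMaxOn hne f.continuous.continuousOn
  choose x hxS hx using hmax
  let D : (Pt →L[ℝ] ℝ) → ℝ := fun f => (c₁ - c₂) * f (x f) + f (v₁ - v₂)
  have hcut {c c' : ℝ} (hc' : 0 ≤ c') {v v' y : Pt} (hy : y ∉ (fun x => c • x + v) '' S)
      (hy' : y ∈ (fun x => c' • x + v') '' S) :
      ∃ f : Pt →L[ℝ] ℝ, (∀ z ∈ (fun x => c • x + v) '' S, f z < f y) ∧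
        c * f (x f) + f v < c' * f (x f) + f v' := by
    have himage : Convex ℝ ((fun x => c • x + v) '' S) := by
      simpa only [add_comm] using hconv.affinity v c
    obtain ⟨f, a, hf, hfy⟩ := geometric_hahn_banach_closed_point himage
      (hcomp.image (by fun_prop)).isClosed hy
    refine ⟨f, fun z hz => (hf z hz).trans hfy, ?_⟩
    obtain ⟨s, hs, rfl⟩ := hy'
    have h1 := (hf _ ⟨x f, hxS f, rfl⟩).trans hfy
    have h2 := mul_le_mul_of_nonneg_left (hx f s hs) hc'
    simp only [map_add, map_smul, smul_eq_mul] at h1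
    linarith
  obtain ⟨fp, hfp, hDp⟩ := hcut (hc₂.trans hc) hp₂ hp₁
  obtain ⟨fr, hfr, hDr⟩ := hcut (hc₂.trans hc) hr₂ hr₁
  obtain ⟨fq, hfq, hDq⟩ := hcut hc₂ hq₁ hq₂
  obtain ⟨fs, hfs, hDs⟩ := hcut hc₂ hs₁ hs₂
  have hDval (f : Pt →L[ℝ] ℝ) : D f = (c₁ * f (x f) + f v₁) - (c₂ * f (x f) + f v₂) := by
    simp only [D, map_sub]
    ring
  have hD0 : D 0 = 0 := by simp [D]
  have hD : ∀ (α β : ℝ) (f g : Pt →L[ℝ] ℝ), 0 ≤ α → 0 ≤ β →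
      D (α • f + β • g) ≤ α * D f + β * D g := by
    intro α β f g hα hβ
    have h1 := mul_le_mul_of_nonneg_left (hx f _ (hxS (α • f + β • g))) hα
    have h2 := mul_le_mul_of_nonneg_left (hx g _ (hxS (α • f + β • g))) hβ
    have h3 := mul_le_mul_of_nonneg_left (add_le_add h1 h2) (sub_nonneg.2 hc)
    simp only [D, add_apply, smul_apply, smul_eq_mul]
    linarith
  have hpq := hfp _ hq₂
  have hps := hfp _ hs₂
  have hrq := hfr _ hq₂
  have hrs := hfr _ hs₂
  have hqp := hfq _ hp₁
  have hqr := hfq _ hr₁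
  have hsp := hfs _ hp₁
  have hsr := hfs _ hr₁
  simp only [map_add, map_smul, smul_eq_mul, add_lt_add_iff_left] at hpq hps hrq hrs hqp hqr hsp hsr
  exact false_of_alternating hD0 hD h hρ hσ (by rw [hDval]; linarith) (by rw [hDval]; linarith)
    (by rw [hDval]; linarith) (by rw [hDval]; linarith) hpq hps hrq hrs hqp hqr hsp hsr

end Crossing

section Counting

/-- The lower half of the sandwich theorem for set families: a family has at least as many members
as it strongly shatters sets. -/
lemma card_le_card_of_strongly_shattered {α : Type*} [DecidableEq α] {X : Finset α}
    {𝒜 ℬ : Finset (Finset α)} (h𝒜 : 𝒜 ⊆ X.powerset) (hℬ : ℬ ⊆ X.powerset)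
    (h : ∀ B ∈ ℬ, ∃ C ⊆ X \ B, ∀ B' ⊆ B, B' ∪ C ∈ 𝒜) : ℬ.card ≤ 𝒜.card := by
  have hsub : (X.powerset \ 𝒜).shatterer ⊆ X.powerset \ ℬ.image (X \ ·) := by
    intro s hs
    rw [Finset.mem_shatterer] at hs
    rw [Finset.mem_sdiff, Finset.mem_powerset, Finset.mem_image]
    have hsX : s ⊆ X := by
      obtain ⟨t, ht, hst⟩ := hs.exists_superset
      exact hst.trans (Finset.mem_powerset.1 (Finset.mem_sdiff.1 ht).1)
    refine ⟨hsX, ?_⟩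
    rintro ⟨B, hB, rfl⟩
    obtain ⟨C, hC, hall⟩ := h B hB
    obtain ⟨u, hu, hucap⟩ := hs hC
    rw [Finset.mem_sdiff, Finset.mem_powerset] at hu
    apply hu.2
    have hu' : u = (u ∩ B) ∪ C := by
      rw [← hucap]
      ext x
      have := @hu.1 x
      simp only [Finset.mem_union, Finset.mem_inter, Finset.mem_sdiff]
      tauto
    rw [hu']
    exact hall _ Finset.inter_subset_right
  have himage : (ℬ.image (X \ ·)).card = ℬ.card := by
    refine Finset.card_image_of_injOn fun B hB B' hB' hEq => ?_
    have hB := Finset.mem_powerset.1 (hℬ hB)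
    have hB' := Finset.mem_powerset.1 (hℬ hB')
    rw [← Finset.sdiff_sdiff_eq_self hB, ← Finset.sdiff_sdiff_eq_self hB']
    exact congrArg (X \ ·) hEq
  have hsubX : ℬ.image (X \ ·) ⊆ X.powerset := by
    intro s hs
    obtain ⟨B, -, rfl⟩ := Finset.mem_image.1 hs
    exact Finset.mem_powerset.2 Finset.sdiff_subset
  have h1 := Finset.card_le_card_shatterer (X.powerset \ 𝒜)
  have h2 := Finset.card_le_card hsub
  rw [Finset.card_sdiff_of_subset hsubX, himage] at h2
  rw [Finset.card_sdiff_of_subset h𝒜] at h1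
  have h3 := Finset.card_le_card hsubX
  rw [himage] at h3
  have h4 := Finset.card_le_card h𝒜
  omega

lemma card_filter_card_le_three {α : Type*} (X : Finset α) :
    (X.powerset.filter fun B => B.card ≤ 3).card =
      X.card.choose 3 + X.card.choose 2 + X.card.choose 1 + 1 := by
  classical
  have h : (X.powerset.filter fun B => B.card ≤ 3) =
      (Finset.range 4).biUnion fun k => Finset.powersetCard k X := by
    ext B
    simp only [Finset.mem_filter, Finset.mem_powerset, Finset.mem_biUnion, Finset.mem_range, Finset.mem_powersetCard]
    constructor
    · rintro ⟨h1, h2⟩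
      exact ⟨B.card, by omega, h1, rfl⟩
    · rintro ⟨k, h1, h2, rfl⟩
      exact ⟨h2, by omega⟩
  rw [h, Finset.card_biUnion]
  · simp only [Finset.card_powersetCard, Finset.sum_range_succ, Finset.range_zero, Finset.sum_empty, Nat.choose_zero_right]
    ring
  · intro i _ j _ hij
    exact Finset.pairwise_disjoint_powersetCard X hij

end Counting

section Captured

variable {S : Set Pt} {X : Finset Pt}

/-- The finset form of the captured subsets of `X`. -/
def IsCaptured (S : Set Pt) (X Y : Finset Pt) : Prop :=
  ∃ (c : ℝ) (v : Pt), 0 < c ∧ ∀ x ∈ X, x ∈ (fun y => c • y + v) '' S ↔ x ∈ Y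

lemma mem_image_homothety_iff {t : ℝ} (ht : 0 < t) (w x : Pt) :
    x ∈ (fun y => t⁻¹ • y + -(t⁻¹ • w)) '' S ↔ t • x + w ∈ S := by
  constructor
  · rintro ⟨y, hy, rfl⟩
    convert hy using 1
    simp only [smul_add, smul_neg, smul_inv_smul₀ ht.ne']
    abel
  · intro h
    refine ⟨_, h, ?_⟩
    simp only [smul_add, inv_smul_smul₀ ht.ne']
    abel

lemma mem_frontier_image_homothety_iff {t : ℝ} (ht : 0 < t) (w x : Pt) :
    x ∈ frontier ((fun y => t⁻¹ • y + -(t⁻¹ • w)) '' S) ↔ t • x + w ∈ frontier S := by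
  let e : Pt ≃ₜ Pt := (Homeomorph.smulOfNeZero t ht.ne').trans (Homeomorph.addRight w)
  have he : (fun y => t⁻¹ • y + -(t⁻¹ • w)) '' S = e ⁻¹' S := by
    ext y
    exact mem_image_homothety_iff ht w y
  rw [he, ← e.preimage_frontier]
  rfl

lemma IsCaptured.of_placement {Y : Finset Pt} {t : ℝ} (ht : 0 < t) {w : Pt}
    (h : ∀ x ∈ X, t • x + w ∈ S ↔ x ∈ Y) : IsCaptured S X Y :=
  ⟨t⁻¹, -(t⁻¹ • w), inv_pos.2 ht, fun x hx => by rw [mem_image_homothety_iff ht, h x hx]⟩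

lemma exists_isRange_inter_eq_iff {Y : Finset Pt} (hY : Y ⊆ X) :
    (∃ T : Set Pt, IsRange S T ∧ ↑X ∩ T = (Y : Set Pt)) ↔ IsCaptured S X Y := by
  constructor
  · rintro ⟨_, ⟨c, v, hc, rfl⟩, h⟩
    refine ⟨c, v, hc, fun x hx => ?_⟩
    have := Set.ext_iff.1 h x
    simp only [Set.mem_inter_iff, Finset.mem_coe, hx, true_and] at this
    exact this
  · rintro ⟨c, v, hc, h⟩
    refine ⟨_, ⟨c, v, hc, rfl⟩, ?_⟩
    ext x
    simp only [Set.mem_inter_iff, Finset.mem_coe]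
    exact ⟨fun hx => (h x hx.1).1 hx.2, fun hx => ⟨hY hx, (h x (hY hx)).2 hx⟩⟩

lemma isCaptured_empty (hS : IsCompact S) : IsCaptured S X ∅ := by
  have hcomp : IsCompact (⋃ x ∈ X, (fun y => y - x) '' S) :=
    X.isCompact_biUnion fun x _ => hS.image (by fun_prop)
  obtain ⟨w, hw⟩ := (Set.ne_univ_iff_exists_notMem _).1 hcomp.ne_univ
  refine IsCaptured.of_placement one_pos (w := w) fun x hx => ?_
  simp only [Finset.notMem_empty, iff_false]
  intro hmem
  exact hw (Set.mem_biUnion hx ⟨_, hmem, by simp⟩)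

lemma GenPos.cross_ne_zero (hX : GenPos S X) {p q r : Pt} (hp : p ∈ X) (hq : q ∈ X) (hr : r ∈ X)
    (hpq : p ≠ q) (hpr : p ≠ r) (hqr : q ≠ r) : cross (q - p) (r - p) ≠ 0 := by
  intro h
  refine hX.2.1 p hp q hq r hr hpq hpr hqr ?_
  have h0 : (q - p) 0 ≠ 0 := by
    simpa [sub_eq_zero] using (hX.1 p hp q hq hpq).symm
  rw [collinear_iff_of_mem (p₀ := p) (by simp)]
  refine ⟨q - p, ?_⟩
  simp only [Set.mem_insert_iff, Set.mem_singleton_iff, forall_eq_or_imp, forall_eq]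
  refine ⟨⟨0, by simp⟩, ⟨1, by simp⟩, ⟨(r - p) 0 / (q - p) 0, ?_⟩⟩
  have key : r - p = ((r - p) 0 / (q - p) 0) • (q - p) := by
    ext i
    fin_cases i
    · simp only [Fin.zero_eta, PiLp.smul_apply, smul_eq_mul]
      field_simp
    · simp only [Fin.mk_one, PiLp.smul_apply, smul_eq_mul]
      rw [div_mul_eq_mul_div, eq_div_iff h0]
      simp only [cross] at h
      linarith
  rw [← key]
  simp

/-- A point of the open segment between two vertices, seen from one end. -/
lemma exists_sub_eq_neg_smul {p r m : Pt} (hm : m ∈ segment ℝ p r) (hmp : m ≠ p) (hmr : m ≠ r) :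
    ∃ ρ : ℝ, 0 < ρ ∧ r = m + -ρ • (p - m) := by
  obtain ⟨a, b, ha, hb, hab, rfl⟩ := hm
  obtain rfl : b = 1 - a := by linarith
  have ha0 : a ≠ 0 := by
    rintro rfl
    simp at hmr
  have hb0 : 1 - a ≠ 0 := by
    intro h
    obtain rfl : a = 1 := by linarith
    simp at hmp
  have ha' : 0 < a := lt_of_le_of_ne ha ha0.symm
  have hb' : 0 < 1 - a := lt_of_le_of_ne hb hb0.symm
  refine ⟨a / (1 - a), by positivity, ?_⟩
  match_scalars <;> field_simp <;> ring

lemma false_of_four_shattered (hS : NiceShape S) {B : Finset Pt} (hB : B.card = 4)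
    (hcross : ∀ p ∈ B, ∀ q ∈ B, ∀ r ∈ B, p ≠ q → p ≠ r → q ≠ r → cross (q - p) (r - p) ≠ 0)
    (hcap : ∀ I ⊆ B, IsCaptured S B I) : False := by
  classical
  have hdep : ¬ AffineIndependent ℝ (fun x : B => (x : Pt)) := by
    intro hind
    have h1 := hind.card_le_finrank_succ
    have h2 := Submodule.finrank_le (vectorSpan ℝ (Set.range fun x : B => (x : Pt)))
    rw [finrank_euclideanSpace_fin] at h2
    rw [Fintype.card_coe, hB] at h1
    omega
  obtain ⟨I, m, hmI, hmIc⟩ := Convex.radon_partition hdep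
  have main : ∀ A ⊆ B, A.card ≤ 2 → m ∈ convexHull ℝ (A : Set Pt) →
      m ∈ convexHull ℝ ((B \ A : Finset Pt) : Set Pt) → False := by
    intro A hAB hcard hmA hmB
    have hconv (c : ℝ) (v : Pt) : Convex ℝ ((fun y => c • y + v) '' S) := by
      simpa only [add_comm] using hS.2.1.affinity v c
    have hBcard : (B \ A).card = 4 - A.card := by rw [Finset.card_sdiff_of_subset hAB, hB]
    obtain ⟨c₁, v₁, hc₁, hcap₁⟩ := hcap A hAB
    obtain ⟨c₂, v₂, hc₂, hcap₂⟩ := hcap (B \ A) Finset.sdiff_subset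
    have hm₁ : m ∈ (fun y => c₁ • y + v₁) '' S :=
      convexHull_min (fun x hx => (hcap₁ x (hAB hx)).2 hx) (hconv c₁ v₁) hmA
    have hm₂ : m ∈ (fun y => c₂ • y + v₂) '' S :=
      convexHull_min (fun x hx => (hcap₂ x (Finset.sdiff_subset hx)).2 hx) (hconv c₂ v₂) hmB
    have hmem₁ : ∀ x ∈ A, x ∈ (fun y => c₁ • y + v₁) '' S ∧ x ∉ (fun y => c₂ • y + v₂) '' S :=
      fun x hx => ⟨(hcap₁ x (hAB hx)).2 hx, fun h =>
        (Finset.mem_sdiff.1 ((hcap₂ x (hAB hx)).1 h)).2 hx⟩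
    have hmem₂ : ∀ x ∈ B \ A, x ∉ (fun y => c₁ • y + v₁) '' S ∧ x ∈ (fun y => c₂ • y + v₂) '' S :=
      fun x hx => ⟨fun h => (Finset.mem_sdiff.1 hx).2 ((hcap₁ x (Finset.sdiff_subset hx)).1 h),
        (hcap₂ x (Finset.sdiff_subset hx)).2 hx⟩
    have hmA' : m ∉ A := fun h => (hmem₁ m h).2 hm₂
    have hmB' : m ∉ B \ A := fun h => (hmem₂ m h).1 hm₁
    interval_cases hA : A.card
    · rw [Finset.card_eq_zero.1 hA] at hmA
      simp at hmA
    · obtain ⟨p, rfl⟩ := Finset.card_eq_one.1 hA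
      simp only [Finset.coe_singleton, convexHull_singleton] at hmA
      exact hmA' (by simpa using hmA)
    · obtain ⟨p, r, hpr, rfl⟩ := Finset.card_eq_two.1 hA
      obtain ⟨q, s, hqs, hBA⟩ := Finset.card_eq_two.1 hBcard
      rw [hBA] at hmB hmem₂ hmB'
      simp only [Finset.coe_insert, Finset.coe_singleton, convexHull_pair] at hmA hmB
      simp only [Finset.mem_insert, Finset.mem_singleton, not_or] at hmA' hmB'
      obtain ⟨ρ, hρ, hr⟩ := exists_sub_eq_neg_smul hmA hmA'.1 hmA'.2
      obtain ⟨σ, hσ, hs⟩ := exists_sub_eq_neg_smul hmB hmB'.1 hmB'.2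
      have hpmem := hmem₁ p (by simp)
      have hrmem := hmem₁ r (by simp)
      have hqmem := hmem₂ q (by simp)
      have hsmem := hmem₂ s (by simp)
      have hpB : p ∈ B := hAB (by simp)
      have hrB : r ∈ B := hAB (by simp)
      have hqB : q ∈ B ∧ ¬ (q = p ∨ q = r) := by
        have : q ∈ B \ {p, r} := by simp [hBA]
        simpa using this
      have hqp : q ≠ p := fun h => hqB.2 (Or.inl h)
      have hqr : q ≠ r := fun h => hqB.2 (Or.inr h)
      have hne : cross (p - m) (q - m) ≠ 0 := by
        intro h0
        apply hcross p hpB r hrB q hqB.1 hpr hqp.symm hqr.symm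
        have h1 : r - p = -(1 + ρ) • (p - m) := by
          rw [hr]
          module
        have h2 : cross (r - p) (q - p) = -(1 + ρ) * cross (p - m) (q - m) := by
          rw [h1]
          simp only [cross, PiLp.smul_apply, PiLp.sub_apply, smul_eq_mul]
          ring
        rw [h2, h0, mul_zero]
      have hne' : cross (q - m) (p - m) ≠ 0 := by
        have : cross (q - m) (p - m) = -cross (p - m) (q - m) := by
          simp only [cross]
          ring
        rwa [this, neg_ne_zero]
      have hp' : p = m + (p - m) := by abel
      have hq' : q = m + (q - m) := by abel
      rw [hr] at hrmem
      rw [hs] at hsmem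
      rw [hp'] at hpmem
      rw [hq'] at hqmem
      rcases le_total c₂ c₁ with hc | hc
      · exact false_of_crossing hS.1 hS.2.1 hS.2.2.1 hc₂.le hc hne hρ hσ hpmem.1 hrmem.1 hqmem.1
          hsmem.1 hpmem.2 hrmem.2 hqmem.2 hsmem.2
      · exact false_of_crossing hS.1 hS.2.1 hS.2.2.1 hc₁.le hc hne' hσ hρ hqmem.2 hsmem.2 hpmem.2
          hrmem.2 hqmem.1 hsmem.1 hpmem.1 hrmem.1
  let A : Finset Pt := B.filter fun x => ∃ h : x ∈ B, (⟨x, h⟩ : B) ∈ I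
  have hA : (fun x : B => (x : Pt)) '' I = (A : Set Pt) := by
    ext x
    simp only [A, Set.mem_image, Subtype.exists, Finset.coe_filter, Set.mem_ofPred_eq]
    grind
  have hAc : (fun x : B => (x : Pt)) '' Iᶜ = ((B \ A : Finset Pt) : Set Pt) := by
    ext x
    simp only [A, Set.mem_image, Subtype.exists, Finset.coe_sdiff, Finset.coe_filter,
      Set.mem_sdiff, Set.mem_ofPred_eq, Set.mem_compl_iff, Finset.mem_coe]
    grind
  rw [hA] at hmI
  rw [hAc] at hmIc
  have hAB : A ⊆ B := Finset.filter_subset _ _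
  rcases le_total A.card 2 with h | h
  · exact main A hAB h hmI hmIc
  · refine main (B \ A) Finset.sdiff_subset ?_ hmIc ?_
    · rw [Finset.card_sdiff_of_subset hAB, hB]
      omega
    · rwa [Finset.sdiff_sdiff_eq_self hAB]

end Captured

section Assembly

variable {S : Set Pt} {X : Finset Pt}

open scoped Classical in
/-- A triple that can be circumscribed without touching further points of `X` is shattered
with a fixed trace on the remaining points. -/
lemma NiceShape.exists_strongly_shattered (hS : NiceShape S) {p q r : Pt}
    (h : cross (q - p) (r - p) ≠ 0)
    (hfree : ∀ (t : ℝ) (w : Pt), 0 < t → t • p + w ∈ frontier S → t • q + w ∈ frontier S →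
      t • r + w ∈ frontier S → ∀ x ∈ X \ {p, q, r}, t • x + w ∉ frontier S) :
    ∃ C ⊆ X \ {p, q, r}, ∀ B ⊆ ({p, q, r} : Finset Pt), IsCaptured S X (B ∪ C) := by
  obtain ⟨t, w, ht, hp, hq, hr⟩ := hS.exists_inscribed h
  have hpq : p ≠ q := by
    rintro rfl
    simp [cross] at h
  have hpr : p ≠ r := by
    rintro rfl
    simp [cross] at h
  have hqr : q ≠ r := by
    rintro rfl
    exact h (by simp only [cross]; ring)
  have hinj : Function.Injective ![p, q, r] := by
    intro i j hij
    fin_cases i <;> fin_cases j <;> simp_all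
  have hfr : ∀ i, t • (![p, q, r] i) + w ∈ frontier S := by
    intro i
    fin_cases i
    exacts [hp, hq, hr]
  refine ⟨(X \ {p, q, r}).filter fun x => t • x + w ∈ S, Finset.filter_subset _ _,
    fun B hB => ?_⟩
  obtain ⟨t', w', ht', hσ, hF⟩ := hS.exists_perturbation hinj ht hfr (X \ {p, q, r})
    (hfree t w ht hp hq hr) fun i => ![p, q, r] i ∈ B
  refine IsCaptured.of_placement ht' (w := w') fun x hx => ?_
  by_cases hxP : x ∈ ({p, q, r} : Finset Pt)
  · have hx' : t' • x + w' ∈ S ↔ x ∈ B := by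
      simp only [Finset.mem_insert, Finset.mem_singleton] at hxP
      rcases hxP with rfl | rfl | rfl
      exacts [hσ 0, hσ 1, hσ 2]
    rw [hx', Finset.mem_union, Finset.mem_filter, Finset.mem_sdiff]
    tauto
  · have hxB : x ∉ B := fun hxB => hxP (hB hxB)
    rw [hF x (Finset.mem_sdiff.2 ⟨hx, hxP⟩), Finset.mem_union, Finset.mem_filter,
      Finset.mem_sdiff]
    tauto

lemma GenPos.not_mem_frontier (hX : GenPos S X) {p q r : Pt} (hp : p ∈ X) (hq : q ∈ X)
    (hr : r ∈ X) (hpq : p ≠ q) (hpr : p ≠ r) (hqr : q ≠ r) {t : ℝ} (ht : 0 < t) {w : Pt}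
    (hp' : t • p + w ∈ frontier S) (hq' : t • q + w ∈ frontier S)
    (hr' : t • r + w ∈ frontier S) {x : Pt} (hx : x ∈ X) (hxp : x ≠ p) (hxq : x ≠ q)
    (hxr : x ≠ r) : t • x + w ∉ frontier S := fun hx' =>
  hX.2.2 _ ⟨t⁻¹, -(t⁻¹ • w), inv_pos.2 ht, rfl⟩ p q r x
    ⟨hp, (mem_frontier_image_homothety_iff ht w p).2 hp'⟩
    ⟨hq, (mem_frontier_image_homothety_iff ht w q).2 hq'⟩
    ⟨hr, (mem_frontier_image_homothety_iff ht w r).2 hr'⟩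
    ⟨hx, (mem_frontier_image_homothety_iff ht w x).2 hx'⟩ hpq hpr hxp.symm hqr hxq.symm hxr.symm

lemma exists_cross_ne_zero {p q : Pt} (hpq : p ≠ q) : ∃ r : Pt, cross (q - p) (r - p) ≠ 0 := by
  by_contra! h
  have h₀ := h (p + !₂[1, 0])
  have h₁ := h (p + !₂[0, 1])
  simp [cross] at h₀ h₁
  refine hpq ?_
  ext i
  fin_cases i
  · simp; linarith
  · simp; linarith

lemma exists_ne_subset_pair (hX : X.card ≤ 2) : ∃ p q : Pt, p ≠ q ∧ X ⊆ {p, q} := by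
  obtain ⟨Z, hXZ, hZ⟩ := Infinite.exists_superset_card_eq X 2 hX
  obtain ⟨p, q, hpq, rfl⟩ := Finset.card_eq_two.1 hZ
  exact ⟨p, q, hpq, hXZ⟩

open scoped Classical in
/-- Every subset of `X` of at most three points lies in a triple that is shattered with a fixed
trace on the rest of `X`. -/
lemma GenPos.exists_strongly_shattered (hX : GenPos S X) (hS : NiceShape S) {B : Finset Pt}
    (hBX : B ⊆ X) (hB : B.card ≤ 3) :
    ∃ C ⊆ X \ B, ∀ B' ⊆ B, IsCaptured S X (B' ∪ C) := by
  obtain ⟨p, q, r, hBP, hcross, hfree⟩ : ∃ p q r : Pt, B ⊆ {p, q, r} ∧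
      cross (q - p) (r - p) ≠ 0 ∧
      ∀ (t : ℝ) (w : Pt), 0 < t → t • p + w ∈ frontier S → t • q + w ∈ frontier S →
        t • r + w ∈ frontier S → ∀ x ∈ X \ {p, q, r}, t • x + w ∉ frontier S := by
    rcases le_or_gt 3 X.card with h3 | h3
    · obtain ⟨Z, hBZ, hZX, hZ⟩ := Finset.exists_subsuperset_card_eq hBX hB h3
      obtain ⟨p, q, r, hpq, hpr, hqr, rfl⟩ := Finset.card_eq_three.1 hZ
      have hp : p ∈ X := hZX (by simp)
      have hq : q ∈ X := hZX (by simp)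
      have hr : r ∈ X := hZX (by simp)
      refine ⟨p, q, r, hBZ, hX.cross_ne_zero hp hq hr hpq hpr hqr, ?_⟩
      intro t w ht hp' hq' hr' x hx
      simp only [Finset.mem_sdiff, Finset.mem_insert, Finset.mem_singleton, not_or] at hx
      exact hX.not_mem_frontier hp hq hr hpq hpr hqr ht hp' hq' hr' hx.1 hx.2.1 hx.2.2.1 hx.2.2.2
    · obtain ⟨p, q, hpq, hXpq⟩ := exists_ne_subset_pair (Nat.le_of_lt_succ h3)
      obtain ⟨r, hr⟩ := exists_cross_ne_zero hpq
      have hsub : X ⊆ {p, q, r} := hXpq.trans (by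
        intro x hx
        simp only [Finset.mem_insert, Finset.mem_singleton] at hx ⊢
        tauto)
      refine ⟨p, q, r, hBX.trans hsub, hr, ?_⟩
      intro t w _ _ _ _ x hx
      exact absurd (hsub (Finset.mem_sdiff.1 hx).1) (Finset.mem_sdiff.1 hx).2
  obtain ⟨C, hC, h⟩ := hS.exists_strongly_shattered hcross hfree
  exact ⟨C, hC.trans (Finset.sdiff_subset_sdiff subset_rfl hBP),
    fun B' hB' => h B' (hB'.trans hBP)⟩

open scoped Classical in
lemma GenPos.card_le_three_of_shatters (hX : GenPos S X) (hS : NiceShape S) {s : Finset Pt}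
    (hs : (X.powerset.filter (IsCaptured S X)).Shatters s) : s ⊆ X ∧ s.card ≤ 3 := by
  have hsX : s ⊆ X := by
    obtain ⟨u, hu, hsu⟩ := hs.exists_superset
    exact hsu.trans (Finset.mem_powerset.1 (Finset.mem_filter.1 hu).1)
  refine ⟨hsX, ?_⟩
  by_contra! h
  obtain ⟨B, hBs, hB⟩ := Finset.exists_subset_card_eq h
  refine false_of_four_shattered hS hB
    (fun p hp q hq r hr => hX.cross_ne_zero (hsX (hBs hp)) (hsX (hBs hq)) (hsX (hBs hr)))
    fun I hI => ?_
  obtain ⟨u, hu, rfl⟩ := (hs.mono_right hBs) hI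
  obtain ⟨c, v, hc, hcv⟩ := (Finset.mem_filter.1 hu).2
  refine ⟨c, v, hc, fun x hx => ?_⟩
  rw [hcv x (hsX (hBs hx)), Finset.mem_inter]
  tauto

open scoped Classical in
/-- The number of captured subsets, the empty one included. -/
lemma GenPos.card_filter_isCaptured (hX : GenPos S X) (hS : NiceShape S) :
    (X.powerset.filter (IsCaptured S X)).card =
      X.card.choose 3 + X.card.choose 2 + X.card.choose 1 + 1 := by
  rw [← card_filter_card_le_three]
  apply le_antisymm
  · refine (Finset.card_le_card_shatterer _).trans (Finset.card_le_card fun s hs => ?_)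
    have := hX.card_le_three_of_shatters hS (Finset.mem_shatterer.1 hs)
    simpa using this
  · refine card_le_card_of_strongly_shattered (Finset.filter_subset _ _)
      (Finset.filter_subset _ _) fun B hB => ?_
    rw [Finset.mem_filter, Finset.mem_powerset] at hB
    obtain ⟨C, hC, h⟩ := hX.exists_strongly_shattered hS hB.1 hB.2
    refine ⟨C, hC, fun B' hB' => Finset.mem_filter.2 ⟨?_, h B' hB'⟩⟩
    exact Finset.mem_powerset.2
      (Finset.union_subset (hB'.trans hB.1) (hC.trans Finset.sdiff_subset))

end Assembly

/-- for a nice shape `S` and a set `X` of `n` points in general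
position with respect to `S`, the total number of non-empty captured subsets of
`X` equals the cake number `C(n,3) + C(n,2) + C(n,1)`. -/
theorem captured_total_equals_cake_number
    (S : Set Pt) (hS : NiceShape S) (X : Finset Pt) (hX : GenPos S X) :
    {Y : Set Pt | Y.Nonempty ∧ Y ⊆ ↑X ∧
        ∃ T : Set Pt, IsRange S T ∧ ↑X ∩ T = Y}.ncard =
      X.card.choose 3 + X.card.choose 2 + X.card.choose 1 := by
  classical
  have hset : {Y : Set Pt | Y.Nonempty ∧ Y ⊆ ↑X ∧ ∃ T : Set Pt, IsRange S T ∧ ↑X ∩ T = Y} =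
      (fun Y : Finset Pt => (Y : Set Pt)) ''
        ↑((X.powerset.filter (IsCaptured S X)).erase ∅) := by
    ext Y
    simp only [Set.mem_ofPred_eq, Set.mem_image, Finset.mem_coe, Finset.mem_erase,
      Finset.mem_filter, Finset.mem_powerset]
    constructor
    · rintro ⟨hne, hYX, hT⟩
      lift Y to Finset Pt using X.finite_toSet.subset hYX
      have hYX' : Y ⊆ X := Finset.coe_subset.1 hYX
      exact ⟨Y, ⟨(Finset.coe_nonempty.1 hne).ne_empty, hYX',
        (exists_isRange_inter_eq_iff hYX').1 hT⟩, rfl⟩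
    · rintro ⟨Y, ⟨hne, hYX, hc⟩, rfl⟩
      exact ⟨Finset.coe_nonempty.2 (Finset.nonempty_iff_ne_empty.2 hne),
        Finset.coe_subset.2 hYX, (exists_isRange_inter_eq_iff hYX).2 hc⟩
  have hempty : ∅ ∈ X.powerset.filter (IsCaptured S X) :=
    Finset.mem_filter.2 ⟨Finset.empty_mem_powerset X, isCaptured_empty hS.2.2.1⟩
  rw [hset, Set.ncard_image_of_injective _ Finset.coe_injective, Set.ncard_coe_finset,
    Finset.card_erase_of_mem hempty, hX.card_filter_isCaptured hS, Nat.add_sub_cancel]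
end
end
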